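/- Let a ∈ (0,2] be a Misiurewicz–Thurston parameter for the quadratic map T_a(x) = 1 − a x² on [−1,1], with ergodic absolutely continuous invariant probability measure μ. Let ζ ∈ [1−a, 1] be a periodic point of T_a of prime period p that belongs to the critical orbit O(0), and let (B_n) be open balls centred at ζ with radii tending to 0 such that n·μ(B_n) → τ for some τ > 0. Set θ = 1 − |(T_a^p)′(ζ)|^{−1/2}. Then the rescaled interarrival process μ(B_n)·Φ_{B_n} converges in distribution under μ to ν_θ (equivalently, the rare events point process of visits to B_n converges to a compound Poisson process of intensity θ whose multiplicity distribution is Geometric: π(k) = θ(1−θ)^{k−1} for k ≥ 1). -/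

import Mathlib

open MeasureTheory Filter Set ProbabilityTheory
open scoped ENNReal Topology ENat

noncomputable section

variable {X : Type*}

/-- The instant of the `i`-th visit (after time `0`) of the orbit of `x` under `T` to `B`,
with the convention that `hitInstant T B x 0 = 0` and the value is `⊤` if there is no
such visit. -/
def hitInstant (T : X → X) (B : Set X) (x : X) : ℕ → ℕ∞
  | 0 => 0
  | (i+1) => sInf {m : ℕ∞ | ∃ n : ℕ, hitInstant T B x i < (n : ℕ∞) ∧ T^[n] x ∈ B ∧ m = (n : ℕ∞)}

/-- The first hitting time `r_B(x) = inf {k ≥ 1 : T^k x ∈ B}` (with value `⊤` if the orbit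
never enters `B`). -/
def hitTime (T : X → X) (B : Set X) (x : X) : ℕ∞ := hitInstant T B x 1

/-- The `i`-th interarrival time (gap between the `i`-th and `(i+1)`-st visits);
`interGap T B 0 x` is the first hitting time `r_B^{(1)}(x)`, and once some
visit fails to occur, all subsequent gaps are `⊤`. -/
def interGap (T : X → X) (B : Set X) (i : ℕ) (x : X) : ℝ≥0∞ :=
  if hitInstant T B x i = ⊤ then ⊤
  else ((hitInstant T B x (i+1) - hitInstant T B x i : ℕ∞) : ℝ≥0∞)

/-- The shadow set `E'_A = ⋃_{k ≥ 0} (A ∩ {r_A > k} ∩ T^{-k} E)` of `E` in `A`. -/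
def shadow (T : X → X) (A E : Set X) : Set X :=
  ⋃ k : ℕ, A ∩ {x | (k : ℕ∞) < hitTime T A x} ∩ (T^[k]) ⁻¹' E

/-- The induced (first-return) map `T_A(x) = T^{r_A(x)}(x)` (junk value `x` if the orbit of
`x` never returns to `A`). -/
def inducedMap (T : X → X) (A : Set X) (x : X) : X :=
  T^[sInf {n : ℕ | 1 ≤ n ∧ T^[n] x ∈ A}] x

/-- The rescaled interarrival process `c · Φ_B : x ↦ (c · r_B^{(i)}(x))_{i ≥ 1}`,
as a random element of `ℕ → ℝ≥0∞`. -/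
def rescaledProcess (T : X → X) (B : Set X) (c : ℝ≥0∞) (x : X) : ℕ → ℝ≥0∞ :=
  fun i => c * interGap T B i x

/-- Convergence in distribution: the laws of the random elements `f n : X → (ℕ → ℝ≥0∞)`
under the measures `P n` converge weakly to `ν` (tested against bounded continuous
real functions, with `ℕ → ℝ≥0∞` carrying the product topology). -/
def ConvInDist [MeasurableSpace X] (P : ℕ → Measure X)
    (f : ℕ → X → (ℕ → ℝ≥0∞)) (ν : Measure (ℕ → ℝ≥0∞)) : Prop :=
  ∀ g : BoundedContinuousFunction (ℕ → ℝ≥0∞) ℝ,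
    Tendsto (fun n => ∫ x, g (f n x) ∂(P n)) atTop (𝓝 (∫ y, g y ∂ν))

end

/-- The quadratic map `T_a(x) = 1 - a x²`. -/
def Ta (a : ℝ) : ℝ → ℝ := fun x => 1 - a * x ^ 2

/-- The exponential law of rate `θ`, pushed forward to `ℝ≥0∞`. -/
noncomputable def expLawENN (θ : ℝ) : Measure ℝ≥0∞ :=
  (ProbabilityTheory.expMeasure θ).map ENNReal.ofReal

/-- The law of the `i`-th coordinate of the interarrival process of a compound Poisson
process of intensity `θ` with Geometric(θ) multiplicity distribution: the first coordinate
is `Exp(θ)` and the following ones are `(1-θ)·δ₀ + θ·Exp(θ)`. -/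
noncomputable def coordLaw (θ : ℝ) : ℕ → Measure ℝ≥0∞ :=
  fun i => if i = 0 then expLawENN θ
    else ENNReal.ofReal (1 - θ) • Measure.dirac 0 + ENNReal.ofReal θ • expLawENN θ

/-- `ν` is the law `ν_θ` on `[0,∞]^ℕ` of the sequence `(G_i)` of independent random
variables with `G_1 ∼ Exp(θ)` and `G_i ∼ (1-θ)δ₀ + θ Exp(θ)` for `i ≥ 2`: a probability
measure all of whose finite-dimensional marginals are the corresponding product laws
(this determines `ν` uniquely). -/
def IsNuTheta (θ : ℝ) (ν : Measure (ℕ → ℝ≥0∞)) : Prop :=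
  IsProbabilityMeasure ν ∧
    ∀ m : ℕ, ν.map (fun ω : ℕ → ℝ≥0∞ => fun i : Fin m => ω (i : ℕ)) =
      Measure.pi (fun i : Fin m => coordLaw θ (i : ℕ))

section Interarrival

variable {X : Type*} (T : X → X) (B : Set X)

/-- The next visit instant strictly after `s`. -/
noncomputable def nextVisit (x : X) (s : ℕ∞) : ℕ∞ :=
  sInf {m : ℕ∞ | ∃ n : ℕ, s < (n : ℕ∞) ∧ T^[n] x ∈ B ∧ m = (n : ℕ∞)}

theorem hitInstant_succ (x : X) (i : ℕ) :
    hitInstant T B x (i + 1) = nextVisit T B x (hitInstant T B x i) := by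
  rw [hitInstant]; rfl

theorem nextVisit_add_one (x : X) (s : ℕ∞) :
    nextVisit T B x (s + 1) = nextVisit T B (T x) s + 1 := by
  apply le_antisymm
  · unfold nextVisit
    rcases Set.eq_empty_or_nonempty
      {m : ℕ∞ | ∃ n : ℕ, s < (n : ℕ∞) ∧ T^[n] (T x) ∈ B ∧ m = (n : ℕ∞)} with h | h
    · rw [h]; simp
    · obtain ⟨n, hn, hB, hm⟩ := csInf_mem h
      rw [hm]
      refine sInf_le ⟨n + 1, ?_, by simpa using hB, by push_cast; rfl⟩
      push_cast
      exact (ENat.add_lt_add_iff_right (by simp)).2 hn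
  · refine le_sInf ?_
    rintro _ ⟨n, hn, hB, rfl⟩
    cases n with
    | zero => simp at hn
    | succ n =>
      push_cast at hn ⊢
      gcongr
      refine sInf_le ⟨n, (ENat.add_lt_add_iff_right (by simp)).1 hn, by simpa using hB, rfl⟩

theorem nextVisit_zero_of_mem {x : X} (h : T x ∈ B) : nextVisit T B x 0 = 1 := by
  apply le_antisymm
  · exact sInf_le ⟨1, by simp, by simpa using h, by simp⟩
  · refine le_sInf ?_
    rintro _ ⟨n, hn, -, rfl⟩
    exact Order.one_le_iff_pos.2 hn

theorem nextVisit_zero_of_notMem {x : X} (h : T x ∉ B) :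
    nextVisit T B x 0 = nextVisit T B (T x) 0 + 1 := by
  rw [← nextVisit_add_one]
  unfold nextVisit
  congr 1
  ext m
  constructor
  · rintro ⟨n, hn, hB, rfl⟩
    refine ⟨n, ?_, hB, rfl⟩
    have h1 : n ≠ 1 := by rintro rfl; exact h (by simpa using hB)
    have h0 : 0 < n := by exact_mod_cast hn
    have : 1 < n := by omega
    rw [zero_add]; exact_mod_cast this
  · rintro ⟨n, hn, hB, rfl⟩
    exact ⟨n, lt_of_le_of_lt bot_le hn, hB, rfl⟩

theorem hitInstant_of_mem {x : X} (h : T x ∈ B) (i : ℕ) :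
    hitInstant T B x (i + 1) = hitInstant T B (T x) i + 1 := by
  induction i with
  | zero => rw [hitInstant_succ, hitInstant, nextVisit_zero_of_mem T B h, hitInstant]; simp
  | succ i ih => rw [hitInstant_succ, ih, nextVisit_add_one, hitInstant_succ]

theorem hitInstant_of_notMem {x : X} (h : T x ∉ B) (i : ℕ) :
    hitInstant T B x (i + 1) = hitInstant T B (T x) (i + 1) + 1 := by
  induction i with
  | zero =>
    rw [hitInstant_succ, hitInstant, nextVisit_zero_of_notMem T B h, hitInstant_succ, hitInstant]
  | succ i ih => rw [hitInstant_succ, ih, nextVisit_add_one, ← hitInstant_succ]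

theorem enat_add_one_sub (m n : ℕ∞) : m + 1 - (n + 1) = m - n := by
  refine eq_of_forall_ge_iff fun c => ?_
  rw [tsub_le_iff_right, tsub_le_iff_right, ← add_assoc]
  exact ENat.add_le_add_iff_right (by simp)

theorem interGap_zero_of_mem {x : X} (h : T x ∈ B) : interGap T B 0 x = 1 := by
  simp only [interGap, hitInstant_of_mem T B h]
  simp [hitInstant]

theorem interGap_succ_of_mem {x : X} (h : T x ∈ B) (i : ℕ) :
    interGap T B (i + 1) x = interGap T B i (T x) := by
  simp only [interGap, hitInstant_of_mem T B h]
  rw [enat_add_one_sub]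
  simp

theorem interGap_zero_of_notMem {x : X} (h : T x ∉ B) :
    interGap T B 0 x = interGap T B 0 (T x) + 1 := by
  simp only [interGap, hitInstant_of_notMem T B h]
  simp [hitInstant]

theorem interGap_succ_of_notMem {x : X} (h : T x ∉ B) (i : ℕ) :
    interGap T B (i + 1) x = interGap T B (i + 1) (T x) := by
  simp only [interGap, hitInstant_of_notMem T B h]
  rw [enat_add_one_sub]
  simp

theorem nextVisit_eq_coe {x : X} {s : ℕ∞} {n : ℕ} (h : s < n ∧ T^[n] x ∈ B)
    (hlt : ∀ k < n, ¬ (s < k ∧ T^[k] x ∈ B)) : nextVisit T B x s = n := by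
  refine le_antisymm ?_ (le_sInf ?_)
  · exact sInf_le ⟨n, h.1, h.2, rfl⟩
  rintro _ ⟨k, h1, h2, rfl⟩
  by_contra hk
  exact hlt k (by exact_mod_cast not_le.1 hk) ⟨h1, h2⟩

theorem measurableSet_hitInstant_eq [MeasurableSpace X] (hT : Measurable T) (hB : MeasurableSet B)
    (i : ℕ) (m : ℕ∞) : MeasurableSet {x | hitInstant T B x i = m} := by
  induction i generalizing m with
  | zero => simp only [hitInstant]; exact MeasurableSet.const _
  | succ i ih =>
    have hP : ∀ k : ℕ, MeasurableSet {x | hitInstant T B x i < k ∧ T^[k] x ∈ B} := by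
      intro k
      have : {x | hitInstant T B x i < k} =
          ⋃ m : ℕ∞, ⋃ _ : m < k, {x | hitInstant T B x i = m} := by ext x; simp
      have h1 : MeasurableSet {x | hitInstant T B x i < k} := by
        rw [this]
        exact MeasurableSet.iUnion fun m => MeasurableSet.iUnion fun _ => ih m
      exact h1.inter ((hT.iterate k) hB)
    have hfin : ∀ n : ℕ, MeasurableSet {x | hitInstant T B x (i + 1) = n} := by
      intro n
      have : {x | hitInstant T B x (i + 1) = n} =
          {x | hitInstant T B x i < n ∧ T^[n] x ∈ B} ∩
          ⋂ k : ℕ, ⋂ _ : k < n, {x | hitInstant T B x i < k ∧ T^[k] x ∈ B}ᶜ := by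
        ext x
        simp only [hitInstant_succ, mem_ofPred_eq, mem_inter_iff, mem_iInter, mem_compl_iff]
        refine ⟨fun h => ?_, fun h => nextVisit_eq_coe T B h.1 h.2⟩
        have hne : {m : ℕ∞ | ∃ n : ℕ, hitInstant T B x i < (n : ℕ∞) ∧ T^[n] x ∈ B ∧
            m = (n : ℕ∞)}.Nonempty := by
          by_contra hne
          rw [Set.not_nonempty_iff_eq_empty] at hne
          simp [nextVisit, hne] at h
        obtain ⟨n', h1, h2, h3⟩ := csInf_mem hne
        have : (n : ℕ∞) = n' := by rw [← h3, ← h]; rfl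
        have hnn : n = n' := by exact_mod_cast this
        subst hnn
        refine ⟨⟨h1, h2⟩, fun k hk hk2 => ?_⟩
        have h4 : nextVisit T B x (hitInstant T B x i) ≤ k := sInf_le ⟨k, hk2.1, hk2.2, rfl⟩
        rw [h] at h4
        exact absurd (by exact_mod_cast h4) (not_le.2 hk)
      rw [this]
      exact (hP n).inter (MeasurableSet.iInter fun k => MeasurableSet.iInter fun _ => (hP k).compl)
    cases m with
    | top =>
      have : {x | hitInstant T B x (i + 1) = ⊤} =
          (⋃ n : ℕ, {x | hitInstant T B x (i + 1) = n})ᶜ := by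
        ext x
        simp only [mem_ofPred_eq, mem_compl_iff, mem_iUnion]
        rw [← not_iff_not, not_not, ← ne_eq, ENat.ne_top_iff_exists]
        simp [eq_comm]
      rw [this]
      exact (MeasurableSet.iUnion hfin).compl
    | coe n => exact hfin n

theorem measurable_interGap [MeasurableSpace X] (hT : Measurable T) (hB : MeasurableSet B)
    (i : ℕ) : Measurable fun x => interGap T B i x := by
  intro s _
  have : (fun x => interGap T B i x) ⁻¹' s = ⋃ m : ℕ∞, ⋃ n : ℕ∞,
      ⋃ _ : (if m = ⊤ then (⊤ : ℝ≥0∞) else ((n - m : ℕ∞) : ℝ≥0∞)) ∈ s,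
      {x | hitInstant T B x i = m} ∩ {x | hitInstant T B x (i + 1) = n} := by
    ext x
    simp only [mem_preimage, interGap, mem_iUnion, mem_inter_iff, mem_ofPred_eq, exists_prop]
    constructor
    · intro h; exact ⟨_, _, h, rfl, rfl⟩
    · rintro ⟨m, n, h, rfl, rfl⟩; exact h
  rw [this]
  exact MeasurableSet.iUnion fun m => MeasurableSet.iUnion fun n => MeasurableSet.iUnion fun _ =>
    (measurableSet_hitInstant_eq T B hT hB i m).inter (measurableSet_hitInstant_eq T B hT hB _ n)

theorem measurable_rescaledProcess [MeasurableSpace X] (hT : Measurable T)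
    (hB : MeasurableSet B) (c : ℝ≥0∞) : Measurable (rescaledProcess T B c) :=
  measurable_pi_lambda _ fun i => (measurable_interGap T B hT hB i).const_mul c

end Interarrival

section Laplace

/-- The function `x ↦ e^{-x}` on `[0,∞]`. -/
noncomputable def expNeg (x : ℝ≥0∞) : ℝ := if x = ⊤ then 0 else Real.exp (-x.toReal)

theorem expNeg_nonneg (x : ℝ≥0∞) : 0 ≤ expNeg x := by
  unfold expNeg; split_ifs <;> positivity

theorem expNeg_le_one (x : ℝ≥0∞) : expNeg x ≤ 1 := by
  unfold expNeg; split_ifs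
  · exact zero_le_one
  · exact Real.exp_le_one_iff.2 (by simp)

theorem expNeg_add (x y : ℝ≥0∞) : expNeg (x + y) = expNeg x * expNeg y := by
  unfold expNeg
  by_cases hx : x = ⊤
  · simp [hx]
  by_cases hy : y = ⊤
  · simp [hy]
  simp [hx, hy, ENNReal.toReal_add hx hy, ← Real.exp_add, add_comm]

theorem expNeg_of_ne_top {x : ℝ≥0∞} (hx : x ≠ ⊤) : expNeg x = Real.exp (-x.toReal) := by
  simp [expNeg, hx]

theorem expNeg_injective : Function.Injective expNeg := by
  intro x y h
  unfold expNeg at h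
  split_ifs at h with hx hy hy
  · rw [hx, hy]
  · exact absurd h.symm (Real.exp_ne_zero _)
  · exact absurd h (Real.exp_ne_zero _)
  · have := Real.exp_injective h
    exact (ENNReal.toReal_eq_toReal_iff' hx hy).1 (neg_injective this)

theorem continuous_expNeg : Continuous expNeg := by
  rw [continuous_iff_continuousAt]
  intro x
  by_cases hx : x = ⊤
  · subst hx
    have h0 : expNeg ⊤ = 0 := by simp [expNeg]
    rw [ContinuousAt, h0]
    rw [Metric.tendsto_nhds]
    intro ε hε
    have h1 : Tendsto (fun t : ℝ => Real.exp (-t)) atTop (𝓝 0) := Real.tendsto_exp_neg_atTop_nhds_zero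
    obtain ⟨M, hM⟩ := (h1.eventually (gt_mem_nhds hε)).exists_forall_of_atTop
    have h2 : ∀ᶠ y in 𝓝 (⊤ : ℝ≥0∞), ENNReal.ofReal M < y := lt_mem_nhds (by simp)
    filter_upwards [h2] with y hy
    rw [Real.dist_eq, sub_zero, abs_of_nonneg (expNeg_nonneg y)]
    unfold expNeg
    split_ifs with h
    · exact hε
    · exact hM _ ((ENNReal.ofReal_le_iff_le_toReal h).1 hy.le)
  · have h1 : ContinuousAt (fun y : ℝ≥0∞ => Real.exp (-y.toReal)) x :=
      (Real.continuous_exp.comp continuous_neg).continuousAt.comp (ENNReal.continuousAt_toReal hx)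
    refine h1.congr ?_
    filter_upwards [isOpen_ne.mem_nhds hx] with y hy
    rw [expNeg_of_ne_top hy]

/-- The multivariate Laplace functional with integer exponents `l`. -/
noncomputable def lap : List ℕ → (ℕ → ℝ≥0∞) → ℝ
  | [], _ => 1
  | k :: l, ω => expNeg (ω 0) ^ k * lap l (fun i => ω (i + 1))

theorem lap_nonneg (l : List ℕ) (ω : ℕ → ℝ≥0∞) : 0 ≤ lap l ω := by
  induction l generalizing ω with
  | nil => simp [lap]
  | cons k l ih => exact mul_nonneg (pow_nonneg (expNeg_nonneg _) _) (ih _)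

theorem lap_le_one (l : List ℕ) (ω : ℕ → ℝ≥0∞) : lap l ω ≤ 1 := by
  induction l generalizing ω with
  | nil => simp [lap]
  | cons k l ih =>
    exact mul_le_one₀ (pow_le_one₀ (expNeg_nonneg _) (expNeg_le_one _)) (lap_nonneg _ _) (ih _)

theorem continuous_lap (l : List ℕ) : Continuous (lap l) := by
  induction l with
  | nil => exact continuous_const
  | cons k l ih =>
    exact ((continuous_expNeg.comp (continuous_apply 0)).pow k).mul
      (ih.comp (continuous_pi fun i => continuous_apply (i + 1)))

variable {X : Type*} (T : X → X) (B : Set X) (c : ℝ≥0∞)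

/-- The Laplace functional of the rescaled interarrival process. -/
noncomputable def procLap (l : List ℕ) (x : X) : ℝ := lap l (rescaledProcess T B c x)

theorem procLap_nonneg (l : List ℕ) (x : X) : 0 ≤ procLap T B c l x := lap_nonneg _ _

theorem procLap_le_one (l : List ℕ) (x : X) : procLap T B c l x ≤ 1 := lap_le_one _ _

theorem measurable_procLap [MeasurableSpace X] (hT : Measurable T) (hB : MeasurableSet B)
    (l : List ℕ) : Measurable (procLap T B c l) :=
  (continuous_lap l).measurable.comp (measurable_rescaledProcess T B hT hB c)

theorem procLap_nil (x : X) : procLap T B c [] x = 1 := rfl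

theorem procLap_of_mem {x : X} (h : T x ∈ B) (k : ℕ) (l : List ℕ) :
    procLap T B c (k :: l) x = expNeg c ^ k * procLap T B c l (T x) := by
  simp only [procLap, lap, rescaledProcess, interGap_zero_of_mem T B h, mul_one,
    interGap_succ_of_mem T B h]
  rfl

theorem procLap_of_notMem {x : X} (h : T x ∉ B) (k : ℕ) (l : List ℕ) :
    procLap T B c (k :: l) x = expNeg c ^ k * procLap T B c (k :: l) (T x) := by
  simp only [procLap, lap, rescaledProcess, interGap_zero_of_notMem T B h, mul_add, mul_one,
    interGap_succ_of_notMem T B h, expNeg_add, mul_pow]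
  ring

open Classical in
/-- The number of visits to `B` at times `1, …, N`. -/
noncomputable def numVisits : ℕ → X → ℕ
  | 0, _ => 0
  | N + 1, x => (if T x ∈ B then 1 else 0) + numVisits N (T x)

theorem procLap_bounds (l : List ℕ) (N : ℕ) (x : X) :
    expNeg c ^ (N * l.sum) * procLap T B c (l.drop (numVisits T B N x)) (T^[N] x)
      ≤ procLap T B c l x ∧
    procLap T B c l x ≤ procLap T B c (l.drop (numVisits T B N x)) (T^[N] x) := by
  have hc0 := expNeg_nonneg c
  have hc1 := expNeg_le_one c
  induction N generalizing l x with
  | zero => simp [numVisits]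
  | succ N ih =>
    cases l with
    | nil => simp [procLap_nil]
    | cons k l =>
      have hk1 : expNeg c ^ k ≤ 1 := pow_le_one₀ hc0 hc1
      by_cases h : T x ∈ B
      · obtain ⟨h1, h2⟩ := ih l (T x)
        rw [procLap_of_mem T B c h]
        simp only [numVisits, h, if_true, Function.iterate_succ, Function.comp]
        rw [add_comm 1, List.drop_succ_cons]
        refine ⟨?_, ?_⟩
        · calc _ ≤ expNeg c ^ (k + N * l.sum) *
              procLap T B c (l.drop (numVisits T B N (T x))) (T^[N] (T x)) := by
                refine mul_le_mul_of_nonneg_right ?_ (procLap_nonneg _ _ _ _ _)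
                refine pow_le_pow_of_le_one hc0 hc1 ?_
                rw [List.sum_cons]; nlinarith [Nat.zero_le (N * k), Nat.zero_le l.sum]
            _ ≤ _ := by
                rw [pow_add, mul_assoc]
                exact mul_le_mul_of_nonneg_left h1 (pow_nonneg hc0 _)
        · exact (mul_le_of_le_one_left (procLap_nonneg _ _ _ _ _) hk1).trans h2
      · obtain ⟨h1, h2⟩ := ih (k :: l) (T x)
        rw [procLap_of_notMem T B c h]
        simp only [numVisits, h, if_false, Function.iterate_succ, Function.comp, zero_add]
        refine ⟨?_, ?_⟩
        · calc _ ≤ expNeg c ^ (k + N * (k :: l).sum) *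
              procLap T B c ((k :: l).drop (numVisits T B N (T x))) (T^[N] (T x)) := by
                refine mul_le_mul_of_nonneg_right ?_ (procLap_nonneg _ _ _ _ _)
                refine pow_le_pow_of_le_one hc0 hc1 ?_
                rw [List.sum_cons]; nlinarith [Nat.zero_le (N * k), Nat.zero_le l.sum]
            _ ≤ _ := by
                rw [pow_add, mul_assoc]
                exact mul_le_mul_of_nonneg_left h1 (pow_nonneg hc0 _)
        · exact (mul_le_of_le_one_left (procLap_nonneg _ _ _ _ _) hk1).trans h2

end Laplace

section Law

theorem lap_eq_prod (l : List ℕ) (ω : ℕ → ℝ≥0∞) :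
    lap l ω = ∏ i : Fin l.length, expNeg (ω i) ^ l.get i := by
  induction l generalizing ω with
  | nil => simp [lap]
  | cons k l ih =>
    rw [lap, ih]
    simp only [List.length_cons]
    rw [Fin.prod_univ_succ]
    simp

theorem exists_lap_mul (l l' : List ℕ) : ∃ m, ∀ ω, lap l ω * lap l' ω = lap m ω := by
  induction l generalizing l' with
  | nil => exact ⟨l', fun ω => by simp [lap]⟩
  | cons k l ih =>
    cases l' with
    | nil => exact ⟨k :: l, fun ω => by simp [lap]⟩
    | cons k' l' =>
      obtain ⟨m, hm⟩ := ih l'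
      refine ⟨(k + k') :: m, fun ω => ?_⟩
      simp only [lap]
      rw [← hm]
      ring

theorem exists_lap_eq_expNeg (i : ℕ) : ∃ l, ∀ ω : ℕ → ℝ≥0∞, lap l ω = expNeg (ω i) := by
  induction i with
  | zero => exact ⟨[1], fun ω => by simp [lap]⟩
  | succ i ih =>
    obtain ⟨l, hl⟩ := ih
    exact ⟨0 :: l, fun ω => by simp [lap, hl]⟩

/-- `lap l` as a continuous map. -/
noncomputable def lapMap (l : List ℕ) : C(ℕ → ℝ≥0∞, ℝ) := ⟨lap l, continuous_lap l⟩

theorem span_lapMap_dense : closure ((Submodule.span ℝ (range lapMap) :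
    Submodule ℝ C(ℕ → ℝ≥0∞, ℝ)) : Set C(ℕ → ℝ≥0∞, ℝ)) = univ := by
  let M : Submonoid C(ℕ → ℝ≥0∞, ℝ) :=
    { carrier := range lapMap
      mul_mem' := by
        rintro _ _ ⟨l, rfl⟩ ⟨l', rfl⟩
        obtain ⟨m, hm⟩ := exists_lap_mul l l'
        exact ⟨m, by ext ω; exact (hm ω).symm⟩
      one_mem' := ⟨[], by ext ω; rfl⟩ }
  have hM : (Subalgebra.toSubmodule (Algebra.adjoin ℝ (range lapMap)) :
      Submodule ℝ C(ℕ → ℝ≥0∞, ℝ)) = Submodule.span ℝ (range lapMap) := by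
    rw [Algebra.adjoin_eq_span]
    congr 1
    have : Submonoid.closure (range lapMap) = M := Submonoid.closure_eq M
    rw [this]; rfl
  have hsep : (Algebra.adjoin ℝ (range lapMap)).SeparatesPoints := by
    intro x y hxy
    obtain ⟨i, hi⟩ := Function.ne_iff.1 hxy
    obtain ⟨l, hl⟩ := exists_lap_eq_expNeg i
    refine ⟨lapMap l, ⟨lapMap l, Algebra.subset_adjoin ⟨l, rfl⟩, rfl⟩, ?_⟩
    change lap l x ≠ lap l y
    rw [hl, hl]
    exact fun h => hi (expNeg_injective h)
  have h := ContinuousMap.subalgebra_topologicalClosure_eq_top_of_separatesPoints _ hsep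
  rw [← hM]
  have h2 := congrArg (fun A : Subalgebra ℝ C(ℕ → ℝ≥0∞, ℝ) => (A : Set C(ℕ → ℝ≥0∞, ℝ))) h
  simpa using h2

theorem convInDist_of_lap {X : Type*} [MeasurableSpace X] (μ : Measure X) [IsProbabilityMeasure μ]
    (f : ℕ → X → (ℕ → ℝ≥0∞)) (hf : ∀ n, Measurable (f n))
    (ν : Measure (ℕ → ℝ≥0∞)) [IsProbabilityMeasure ν]
    (h : ∀ l, Tendsto (fun n => ∫ x, lap l (f n x) ∂μ) atTop (𝓝 (∫ y, lap l y ∂ν))) :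
    ConvInDist (fun _ => μ) f ν := by
  have hbd : ∀ g : C(ℕ → ℝ≥0∞, ℝ), ∀ ω, ‖g ω‖ ≤ ‖g‖ := fun g ω => g.norm_coe_le_norm ω
  have hi : ∀ g : C(ℕ → ℝ≥0∞, ℝ), ∀ n, Integrable (fun x => g (f n x)) μ := fun g n =>
    Integrable.of_bound ((g.continuous.measurable.comp (hf n)).aestronglyMeasurable) ‖g‖
      (ae_of_all _ fun x => hbd g _)
  have hiν : ∀ g : C(ℕ → ℝ≥0∞, ℝ), Integrable (fun y => g y) ν := fun g =>
    Integrable.of_bound (g.continuous.measurable.aestronglyMeasurable) ‖g‖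
      (ae_of_all _ fun x => hbd g _)
  have hspan : ∀ g ∈ Submodule.span ℝ (range lapMap),
      Tendsto (fun n => ∫ x, g (f n x) ∂μ) atTop (𝓝 (∫ y, g y ∂ν)) := by
    intro g hg
    induction hg using Submodule.span_induction with
    | mem g hg => obtain ⟨l, rfl⟩ := hg; exact h l
    | zero => simp
    | add g g' _ _ h1 h2 =>
      simp only [ContinuousMap.add_apply]
      rw [integral_add (hiν g) (hiν g')]
      simp_rw [fun n => integral_add (hi g n) (hi g' n)]
      exact h1.add h2
    | smul c g _ h1 =>
      simp only [ContinuousMap.smul_apply, smul_eq_mul]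
      simp_rw [integral_const_mul]
      exact h1.const_mul c
  intro g
  have hgc : (g.toContinuousMap : C(ℕ → ℝ≥0∞, ℝ)) ∈ closure ((Submodule.span ℝ (range lapMap) :
    Submodule ℝ C(ℕ → ℝ≥0∞, ℝ)) : Set C(ℕ → ℝ≥0∞, ℝ)) := by rw [span_lapMap_dense]; trivial
  rw [Metric.tendsto_atTop]
  intro ε hε
  obtain ⟨g', hg', hd⟩ := Metric.mem_closure_iff.1 hgc (ε / 3) (by positivity)
  obtain ⟨N, hN⟩ := Metric.tendsto_atTop.1 (hspan g' hg') (ε / 3) (by positivity)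
  have hpt : ∀ ω, ‖g ω - g' ω‖ ≤ ε / 3 := fun ω => by
    rw [← dist_eq_norm]
    exact (ContinuousMap.dist_apply_le_dist (f := g.toContinuousMap) (g := g') ω).trans hd.le
  refine ⟨N, fun n hn => ?_⟩
  have h1 : ‖∫ x, g (f n x) ∂μ - ∫ x, g' (f n x) ∂μ‖ ≤ ε / 3 := by
    have e := integral_sub (hi g.toContinuousMap n) (hi g' n)
    refine (congrArg norm e.symm).le.trans ?_
    refine (norm_integral_le_of_norm_le_const (ae_of_all _ fun x => hpt _)).trans ?_
    simp
  have h2 : ‖∫ x, g x ∂ν - ∫ x, g' x ∂ν‖ ≤ ε / 3 := by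
    have e := integral_sub (hiν g.toContinuousMap) (hiν g')
    refine (congrArg norm e.symm).le.trans ?_
    refine (norm_integral_le_of_norm_le_const (ae_of_all _ fun x => hpt _)).trans ?_
    simp
  have h3 := hN n hn
  rw [Real.norm_eq_abs, abs_le] at h1 h2
  rw [Real.dist_eq, abs_lt] at h3 ⊢
  constructor <;> linarith [h1.1, h1.2, h2.1, h2.2, h3.1, h3.2]

theorem integral_expNeg_pow_expLawENN {θ : ℝ} (hθ : 0 < θ) (k : ℕ) :
    ∫ y, expNeg y ^ k ∂expLawENN θ = θ / (θ + k) := by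
  rw [expLawENN, integral_map ENNReal.measurable_ofReal.aemeasurable
    (f := fun y => expNeg y ^ k) (continuous_expNeg.pow k).aestronglyMeasurable, expMeasure, gammaMeasure,
    integral_withDensity_eq_integral_toReal_smul (f := gammaPDF 1 θ)
      (measurable_gammaPDFReal 1 θ).ennreal_ofReal
      (ae_of_all _ fun _ => ENNReal.ofReal_lt_top)]
  have h2 : ∫ x in Ioi (0 : ℝ), (gammaPDF 1 θ x).toReal • expNeg (ENNReal.ofReal x) ^ k =
      ∫ x : ℝ, (gammaPDF 1 θ x).toReal • expNeg (ENNReal.ofReal x) ^ k := by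
    rw [← integral_Ici_eq_integral_Ioi]
    refine setIntegral_eq_integral_of_forall_compl_eq_zero fun x hx => ?_
    rw [gammaPDF_of_neg (by simpa using hx)]; simp
  rw [← h2]
  have h3 : ∫ x in Ioi (0 : ℝ), (gammaPDF 1 θ x).toReal • expNeg (ENNReal.ofReal x) ^ k =
      ∫ x in Ioi (0 : ℝ), θ * Real.exp (-(θ + k) * x) := by
    refine setIntegral_congr_fun measurableSet_Ioi fun x hx => ?_
    have hx0 : (0 : ℝ) ≤ x := le_of_lt hx
    change (exponentialPDF θ x).toReal • expNeg (ENNReal.ofReal x) ^ k = _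
    rw [exponentialPDF_of_nonneg hx0, ENNReal.toReal_ofReal (by positivity),
      expNeg_of_ne_top ENNReal.ofReal_ne_top, ENNReal.toReal_ofReal hx0, ← Real.exp_nat_mul,
      smul_eq_mul, mul_assoc, ← Real.exp_add]
    ring_nf
  have hk : (0 : ℝ) < θ + k := by positivity
  rw [h3, integral_const_mul, integral_exp_mul_Ioi (by linarith)]
  rw [mul_zero, Real.exp_zero, neg_div_neg_eq, mul_one_div]

/-- Laplace factor of a non-initial coordinate of `ν_θ`. -/
noncomputable def tailFactor (θ : ℝ) (k : ℕ) : ℝ := θ * (θ / (θ + k)) + (1 - θ)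

theorem isProbabilityMeasure_coordLaw {θ : ℝ} (hθ : 0 < θ) (hθ1 : θ ≤ 1) (i : ℕ) :
    IsProbabilityMeasure (coordLaw θ i) := by
  have := isProbabilityMeasure_expMeasure hθ
  have h : IsProbabilityMeasure (expLawENN θ) :=
    Measure.isProbabilityMeasure_map ENNReal.measurable_ofReal.aemeasurable
  unfold coordLaw
  split_ifs
  · exact h
  · refine ⟨?_⟩
    simp only [Measure.coe_add, Measure.coe_smul, Pi.add_apply, Pi.smul_apply, measure_univ,
      smul_eq_mul, mul_one]
    rw [← ENNReal.ofReal_add (by linarith) hθ.le]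
    simp

theorem integral_lap_nuTheta {θ : ℝ} (hθ : 0 < θ) (hθ1 : θ ≤ 1) {ν : Measure (ℕ → ℝ≥0∞)}
    (hν : IsNuTheta θ ν) (k : ℕ) (l : List ℕ) :
    ∫ y, lap (k :: l) y ∂ν = θ / (θ + k) * (l.map (tailFactor θ)).prod := by
  have hprob := isProbabilityMeasure_coordLaw hθ hθ1
  have := isProbabilityMeasure_expMeasure hθ
  have hexp : IsProbabilityMeasure (expLawENN θ) :=
    Measure.isProbabilityMeasure_map ENNReal.measurable_ofReal.aemeasurable
  have hmeas : Measurable (fun ω : ℕ → ℝ≥0∞ => fun i : Fin (k :: l).length => ω (i : ℕ)) :=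
    measurable_pi_lambda _ fun i => measurable_pi_apply _
  have h1 : ∫ y, lap (k :: l) y ∂ν = ∫ z : Fin (k :: l).length → ℝ≥0∞,
      ∏ i, expNeg (z i) ^ (k :: l).get i ∂(Measure.pi fun i : Fin (k :: l).length =>
        coordLaw θ (i : ℕ)) := by
    rw [← hν.2, integral_map hmeas.aemeasurable]
    · simp_rw [lap_eq_prod]
    · refine Continuous.aestronglyMeasurable ?_
      exact continuous_finsetProd _ fun i _ =>
        (continuous_expNeg.comp (continuous_apply i)).pow _
  rw [h1, integral_fintype_prod_eq_prod (f := fun i z => expNeg z ^ (k :: l).get i)]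
  simp only [List.length_cons]
  rw [Fin.prod_univ_succ]
  congr 1
  · simp [coordLaw, integral_expNeg_pow_expLawENN hθ]
  · rw [← List.prod_ofFn]
    congr 1
    apply List.ext_get
    · simp
    · intro n h1 h2
      simp only [List.get_eq_getElem, List.getElem_ofFn, List.getElem_map]
      have hInt : ∀ (μ : Measure ℝ≥0∞) [IsFiniteMeasure μ] (j : ℕ),
          Integrable (fun z => expNeg z ^ j) μ := fun μ _ j =>
        Integrable.of_bound (continuous_expNeg.pow j).aestronglyMeasurable 1
          (ae_of_all _ fun z => by
            rw [Real.norm_eq_abs, abs_of_nonneg (pow_nonneg (expNeg_nonneg z) _)]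
            exact pow_le_one₀ (expNeg_nonneg _) (expNeg_le_one _))
      have hA : IsFiniteMeasure (ENNReal.ofReal (1 - θ) • Measure.dirac (0 : ℝ≥0∞)) :=
        Measure.smul_finite _ ENNReal.ofReal_ne_top
      have hB : IsFiniteMeasure (ENNReal.ofReal θ • expLawENN θ) :=
        Measure.smul_finite _ ENNReal.ofReal_ne_top
      simp only [coordLaw, Fin.val_succ, Nat.succ_ne_zero, if_false]
      rw [integral_add_measure (hInt _ _) (hInt _ _), integral_smul_measure, integral_smul_measure,
        integral_expNeg_pow_expLawENN hθ, integral_dirac]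
      rw [ENNReal.toReal_ofReal (by linarith), ENNReal.toReal_ofReal hθ.le, tailFactor]
      simp [expNeg]
      ring

end Law

section Abstract

variable {X : Type*} [MeasurableSpace X] {μ : Measure X} [IsProbabilityMeasure μ] {T : X → X}

theorem integrable_of_mem_unit {G : X → ℝ} (hG : Measurable G) (h0 : ∀ x, 0 ≤ G x)
    (h1 : ∀ x, G x ≤ 1) : Integrable G μ :=
  Integrable.of_bound hG.aestronglyMeasurable 1 (ae_of_all _ fun x => by
    rw [Real.norm_eq_abs, abs_of_nonneg (h0 x)]; exact h1 x)

theorem integrable_procLap (hT : Measurable T) {B : Set X} (hB : MeasurableSet B) (c : ℝ≥0∞)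
    (l : List ℕ) : Integrable (procLap T B c l) μ :=
  integrable_of_mem_unit (measurable_procLap T B c hT hB l) (procLap_nonneg T B c l)
    (procLap_le_one T B c l)

theorem procLap_duality (hT : MeasurePreserving T μ μ) {B : Set X} (hB : MeasurableSet B)
    (c : ℝ≥0∞) (k : ℕ) (l : List ℕ) :
    ∫ x, procLap T B c (k :: l) x ∂μ = expNeg c ^ k * (∫ x in B, procLap T B c l x ∂μ +
      (∫ x, procLap T B c (k :: l) x ∂μ - ∫ x in B, procLap T B c (k :: l) x ∂μ)) := by
  have hi := fun l => integrable_procLap (μ := μ) hT.measurable hB c l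
  have hpre : ∀ {f : X → ℝ} {S : Set X}, MeasurableSet S → Integrable f μ →
      ∫ x in T ⁻¹' S, f (T x) ∂μ = ∫ x in S, f x ∂μ := by
    intro f S hS hf
    have := setIntegral_map (μ := μ) (g := T) (f := f) hS
      (by rw [hT.map_eq]; exact hf.aestronglyMeasurable) hT.measurable.aemeasurable
    rw [hT.map_eq] at this
    exact this.symm
  have e1 : ∫ x in T ⁻¹' B, procLap T B c (k :: l) x ∂μ =
      expNeg c ^ k * ∫ x in B, procLap T B c l x ∂μ := by
    rw [← hpre hB (hi l), ← integral_const_mul]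
    exact setIntegral_congr_fun (hT.measurable hB) fun x hx => procLap_of_mem T B c hx k l
  have e2 : ∫ x in (T ⁻¹' B)ᶜ, procLap T B c (k :: l) x ∂μ =
      expNeg c ^ k * ∫ x in Bᶜ, procLap T B c (k :: l) x ∂μ := by
    rw [← hpre hB.compl (hi (k :: l)), ← integral_const_mul]
    exact setIntegral_congr_fun (hT.measurable hB).compl
      fun x hx => procLap_of_notMem T B c hx k l
  have e3 : ∫ x in B, procLap T B c (k :: l) x ∂μ + ∫ x in Bᶜ, procLap T B c (k :: l) x ∂μ =
      ∫ x, procLap T B c (k :: l) x ∂μ := integral_add_compl hB (hi (k :: l))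
  have e4 := integral_add_compl (hT.measurable hB) (hi (k :: l))
  rw [e1, e2] at e4
  linear_combination (expNeg c ^ k) * e3 - e4

theorem tendsto_exp_sub_one_div {c : ℕ → ℝ} (hc : Tendsto c atTop (𝓝 0))
    (hpos : ∀ᶠ n in atTop, 0 < c n) (k : ℝ) :
    Tendsto (fun n => (Real.exp (k * c n) - 1) / c n) atTop (𝓝 k) := by
  have h : HasDerivAt (fun t : ℝ => Real.exp (k * t)) k 0 := by
    have := ((hasDerivAt_id (0 : ℝ)).const_mul k).exp
    simpa using this
  have h2 := h.tendsto_slope_zero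
  have h3 : Tendsto c atTop (𝓝[≠] 0) :=
    tendsto_nhdsWithin_iff.2 ⟨hc, hpos.mono fun n hn => hn.ne'⟩
  refine (h2.comp h3).congr fun n => ?_
  simp only [Function.comp, zero_add, mul_zero, Real.exp_zero, smul_eq_mul]
  ring

theorem procLap_limits (hT : MeasurePreserving T μ μ) {B : ℕ → Set X}
    (hB : ∀ n, MeasurableSet (B n)) (hpos : ∀ᶠ n in atTop, 0 < μ.real (B n))
    (hc : Tendsto (fun n => μ.real (B n)) atTop (𝓝 0)) {θ : ℝ} (hθ : 0 < θ)
    (hexp : ∀ l : List ℕ, Tendsto (fun n => (∫ x in B n, procLap T (B n) (μ (B n)) l x ∂μ) /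
      μ.real (B n) - (∑ j ∈ Finset.range l.length, θ * (1 - θ) ^ j *
        ∫ x, procLap T (B n) (μ (B n)) (l.drop j) x ∂μ + (1 - θ) ^ l.length)) atTop (𝓝 0))
    (l : List ℕ) :
    Tendsto (fun n => (∫ x in B n, procLap T (B n) (μ (B n)) l x ∂μ) / μ.real (B n)) atTop
      (𝓝 (l.map (tailFactor θ)).prod) ∧
    ∀ k, Tendsto (fun n => ∫ x, procLap T (B n) (μ (B n)) (k :: l) x ∂μ) atTop
      (𝓝 (θ / (θ + k) * (l.map (tailFactor θ)).prod)) := by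
  set At : List ℕ → ℕ → ℝ := fun l n =>
    (∫ x in B n, procLap T (B n) (μ (B n)) l x ∂μ) / μ.real (B n) with hAt
  set A : List ℕ → ℕ → ℝ := fun l n => ∫ x, procLap T (B n) (μ (B n)) l x ∂μ with hA
  have hii : ∀ k l, Tendsto (fun n => At (k :: l) n - θ * A (k :: l) n - (1 - θ) * At l n)
      atTop (𝓝 0) := by
    intro k l
    have h := (hexp (k :: l)).sub ((hexp l).const_mul (1 - θ))
    simp only [mul_zero, sub_zero] at h
    refine h.congr fun n => ?_
    simp only [List.length_cons]
    rw [Finset.sum_range_succ']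
    simp only [List.drop_succ_cons, pow_zero, mul_one, List.drop_zero]
    have : ∑ j ∈ Finset.range l.length, θ * (1 - θ) ^ (j + 1) *
        ∫ x, procLap T (B n) (μ (B n)) (l.drop j) x ∂μ =
        (1 - θ) * ∑ j ∈ Finset.range l.length, θ * (1 - θ) ^ j *
        ∫ x, procLap T (B n) (μ (B n)) (l.drop j) x ∂μ := by
      rw [Finset.mul_sum]
      exact Finset.sum_congr rfl fun j _ => by ring
    rw [this]
    simp only [hAt, hA]
    ring
  have hq := fun k : ℕ => tendsto_exp_sub_one_div hc hpos (k : ℝ)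
  have hdual : ∀ k l, ∀ᶠ n in atTop, At l n - At (k :: l) n =
      (Real.exp (k * μ.real (B n)) - 1) / μ.real (B n) * A (k :: l) n := by
    intro k l
    filter_upwards [hpos] with n hn
    have h := procLap_duality hT (hB n) (μ (B n)) k l
    rw [expNeg_of_ne_top (measure_ne_top _ _)] at h
    have hz : Real.exp (k * μ.real (B n)) * Real.exp (-(μ (B n)).toReal) ^ k = 1 := by
      rw [← Real.exp_nat_mul, ← Real.exp_add]
      simp [measureReal_def]
    simp only [hAt, hA]
    rw [← sub_div, div_mul_eq_mul_div, div_left_inj' hn.ne']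
    generalize Real.exp (k * μ.real (B n)) = y at *
    generalize Real.exp (-(μ (B n)).toReal) ^ k = z at *
    generalize ∫ x, procLap T (B n) (μ (B n)) (k :: l) x ∂μ = I at *
    generalize ∫ x in B n, procLap T (B n) (μ (B n)) (k :: l) x ∂μ = J at *
    generalize ∫ x in B n, procLap T (B n) (μ (B n)) l x ∂μ = K at *
    linear_combination -y * h + (-K - I + J) * hz
  have hstep : ∀ k l L, Tendsto (At l) atTop (𝓝 L) →
      Tendsto (A (k :: l)) atTop (𝓝 (θ / (θ + k) * L)) := by
    intro k l L hL
    have hk : (0 : ℝ) < θ + k := by positivity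
    have h1 : Tendsto (fun n => (θ + (Real.exp (k * μ.real (B n)) - 1) / μ.real (B n)) *
        A (k :: l) n) atTop (𝓝 (θ * L)) := by
      have := (hL.const_mul θ).sub (hii k l)
      rw [sub_zero] at this
      refine this.congr' ?_
      filter_upwards [hdual k l] with n hn
      linear_combination hn
    have h2 := h1.div ((hq k).const_add θ) hk.ne'
    rw [div_mul_eq_mul_div]
    refine h2.congr' ?_
    have h3 := ((hq k).const_add θ).eventually (lt_mem_nhds hk)
    filter_upwards [h3] with n hn
    simp only [Pi.div_apply]
    field_simp
  have hmain : Tendsto (At l) atTop (𝓝 (l.map (tailFactor θ)).prod) := by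
    induction l with
    | nil =>
      refine tendsto_const_nhds.congr' ?_
      filter_upwards [hpos] with n hn
      simp only [hAt, procLap_nil]
      simp [hn.ne']
    | cons k l ih =>
      have hk : (0 : ℝ) < θ + k := by positivity
      have h1 := ih.sub ((hq k).mul (hstep k l _ ih))
      have e : (List.map (tailFactor θ) (k :: l)).prod = (List.map (tailFactor θ) l).prod -
          k * (θ / (θ + k) * (List.map (tailFactor θ) l).prod) := by
        rw [List.map_cons, List.prod_cons, tailFactor]
        field_simp
        ring
      rw [e]
      refine h1.congr' ?_
      filter_upwards [hdual k l] with n hn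
      linear_combination hn
  exact ⟨hmain, fun k => hstep k l _ hmain⟩

theorem procLap_expansion (hT : Measurable T) {B : ℕ → Set X}
    (hB : ∀ n, MeasurableSet (B n)) {W : ℕ → ℕ → Set X} (hW : ∀ n k, MeasurableSet (W n k))
    (hW0 : ∀ n, W n 0 = B n) (hanti : ∀ n k, W n (k + 1) ⊆ W n k) {θ : ℝ}
    (hWlim : ∀ k, Tendsto (fun n => μ.real (W n k) / μ.real (B n)) atTop (𝓝 ((1 - θ) ^ k)))
    {l : List ℕ}
    (hU : ∀ k < l.length, Tendsto (fun n =>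
      (∫ x in W n k \ W n (k + 1), procLap T (B n) (μ (B n)) l x ∂μ -
        μ.real (W n k \ W n (k + 1)) * ∫ x, procLap T (B n) (μ (B n)) (l.drop k) x ∂μ) /
        μ.real (B n)) atTop (𝓝 0))
    (hlast : Tendsto (fun n => (∫ x in W n l.length, procLap T (B n) (μ (B n)) l x ∂μ -
      μ.real (W n l.length)) / μ.real (B n)) atTop (𝓝 0)) :
    Tendsto (fun n => (∫ x in B n, procLap T (B n) (μ (B n)) l x ∂μ) /
      μ.real (B n) - (∑ j ∈ Finset.range l.length, θ * (1 - θ) ^ j *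
        ∫ x, procLap T (B n) (μ (B n)) (l.drop j) x ∂μ + (1 - θ) ^ l.length)) atTop (𝓝 0) := by
  have hi := fun n l => integrable_procLap (μ := μ) hT (hB n) (μ (B n)) l
  have hdecomp : ∀ n m, ∫ x in B n, procLap T (B n) (μ (B n)) l x ∂μ =
      ∑ j ∈ Finset.range m, ∫ x in W n j \ W n (j + 1), procLap T (B n) (μ (B n)) l x ∂μ +
        ∫ x in W n m, procLap T (B n) (μ (B n)) l x ∂μ := by
    intro n m
    induction m with
    | zero => simp [hW0]
    | succ m ih =>
      rw [ih, Finset.sum_range_succ, add_assoc, setIntegral_sdiff (hW n (m + 1))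
        (hi n l).integrableOn (hanti n m)]
      ring
  have hreal : ∀ n j, μ.real (W n j \ W n (j + 1)) = μ.real (W n j) - μ.real (W n (j + 1)) :=
    fun n j => measureReal_sdiff (hanti n j) (hW n (j + 1))
  have hA1 : ∀ n j, |∫ x, procLap T (B n) (μ (B n)) (l.drop j) x ∂μ| ≤ 1 := by
    intro n j
    rw [abs_of_nonneg (integral_nonneg fun x => procLap_nonneg _ _ _ _ _)]
    calc _ ≤ ∫ _, (1 : ℝ) ∂μ := integral_mono (hi n _) (integrable_const _)
          fun x => procLap_le_one _ _ _ _ _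
      _ = 1 := by simp
  have hterm : ∀ j ∈ Finset.range l.length, Tendsto (fun n =>
      (∫ x in W n j \ W n (j + 1), procLap T (B n) (μ (B n)) l x ∂μ) / μ.real (B n) -
      θ * (1 - θ) ^ j * ∫ x, procLap T (B n) (μ (B n)) (l.drop j) x ∂μ) atTop (𝓝 0) := by
    intro j hj
    have h1 := hU j (Finset.mem_range.1 hj)
    have h2 : Tendsto (fun n => μ.real (W n j) / μ.real (B n) - μ.real (W n (j + 1)) /
        μ.real (B n) - θ * (1 - θ) ^ j) atTop (𝓝 0) := by
      have := ((hWlim j).sub (hWlim (j + 1))).sub_const (θ * (1 - θ) ^ j)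
      convert this using 2
      ring
    have h3 : Tendsto (fun n => (μ.real (W n j) / μ.real (B n) - μ.real (W n (j + 1)) /
        μ.real (B n) - θ * (1 - θ) ^ j) * ∫ x, procLap T (B n) (μ (B n)) (l.drop j) x ∂μ)
        atTop (𝓝 0) := by
      refine h2.zero_mul_isBoundedUnder_le ?_
      exact isBoundedUnder_of ⟨1, fun n => hA1 n j⟩
    have h4 := h1.add h3
    rw [add_zero] at h4
    refine h4.congr fun n => ?_
    rw [hreal]
    ring
  have hsum := tendsto_finsetSum _ hterm
  have hl := hlast.add ((hWlim l.length).sub_const ((1 - θ) ^ l.length))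
  have := hsum.add hl
  simp only [Finset.sum_const_zero, sub_self, add_zero] at this
  refine this.congr fun n => ?_
  rw [hdecomp n l.length, Finset.sum_sub_distrib, add_div, Finset.sum_div]
  ring

end Abstract

section ErgodicMixing

theorem tendsto_inner_sub_projection {E : Type*} [NormedAddCommGroup E] [InnerProductSpace ℝ E]
    [CompleteSpace E] (f : E →ₗᵢ[ℝ] E) (g : ℕ → E) (hg : ∀ n, ‖g n‖ ≤ 1)
    (hfg : Tendsto (fun n => ‖g n - f (g n)‖) atTop (𝓝 0)) (v : E) :
    ∃ w : E, f w = w ∧ Tendsto (fun n => inner ℝ (g n) (v - w)) atTop (𝓝 0) ∧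
      ∀ g₀ : E, f g₀ = g₀ → inner ℝ g₀ (v - w) = 0 := by
  let F : E →L[ℝ] E := f.toContinuousLinearMap
  have hF : ‖F‖ ≤ 1 := f.norm_toContinuousLinearMap_le
  obtain ⟨w, hwfix, hav⟩ : ∃ w : E, f w = w ∧
      Tendsto (birkhoffAverage ℝ F _root_.id · v) atTop (𝓝 w) :=
    ⟨_, ((F.eqLocus (1 : E →L[ℝ] E)).orthogonalProjectionOnto v).2,
      F.tendsto_birkhoffAverage_orthogonalProjection hF v⟩
  have hstep : ∀ (h : ℕ → E), (Tendsto (fun n => ‖h n - f (h n)‖) atTop (𝓝 0)) → ∀ k : ℕ,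
      Tendsto (fun n => inner ℝ (h n) (F^[k] v - v)) atTop (𝓝 0) := by
    intro h hh k
    induction k with
    | zero => simp
    | succ k ih =>
      have h1 : Tendsto (fun n => inner ℝ (h n - f (h n)) (F^[k + 1] v)) atTop (𝓝 0) := by
        have h2 : Tendsto (fun n => ‖h n - f (h n)‖ * ‖F^[k + 1] v‖) atTop (𝓝 0) := by
          simpa using hh.mul_const ‖F^[k + 1] v‖
        exact squeeze_zero_norm (fun n => norm_inner_le_norm _ _) h2
      have h3 := h1.add ih
      rw [add_zero] at h3
      refine h3.congr fun n => ?_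
      have e : F^[k + 1] v = f (F^[k] v) := Function.iterate_succ_apply' _ _ _
      have e2 : inner ℝ (f (h n)) (F^[k + 1] v) = inner ℝ (h n) (F^[k] v) := by
        rw [e, f.inner_map_map]
      rw [inner_sub_left, inner_sub_right, inner_sub_right, e2]
      ring
  have hall : ∀ (h : ℕ → E), (∀ n, ‖h n‖ ≤ 1) →
      (Tendsto (fun n => ‖h n - f (h n)‖) atTop (𝓝 0)) →
      Tendsto (fun n => inner ℝ (h n) (v - w)) atTop (𝓝 0) := by
    intro h hb hh
    rw [Metric.tendsto_atTop]
    intro ε hε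
    obtain ⟨N, hN⟩ := Metric.tendsto_atTop.1 hav (ε / 2) (by positivity)
    have hN1 := hN (N + 1) (by omega)
    have h4 : Tendsto (fun n => inner ℝ (h n) (birkhoffAverage ℝ F _root_.id (N + 1) v - v)) atTop
        (𝓝 0) := by
      have h5 : Tendsto (fun n => ((N + 1 : ℕ) : ℝ)⁻¹ * ∑ k ∈ Finset.range (N + 1),
          inner ℝ (h n) (F^[k] v - v)) atTop (𝓝 0) := by
        have := (tendsto_finsetSum (Finset.range (N + 1)) fun k _ => hstep h hh k).const_mul
          (((N + 1 : ℕ) : ℝ)⁻¹)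
        simpa using this
      refine h5.congr fun n => ?_
      rw [← inner_sum, ← inner_smul_right]
      congr 1
      rw [Finset.sum_sub_distrib, smul_sub, birkhoffAverage, birkhoffSum]
      congr 1
      rw [Finset.sum_const, Finset.card_range, ← Nat.cast_smul_eq_nsmul ℝ, smul_smul,
        inv_mul_cancel₀ (by positivity), one_smul]
    obtain ⟨M, hM⟩ := Metric.tendsto_atTop.1 h4 (ε / 2) (by positivity)
    refine ⟨M, fun n hn => ?_⟩
    have h6 := hM n hn
    rw [Real.dist_eq, sub_zero] at h6 ⊢
    have h7 : |inner ℝ (h n) (birkhoffAverage ℝ F _root_.id (N + 1) v - w)| < ε / 2 := by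
      refine (abs_real_inner_le_norm _ _).trans_lt ?_
      rw [dist_eq_norm] at hN1
      refine (mul_le_of_le_one_left (norm_nonneg _) (hb n)).trans_lt hN1
    have e : inner ℝ (h n) (v - w) = inner ℝ (h n) (birkhoffAverage ℝ F _root_.id (N + 1) v - w) -
        inner ℝ (h n) (birkhoffAverage ℝ F _root_.id (N + 1) v - v) := by
      rw [← inner_sub_right]; congr 1; abel
    rw [e]
    rw [abs_lt] at h6 h7 ⊢
    constructor <;> linarith [h6.1, h6.2, h7.1, h7.2]
  refine ⟨w, hwfix, hall g hg hfg, fun g₀ hg₀ => ?_⟩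
  · set s : ℝ := (1 + ‖g₀‖)⁻¹ with hs
    have hs0 : 0 < s := by positivity
    have h1 := hall (fun _ => s • g₀) (fun _ => by
      rw [norm_smul, Real.norm_eq_abs, abs_of_pos hs0, hs, inv_mul_le_iff₀ (by positivity)]
      linarith) (by simp [hg₀])
    have h2 : inner ℝ (s • g₀) (v - w) = 0 := tendsto_nhds_unique tendsto_const_nhds h1
    rw [real_inner_smul_left] at h2
    exact (mul_eq_zero.1 h2).resolve_left hs0.ne'

variable {X : Type*} [MeasurableSpace X] {μ : Measure X} [IsProbabilityMeasure μ] {T : X → X}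

theorem ergodic_asymptotic_independence (hT : Ergodic T μ) {G : ℕ → X → ℝ}
    (hG : ∀ n, Measurable (G n)) (h0 : ∀ n x, 0 ≤ G n x) (h1 : ∀ n x, G n x ≤ 1)
    (hGT : Tendsto (fun n => ∫ x, |G n (T x) - G n x| ∂μ) atTop (𝓝 0))
    {u : X → ℝ} (hu : MemLp u 2 μ) :
    Tendsto (fun n => ∫ x, G n x * u x ∂μ - (∫ x, G n x ∂μ) * ∫ x, u x ∂μ) atTop (𝓝 0) := by
  have hp : MeasurePreserving T μ μ := hT.toMeasurePreserving
  have hGm : ∀ n, MemLp (G n) 2 μ := fun n => MemLp.of_bound (hG n).aestronglyMeasurable 1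
    (ae_of_all _ fun x => by rw [Real.norm_eq_abs, abs_of_nonneg (h0 n x)]; exact h1 n x)
  let f : Lp ℝ 2 μ →ₗᵢ[ℝ] Lp ℝ 2 μ := Lp.compMeasurePreservingₗᵢ ℝ T hp
  have hf : ∀ g : Lp ℝ 2 μ, f g =ᵐ[μ] g ∘ T := fun g => Lp.coeFn_compMeasurePreserving g hp
  let g : ℕ → Lp ℝ 2 μ := fun n => (hGm n).toLp (G n)
  have hgG : ∀ n, g n =ᵐ[μ] G n := fun n => (hGm n).coeFn_toLp
  have inner_eq : ∀ v w : Lp ℝ 2 μ, inner ℝ v w = ∫ x, v x * w x ∂μ := by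
    intro v w
    rw [L2.inner_def]
    simp [mul_comm]
  have hnorm : ∀ n, ‖g n‖ ≤ 1 := by
    intro n
    have h2 : ‖g n‖ ^ 2 ≤ 1 := by
      rw [← real_inner_self_eq_norm_sq, inner_eq]
      calc ∫ x, g n x * g n x ∂μ = ∫ x, G n x * G n x ∂μ :=
            integral_congr_ae (by filter_upwards [hgG n] with x hx; rw [hx])
        _ ≤ ∫ _, (1 : ℝ) ∂μ := by
            refine integral_mono_of_nonneg (ae_of_all _ fun x => mul_nonneg (h0 n x) (h0 n x))
              (integrable_const _) (ae_of_all _ fun x => ?_)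
            exact mul_le_one₀ (h1 n x) (h0 n x) (h1 n x)
        _ = 1 := by simp
    nlinarith [norm_nonneg (g n)]
  have hfg : Tendsto (fun n => ‖g n - f (g n)‖) atTop (𝓝 0) := by
    have hsq : Tendsto (fun n => ‖g n - f (g n)‖ ^ 2) atTop (𝓝 0) := by
      refine squeeze_zero (fun n => by positivity) (fun n => ?_) hGT
      rw [← real_inner_self_eq_norm_sq, inner_eq]
      have hInt : Integrable (fun x => |G n (T x) - G n x|) μ :=
        (((hp.integrable_comp (hG n).aestronglyMeasurable).2
          (integrable_of_mem_unit (hG n) (h0 n) (h1 n))).sub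
          (integrable_of_mem_unit (hG n) (h0 n) (h1 n))).abs
      refine integral_mono_of_nonneg (ae_of_all _ fun x => mul_self_nonneg _) hInt ?_
      filter_upwards [Lp.coeFn_sub (g n) (f (g n)), hf (g n), hgG n,
        hp.quasiMeasurePreserving.ae_eq_comp (hgG n)] with x e1 e2 e3 e4
      simp only [Function.comp] at e2 e4
      rw [e1, Pi.sub_apply, e2, e3, e4, ← abs_mul_abs_self, abs_sub_comm]
      refine mul_le_of_le_one_left (abs_nonneg _) ?_
      rw [abs_le]
      constructor <;> linarith [h0 n x, h1 n x, h0 n (T x), h1 n (T x)]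
    have := hsq.sqrt
    simpa [Real.sqrt_sq] using this
  obtain ⟨w, hw, hlim, hinv⟩ := tendsto_inner_sub_projection f g hnorm hfg (hu.toLp u)
  have hwT : (w : X → ℝ) ∘ T =ᵐ[μ] w := by
    have := hf w
    rw [hw] at this
    exact this.symm
  obtain ⟨c, hc⟩ := hT.quasiErgodic.ae_eq_const_of_ae_eq_comp_ae
    (Lp.aestronglyMeasurable w) hwT
  have hui : Integrable u μ := hu.integrable (by norm_num)
  have hdiff : ∀ n, inner ℝ (g n) (hu.toLp u - w) =
      ∫ x, G n x * u x ∂μ - (∫ x, G n x ∂μ) * c := by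
    intro n
    have hGi := integrable_of_mem_unit (μ := μ) (hG n) (h0 n) (h1 n)
    have hGu : Integrable (fun x => G n x * u x) μ := hui.bdd_mul (c := 1) (hG n).aestronglyMeasurable
      (ae_of_all _ fun x => by rw [Real.norm_eq_abs, abs_of_nonneg (h0 n x)]; exact h1 n x)
    rw [inner_eq, ← integral_mul_const, ← integral_sub hGu (hGi.mul_const c)]
    refine integral_congr_ae ?_
    filter_upwards [Lp.coeFn_sub (hu.toLp u) w, hu.coeFn_toLp, hgG n, hc] with x e1 e2 e3 e4
    rw [e1, Pi.sub_apply, e2, e3, e4]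
    simp only [Function.const]
    ring
  have hone : MemLp (fun _ : X => (1 : ℝ)) 2 μ := memLp_const 1
  have hfix : f (hone.toLp _) = hone.toLp _ := by
    apply Lp.ext
    filter_upwards [hf (hone.toLp _), hp.quasiMeasurePreserving.ae_eq_comp hone.coeFn_toLp,
      hone.coeFn_toLp] with x e1 e2 e3
    rw [e1, e2, e3]; rfl
  have hcu : ∫ x, u x ∂μ = c := by
    have h2 := hinv _ hfix
    rw [inner_eq] at h2
    have h3 : ∫ x, (hone.toLp _ : Lp ℝ 2 μ) x * (hu.toLp u - w : Lp ℝ 2 μ) x ∂μ =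
        ∫ x, (u x - c) ∂μ := by
      refine integral_congr_ae ?_
      filter_upwards [Lp.coeFn_sub (hu.toLp u) w, hu.coeFn_toLp, hone.coeFn_toLp, hc]
        with x e1 e2 e3 e4
      rw [e1, Pi.sub_apply, e2, e3, e4, one_mul]
      rfl
    rw [h3, integral_sub hui (integrable_const _)] at h2
    simp at h2
    linarith
  rw [hcu]
  exact hlim.congr hdiff

theorem procLap_almost_invariant (hT : MeasurePreserving T μ μ) {B : ℕ → Set X}
    (hB : ∀ n, MeasurableSet (B n)) (hc : Tendsto (fun n => μ.real (B n)) atTop (𝓝 0))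
    (l : List ℕ) :
    Tendsto (fun n => ∫ x, |procLap T (B n) (μ (B n)) l (T x) - procLap T (B n) (μ (B n)) l x| ∂μ)
      atTop (𝓝 0) := by
  cases l with
  | nil => simp [procLap_nil]
  | cons k l =>
    have hz : Tendsto (fun n => 1 - Real.exp (-μ.real (B n)) ^ k + μ.real (B n)) atTop (𝓝 0) := by
      have h1 : Tendsto (fun n => 1 - Real.exp (-μ.real (B n)) ^ k + μ.real (B n)) atTop
          (𝓝 (1 - Real.exp (-0) ^ k + 0)) :=
        ((((Real.continuous_exp.tendsto _).comp hc.neg).pow k).const_sub 1).add hc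
      simpa using h1
    refine squeeze_zero (fun n => integral_nonneg fun x => abs_nonneg _) (fun n => ?_) hz
    have hz1 : expNeg (μ (B n)) = Real.exp (-μ.real (B n)) := expNeg_of_ne_top (measure_ne_top _ _)
    set z := expNeg (μ (B n)) ^ k with hzdef
    have hz01 : z ≤ 1 := pow_le_one₀ (expNeg_nonneg _) (expNeg_le_one _)
    have hz00 : 0 ≤ z := pow_nonneg (expNeg_nonneg _) _
    calc _ ≤ ∫ x, ((1 - z) + (T ⁻¹' (B n)).indicator (fun _ => (1 : ℝ)) x) ∂μ := by
          refine integral_mono_of_nonneg (ae_of_all _ fun x => abs_nonneg _) ?_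
            (ae_of_all _ fun x => ?_)
          · exact (integrable_const _).add
              ((integrable_const _).indicator (hT.measurable (hB n)))
          · have b1 := procLap_nonneg T (B n) (μ (B n)) (k :: l) (T x)
            have b2 := procLap_le_one T (B n) (μ (B n)) (k :: l) (T x)
            have b3 := procLap_nonneg T (B n) (μ (B n)) (k :: l) x
            have b4 := procLap_le_one T (B n) (μ (B n)) (k :: l) x
            by_cases hx : T x ∈ B n
            · simp only [indicator, mem_preimage, hx, if_true]
              rw [abs_le]; constructor <;> linarith
            · simp only [indicator, mem_preimage, hx, if_false]
              rw [procLap_of_notMem T _ _ hx, abs_of_nonneg] <;> nlinarith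
      _ = _ := by
          rw [integral_add (integrable_const _)
            ((integrable_const _).indicator (hT.measurable (hB n))),
            integral_indicator_const _ (hT.measurable (hB n)), ← hz1, ← hzdef]
          simp [hT.measureReal_preimage (hB n).nullMeasurableSet]

end ErgodicMixing

section MonotoneMixing

variable {X : Type*} [MeasurableSpace X] {μ : Measure X} {T : X → X}

theorem setIntegral_strips {F : X → ℝ} (hF : Integrable F μ) {τ : X → ℝ} (hτ : Measurable τ)
    {t : ℕ → ℝ} (ht : Monotone t) (K : ℕ) :
    ∫ x in τ ⁻¹' Ico (t 0) (t K), F x ∂μ =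
      ∑ i ∈ Finset.range K, ∫ x in τ ⁻¹' Ico (t i) (t (i + 1)), F x ∂μ := by
  induction K with
  | zero => simp
  | succ K ih =>
    rw [Finset.sum_range_succ, ← ih, ← setIntegral_union _ (hτ measurableSet_Ico)
      hF.integrableOn hF.integrableOn, ← preimage_union,
      Ico_union_Ico_eq_Ico (ht (Nat.zero_le K)) (ht (Nat.le_succ K))]
    exact Disjoint.preimage _ (Ico_disjoint_Ico_same)

variable [IsProbabilityMeasure μ]

theorem ergodic_monotone_independence (hT : Ergodic T μ) {G : ℕ → X → ℝ}
    (hG : ∀ n, Measurable (G n)) (h0 : ∀ n x, 0 ≤ G n x) (h1 : ∀ n x, G n x ≤ 1)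
    (hGT : Tendsto (fun n => ∫ x, |G n (T x) - G n x| ∂μ) atTop (𝓝 0))
    {u : X → ℝ} (hu : Measurable u) (hu0 : ∀ x, 0 ≤ u x) {C : ℝ} (huC : ∀ x, u x ≤ C)
    {τ : X → ℝ} (hτ : Measurable τ) {α β C' : ℝ} (hαβ : α < β)
    (hsupp : ∀ x, τ x ∉ Ico α β → u x = 0)
    (hstrip : ∀ s t, α ≤ s → s ≤ t → t ≤ β → ∫ x in τ ⁻¹' Ico s t, u x ∂μ ≤ C' * (t - s))
    {ε : ℝ} (hε : 0 < ε) :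
    ∀ᶠ n in atTop, ∀ M : ℝ → ℝ, Monotone M → (∀ v, 0 ≤ M v) → (∀ v, M v ≤ 1) →
      |∫ x, (G n x - ∫ y, G n y ∂μ) * (M (τ x) * u x) ∂μ| ≤ ε := by
  have hC' : 0 ≤ C' := by
    have h := hstrip α β le_rfl hαβ.le le_rfl
    have h2 : 0 ≤ ∫ x in τ ⁻¹' Ico α β, u x ∂μ := integral_nonneg fun x => hu0 x
    by_contra hneg
    nlinarith
  obtain ⟨K, hK⟩ := exists_nat_gt (C' * (β - α) / (ε / 2))
  have hK0 : (0 : ℝ) < K := lt_of_le_of_lt (by have := sub_pos.2 hαβ; positivity) hK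
  set t : ℕ → ℝ := fun i => α + i * ((β - α) / K) with ht
  have hd : 0 < (β - α) / K := div_pos (sub_pos.2 hαβ) hK0
  have htm : Monotone t := fun i j hij => by
    simp only [ht]; gcongr
  have ht0 : t 0 = α := by simp [ht]
  have htK : t K = β := by simp only [ht]; field_simp; ring
  have hsmall : C' * ((β - α) / K) ≤ ε / 2 := by
    rw [div_lt_iff₀ (by positivity)] at hK
    rw [← mul_div_assoc, div_le_iff₀ hK0]
    linarith
  set S : ℕ → Set X := fun i => τ ⁻¹' Ico (t i) (t (i + 1)) with hS
  have hSm : ∀ i, MeasurableSet (S i) := fun i => hτ measurableSet_Ico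
  have huL : ∀ i, MemLp ((S i).indicator u) 2 μ := fun i =>
    MemLp.of_bound (hu.indicator (hSm i)).aestronglyMeasurable C (ae_of_all _ fun x => by
      by_cases hx : x ∈ S i
      · rw [indicator_of_mem hx, Real.norm_eq_abs, abs_of_nonneg (hu0 x)]; exact huC x
      · rw [indicator_of_notMem hx, norm_zero]; exact (hu0 x).trans (huC x))
  have hconst : ∀ i, Tendsto (fun n => ∫ x in S i, (G n x - ∫ y, G n y ∂μ) * u x ∂μ) atTop
      (𝓝 0) := by
    intro i
    refine (ergodic_asymptotic_independence hT hG h0 h1 hGT (huL i)).congr fun n => ?_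
    have hui : Integrable ((S i).indicator u) μ := (huL i).integrable (by norm_num)
    have hGu : Integrable (fun x => G n x * (S i).indicator u x) μ :=
      hui.bdd_mul (c := 1) (hG n).aestronglyMeasurable
      (ae_of_all _ fun x => by rw [Real.norm_eq_abs, abs_of_nonneg (h0 n x)]; exact h1 n x)
    rw [← integral_const_mul, ← integral_sub hGu (hui.const_mul _), ← integral_indicator (hSm i)]
    refine integral_congr_ae (ae_of_all _ fun x => ?_)
    by_cases hx : x ∈ S i <;> simp [hx]
    ring
  have hsum : Tendsto (fun n => ∑ i ∈ Finset.range K,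
      |∫ x in S i, (G n x - ∫ y, G n y ∂μ) * u x ∂μ|) atTop (𝓝 0) := by
    have := tendsto_finsetSum (Finset.range K) fun i _ => (hconst i).abs
    simpa using this
  filter_upwards [hsum.eventually (gt_mem_nhds (half_pos hε))] with n hn M hM hM0 hM1
  have hbar0 : 0 ≤ ∫ y, G n y ∂μ := integral_nonneg (h0 n)
  have hbar1 : ∫ y, G n y ∂μ ≤ 1 := by
    calc _ ≤ ∫ _, (1 : ℝ) ∂μ := integral_mono (integrable_of_mem_unit (hG n) (h0 n) (h1 n))
          (integrable_const _) (h1 n)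
      _ = 1 := by simp
  set g : X → ℝ := fun x => G n x - ∫ y, G n y ∂μ with hg
  have hgm : Measurable g := (hG n).sub_const _
  have hgb : ∀ x, |g x| ≤ 1 := fun x => by
    rw [abs_le]; simp only [hg]; constructor <;> linarith [h0 n x, h1 n x]
  have hMm : Measurable fun x => M (τ x) := hM.measurable.comp hτ
  have huint : Integrable u μ := Integrable.of_bound hu.aestronglyMeasurable C
    (ae_of_all _ fun x => by rw [Real.norm_eq_abs, abs_of_nonneg (hu0 x)]; exact huC x)
  have hMu : Integrable (fun x => M (τ x) * u x) μ := huint.bdd_mul (c := 1)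
    hMm.aestronglyMeasurable
    (ae_of_all _ fun x => by rw [Real.norm_eq_abs, abs_of_nonneg (hM0 _)]; exact hM1 _)
  have hF : Integrable (fun x => g x * (M (τ x) * u x)) μ := hMu.bdd_mul (c := 1)
    hgm.aestronglyMeasurable (ae_of_all _ hgb)
  have hgu : Integrable (fun x => g x * u x) μ := huint.bdd_mul (c := 1)
    hgm.aestronglyMeasurable (ae_of_all _ hgb)
  have e1 : ∫ x, g x * (M (τ x) * u x) ∂μ =
      ∑ i ∈ Finset.range K, ∫ x in S i, g x * (M (τ x) * u x) ∂μ := by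
    rw [← setIntegral_strips hF hτ htm K]
    symm
    refine setIntegral_eq_integral_of_forall_compl_eq_zero fun x hx => ?_
    rw [hsupp x (by rwa [ht0, htK] at hx), mul_zero, mul_zero]
  have hpiece : ∀ i ∈ Finset.range K, |∫ x in S i, g x * (M (τ x) * u x) ∂μ| ≤
      |∫ x in S i, g x * u x ∂μ| + (M (t (i + 1)) - M (t i)) * (C' * ((β - α) / K)) := by
    intro i hi
    have hMi : 0 ≤ M (t (i + 1)) - M (t i) := sub_nonneg.2 (hM (htm (Nat.le_succ i)))
    have e2 : ∫ x in S i, g x * (M (τ x) * u x) ∂μ = M (t i) * ∫ x in S i, g x * u x ∂μ +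
        ∫ x in S i, (g x * (M (τ x) * u x) - M (t i) * (g x * u x)) ∂μ := by
      rw [integral_sub hF.integrableOn (hgu.const_mul _).integrableOn, integral_const_mul]
      ring
    have e3 : |∫ x in S i, (g x * (M (τ x) * u x) - M (t i) * (g x * u x)) ∂μ| ≤
        (M (t (i + 1)) - M (t i)) * ∫ x in S i, u x ∂μ := by
      rw [← integral_const_mul, ← Real.norm_eq_abs]
      refine norm_integral_le_of_norm_le (huint.const_mul _).integrableOn ?_
      refine (ae_restrict_iff' (hSm i)).2 (ae_of_all _ fun x hx => ?_)
      have a1 : M (t i) ≤ M (τ x) := hM hx.1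
      have a2 : M (τ x) ≤ M (t (i + 1)) := hM hx.2.le
      have a3 : g x * (M (τ x) * u x) - M (t i) * (g x * u x) =
        g x * ((M (τ x) - M (t i)) * u x) := by ring
      rw [a3, norm_mul, Real.norm_eq_abs, Real.norm_eq_abs,
        abs_of_nonneg (mul_nonneg (sub_nonneg.2 a1) (hu0 x))]
      refine (mul_le_of_le_one_left (mul_nonneg (sub_nonneg.2 a1) (hu0 x)) (hgb x)).trans ?_
      exact mul_le_mul_of_nonneg_right (by linarith) (hu0 x)
    have hiK : i + 1 ≤ K := Finset.mem_range.1 hi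
    have e4 := hstrip (t i) (t (i + 1)) (ht0 ▸ htm (Nat.zero_le i)) (htm (Nat.le_succ i))
      (htK ▸ htm hiK)
    have e5 : t (i + 1) - t i = (β - α) / K := by simp only [ht]; push_cast; ring
    rw [e5] at e4
    rw [e2]
    refine (abs_add_le _ _).trans (add_le_add ?_ (e3.trans (mul_le_mul_of_nonneg_left e4 hMi)))
    rw [abs_mul, abs_of_nonneg (hM0 _)]
    exact mul_le_of_le_one_left (abs_nonneg _) (hM1 _)
  rw [e1]
  refine (Finset.abs_sum_le_sum_abs _ _).trans ((Finset.sum_le_sum hpiece).trans ?_)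
  rw [Finset.sum_add_distrib, ← Finset.sum_mul, Finset.sum_range_sub (fun i => M (t i))]
  have h5 : (M (t K) - M (t 0)) * (C' * ((β - α) / K)) ≤ 1 * (ε / 2) := by
    refine mul_le_mul ?_ hsmall (by positivity) zero_le_one
    linarith [hM0 (t 0), hM1 (t K)]
  linarith

end MonotoneMixing

section Branch

theorem eq_one_or_eq_neg_one_of_sq {σ : ℝ} (hσ : σ ^ 2 = 1) : σ = 1 ∨ σ = -1 := by
  rwa [sq, mul_self_eq_one_iff] at hσ

/-- A Harnack-type inequality, preserved by transfer operators of maps with negative Schwarzian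
derivative: `f` on an interval inside `S` satisfies `f z (y - z)² ≤ f x (y - x)²`. -/
def Harnack (f : ℝ → ℝ≥0∞) (S : Set ℝ) : Prop :=
  ∀ x y z, uIcc x y ⊆ S → z ∈ uIcc x y →
    f z * ENNReal.ofReal ((y - z) ^ 2) ≤ f x * ENNReal.ofReal ((y - x) ^ 2)

theorem Harnack.add {f g : ℝ → ℝ≥0∞} {S : Set ℝ} (hf : Harnack f S) (hg : Harnack g S) :
    Harnack (f + g) S := fun x y z h hz => by
  simp only [Pi.add_apply, add_mul]
  exact add_le_add (hf x y z h hz) (hg x y z h hz)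

theorem Harnack.mono {f : ℝ → ℝ≥0∞} {S S' : Set ℝ} (hf : Harnack f S) (h : S' ⊆ S) :
    Harnack f S' := fun x y z hxy hz => hf x y z (hxy.trans h) hz

theorem Harnack.limsup {f : ℕ → ℝ → ℝ≥0∞} {S : Set ℝ} (hf : ∀ n, Harnack (f n) S) :
    Harnack (fun x => Filter.limsup (fun n => f n x) atTop) S := by
  intro x y z hxy hz
  rw [mul_comm, mul_comm _ (ENNReal.ofReal ((y - x) ^ 2)),
    ← ENNReal.limsup_const_mul_of_ne_top ENNReal.ofReal_ne_top,
    ← ENNReal.limsup_const_mul_of_ne_top ENNReal.ofReal_ne_top]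
  refine limsup_le_limsup (Eventually.of_forall fun n => ?_)
  simpa [mul_comm] using hf n x y z hxy hz

variable {a : ℝ}

/-- The inverse branch of `Ta a` with sign `σ`. -/
noncomputable def invBranch (a σ x : ℝ) : ℝ := σ * √((1 - x) / a)

theorem Ta_invBranch (ha : 0 < a) {σ x : ℝ} (hσ : σ ^ 2 = 1) (hx : x ≤ 1) :
    Ta a (invBranch a σ x) = x := by
  have : 0 ≤ (1 - x) / a := div_nonneg (by linarith) ha.le
  simp only [Ta, invBranch, mul_pow, hσ, Real.sq_sqrt this]
  field_simp
  ring

theorem invBranch_Ta (ha : 0 < a) {σ v : ℝ} (hσ : σ ^ 2 = 1) (hv : 0 ≤ σ * v) :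
    invBranch a σ (Ta a v) = v := by
  have h : (1 - Ta a v) / a = (σ * v) ^ 2 := by
    simp only [Ta, mul_pow, hσ]; field_simp; ring
  rw [invBranch, h, Real.sqrt_sq hv, ← mul_assoc, ← sq, hσ, one_mul]

theorem Ta_lt_one (ha : 0 < a) {v : ℝ} (hv : v ≠ 0) : Ta a v < 1 := by
  have : 0 < a * v ^ 2 := by positivity
  simp only [Ta]; linarith

theorem sigma_mul_invBranch_pos (ha : 0 < a) {σ x : ℝ} (hσ : σ ^ 2 = 1) (hx : x < 1) :
    0 < σ * invBranch a σ x := by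
  rw [invBranch, ← mul_assoc, ← sq, hσ, one_mul]
  exact Real.sqrt_pos.2 (div_pos (by linarith) ha)

/-- The transfer operator of a single branch of `Ta a`. -/
noncomputable def branchOp (a σ : ℝ) (f : ℝ → ℝ≥0∞) (x : ℝ) : ℝ≥0∞ :=
  (Iio (1 : ℝ)).indicator
    (fun x => ENNReal.ofReal (2 * a * √((1 - x) / a))⁻¹ * f (invBranch a σ x)) x

theorem measurable_invBranch (a σ : ℝ) : Measurable (invBranch a σ) := by
  unfold invBranch; fun_prop

theorem measurable_branchOp (σ : ℝ) {f : ℝ → ℝ≥0∞} (hf : Measurable f) :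
    Measurable (branchOp a σ f) := by
  unfold branchOp
  refine Measurable.indicator ?_ measurableSet_Iio
  exact Measurable.mul (by fun_prop) (hf.comp (measurable_invBranch a σ))

theorem lintegral_branchOp (ha : 0 < a) {σ : ℝ} (hσ : σ ^ 2 = 1) (f : ℝ → ℝ≥0∞)
    {A : Set ℝ} (hA : MeasurableSet A) :
    ∫⁻ x in A, branchOp a σ f x = ∫⁻ x in Ta a ⁻¹' A ∩ {v | 0 < σ * v}, f x := by
  have himg : invBranch a σ '' (A ∩ Iio 1) = Ta a ⁻¹' A ∩ {v | 0 < σ * v} := by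
    ext v
    constructor
    · rintro ⟨x, ⟨hxA, hx1⟩, rfl⟩
      refine ⟨?_, sigma_mul_invBranch_pos ha hσ hx1⟩
      rw [mem_preimage, Ta_invBranch ha hσ (le_of_lt hx1)]; exact hxA
    · rintro ⟨h1, h2⟩
      have hv : v ≠ 0 := by rintro rfl; simp at h2
      exact ⟨Ta a v, ⟨h1, Ta_lt_one ha hv⟩, invBranch_Ta ha hσ (le_of_lt h2)⟩
  have hinj : InjOn (invBranch a σ) (A ∩ Iio 1) := by
    intro x hx y hy h
    rw [← Ta_invBranch ha hσ (le_of_lt hx.2), h, Ta_invBranch ha hσ (le_of_lt hy.2)]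
  have hder : ∀ x ∈ A ∩ Iio 1, HasDerivWithinAt (invBranch a σ)
      (σ * ((-1 / a) / (2 * √((1 - x) / a)))) (A ∩ Iio 1) x := by
    intro x hx
    have hpos : (1 - x) / a ≠ 0 := (div_pos (by have := hx.2; simp at this; linarith) ha).ne'
    have h1 : HasDerivAt (fun x : ℝ => (1 - x) / a) (-1 / a) x :=
      ((hasDerivAt_id x).const_sub 1).div_const a
    exact ((h1.sqrt hpos).const_mul σ).hasDerivWithinAt
  rw [← himg, lintegral_image_eq_lintegral_abs_deriv_mul (hA.inter measurableSet_Iio) hder hinj]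
  unfold branchOp
  rw [lintegral_indicator measurableSet_Iio, Measure.restrict_restrict measurableSet_Iio,
    inter_comm]
  refine setLIntegral_congr_fun (hA.inter measurableSet_Iio) fun x hx => ?_
  have hσ1 : |σ| = 1 := by
    have : |σ| ^ 2 = 1 := by rw [sq_abs, hσ]
    nlinarith [abs_nonneg σ]
  congr 2
  rw [abs_mul, hσ1, one_mul, abs_div, abs_div, abs_neg, abs_one, abs_of_pos ha,
    abs_of_nonneg (by positivity : 0 ≤ 2 * √((1 - x) / a))]
  field_simp

theorem add_sq_div_le {s t d : ℝ} (hs : 0 < s) (ht : 0 < t) (hd : 0 < d)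
    (h : s ∈ uIcc t d) : (s + d) ^ 2 / s ≤ (t + d) ^ 2 / t := by
  rw [div_le_div_iff₀ hs ht]
  rcases le_total t d with htd | htd
  · rw [uIcc_of_le htd] at h
    have : 0 ≤ (s - t) * (d ^ 2 - s * t) := mul_nonneg (by linarith [h.1])
      (by nlinarith [h.1, h.2])
    nlinarith
  · rw [uIcc_of_ge htd] at h
    have : 0 ≤ (t - s) * (s * t - d ^ 2) := mul_nonneg (by linarith [h.2])
      (by nlinarith [h.1, h.2])
    nlinarith

theorem invBranch_mem_uIcc (ha : 0 < a) {σ x y z : ℝ} (hσ : σ ^ 2 = 1) (hz : z ∈ uIcc x y) :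
    invBranch a σ z ∈ uIcc (invBranch a σ x) (invBranch a σ y) := by
  have hanti : Antitone fun x : ℝ => √((1 - x) / a) := fun x y h =>
    Real.sqrt_le_sqrt (div_le_div_of_nonneg_right (by linarith) ha.le)
  have h1 : √((1 - z) / a) ∈ uIcc (√((1 - x) / a)) (√((1 - y) / a)) := by
    rcases le_total x y with h | h
    · rw [uIcc_of_le h] at hz; exact mem_uIcc_of_ge (hanti hz.2) (hanti hz.1)
    · rw [uIcc_of_ge h] at hz; exact mem_uIcc_of_le (hanti hz.2) (hanti hz.1)
  have hσ' : σ = 1 ∨ σ = -1 := eq_one_or_eq_neg_one_of_sq hσ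
  unfold invBranch
  rcases hσ' with rfl | rfl
  · simpa using h1
  · simp only [neg_mul, one_mul, mem_uIcc] at h1 ⊢
    rcases h1 with h | h
    · right; constructor <;> linarith [h.1, h.2]
    · left; constructor <;> linarith [h.1, h.2]

theorem Harnack.branchOp (ha : 0 < a) {σ : ℝ} (hσ : σ ^ 2 = 1) {f : ℝ → ℝ≥0∞} {S S' : Set ℝ}
    (hf : Harnack f S) (hS : ∀ v, 0 < σ * v → Ta a v ∈ S' → v ∈ S) (h1 : (1 : ℝ) ∉ S') :
    Harnack (branchOp a σ f) S' := by
  intro x y z hxy hz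
  have hne : ∀ w ∈ uIcc x y, w ≠ 1 := fun w hw h => h1 (h ▸ hxy hw)
  by_cases hz1 : z < 1
  swap
  · rw [_root_.branchOp, indicator_of_notMem (by simpa using hz1)]
    simp
  have hx1 : x < 1 := by
    by_contra hcon
    refine hne 1 ?_ rfl
    exact (uIcc_subset_uIcc left_mem_uIcc hz) (mem_uIcc_of_ge hz1.le (not_lt.1 hcon))
  have hy1 : y < 1 := by
    by_contra hcon
    refine hne 1 ?_ rfl
    exact (uIcc_subset_uIcc right_mem_uIcc hz) (mem_uIcc_of_ge hz1.le (not_lt.1 hcon))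
  have hab : ∀ w, |invBranch a σ w| = √((1 - w) / a) := fun w => by
    have hσ1 : |σ| = 1 := by
      have : |σ| ^ 2 = 1 := by rw [sq_abs, hσ]
      nlinarith [abs_nonneg σ]
    rw [invBranch, abs_mul, hσ1, one_mul, abs_of_nonneg (Real.sqrt_nonneg _)]
  rw [_root_.branchOp, _root_.branchOp, indicator_of_mem (by simpa using hz1),
    indicator_of_mem (by simpa using hx1), ← hab z, ← hab x]
  set X := invBranch a σ x with hX
  set Y := invBranch a σ y with hY
  set Z := invBranch a σ z with hZ
  have hXp : 0 < σ * X := sigma_mul_invBranch_pos ha hσ hx1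
  have hYp : 0 < σ * Y := sigma_mul_invBranch_pos ha hσ hy1
  have hZp : 0 < σ * Z := sigma_mul_invBranch_pos ha hσ hz1
  have hZXY : Z ∈ uIcc X Y := invBranch_mem_uIcc ha hσ hz
  have hsub : uIcc X Y ⊆ S := by
    intro v hv
    have hvp : 0 < σ * v := by
      rcases eq_one_or_eq_neg_one_of_sq hσ with rfl | rfl
      · rcases mem_uIcc.1 hv with h | h <;> linarith [h.1, h.2]
      · rcases mem_uIcc.1 hv with h | h <;> linarith [h.1, h.2]
    refine hS v hvp (hxy ?_)
    have hTX : Ta a X = x := Ta_invBranch ha hσ hx1.le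
    have hTY : Ta a Y = y := Ta_invBranch ha hσ hy1.le
    rw [← hTX, ← hTY]
    have hmono : ∀ s t : ℝ, 0 < σ * s → 0 < σ * t → σ * s ≤ σ * t → Ta a t ≤ Ta a s := by
      intro s t hs ht hst
      have h2 : (σ * s) ^ 2 ≤ (σ * t) ^ 2 := by gcongr
      rw [mul_pow, mul_pow, hσ, one_mul, one_mul] at h2
      simp only [Ta]; nlinarith
    have hv2 : (σ * X ≤ σ * v ∧ σ * v ≤ σ * Y) ∨ (σ * Y ≤ σ * v ∧ σ * v ≤ σ * X) := by
      rcases eq_one_or_eq_neg_one_of_sq hσ with rfl | rfl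
      · rcases mem_uIcc.1 hv with h | h
        · left; constructor <;> linarith [h.1, h.2]
        · right; constructor <;> linarith [h.1, h.2]
      · rcases mem_uIcc.1 hv with h | h
        · right; constructor <;> linarith [h.1, h.2]
        · left; constructor <;> linarith [h.1, h.2]
    rcases hv2 with h | h
    · exact mem_uIcc_of_ge (hmono _ _ hvp hYp h.2) (hmono _ _ hXp hvp h.1)
    · exact mem_uIcc_of_le (hmono _ _ hvp hXp h.2) (hmono _ _ hYp hvp h.1)
  have key := hf X Y Z hsub hZXY
  have hxX : x = 1 - a * X ^ 2 := (Ta_invBranch ha hσ hx1.le).symm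
  have hyY : y = 1 - a * Y ^ 2 := (Ta_invBranch ha hσ hy1.le).symm
  have hzZ : z = 1 - a * Z ^ 2 := (Ta_invBranch ha hσ hz1.le).symm
  have habs : ∀ w, 0 < σ * w → |w| = σ * w := fun w hw => by
    rcases eq_one_or_eq_neg_one_of_sq hσ with rfl | rfl
    · rw [one_mul] at hw ⊢; exact abs_of_pos hw
    · rw [neg_one_mul] at hw ⊢; exact abs_of_neg (by linarith)
  have hfac : ∀ W w : ℝ, 0 < σ * W → w = 1 - a * W ^ 2 →
      (2 * a * |W|)⁻¹ * (y - w) ^ 2 = (a / 2 * ((|W| + |Y|) ^ 2 / |W|)) * (Y - W) ^ 2 := by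
    intro W w hW hw
    rw [hw, hyY, habs W hW, habs Y hYp]
    have hW0 : W ≠ 0 := by rintro rfl; simp at hW
    rcases eq_one_or_eq_neg_one_of_sq hσ with h | h <;> rw [h] <;> field_simp <;> ring
  have hXW : 0 < |X| := by rw [habs X hXp]; exact hXp
  have hYW : 0 < |Y| := by rw [habs Y hYp]; exact hYp
  have hZW : 0 < |Z| := by rw [habs Z hZp]; exact hZp
  have hmem : |Z| ∈ uIcc |X| |Y| := by
    rw [habs X hXp, habs Y hYp, habs Z hZp]
    rcases eq_one_or_eq_neg_one_of_sq hσ with rfl | rfl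
    · simpa using hZXY
    · simp only [neg_mul, one_mul, mem_uIcc] at hZXY ⊢
      rcases hZXY with h | h
      · right; constructor <;> linarith [h.1, h.2]
      · left; constructor <;> linarith [h.1, h.2]
  have hk := add_sq_div_le hZW hXW hYW hmem
  have e : ∀ W w : ℝ, 0 < σ * W → w = 1 - a * W ^ 2 →
      ENNReal.ofReal (2 * a * |W|)⁻¹ * f W * ENNReal.ofReal ((y - w) ^ 2) =
      ENNReal.ofReal (a / 2 * ((|W| + |Y|) ^ 2 / |W|)) *
        (f W * ENNReal.ofReal ((Y - W) ^ 2)) := by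
    intro W w hW hw
    have h0 : 0 < |W| := by rw [habs W hW]; exact hW
    have h2 := congrArg ENNReal.ofReal (hfac W w hW hw)
    rw [ENNReal.ofReal_mul (by positivity), ENNReal.ofReal_mul (by positivity)] at h2
    calc _ = (ENNReal.ofReal (2 * a * |W|)⁻¹ * ENNReal.ofReal ((y - w) ^ 2)) * f W := by ring
      _ = _ := by rw [h2]; ring
  rw [e Z z hZp hzZ, e X x hXp hxX]
  gcongr

end Branch

section Homterval

variable {a : ℝ}

theorem continuous_Ta (a : ℝ) : Continuous (Ta a) := by unfold Ta; fun_prop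

theorem measurable_Ta (a : ℝ) : Measurable (Ta a) := (continuous_Ta a).measurable

/-- The points never mapped to the critical point. -/
def noCrit (a : ℝ) : Set ℝ := {x | ∀ n, (Ta a)^[n] x ≠ 0}

theorem mapsTo_noCrit (a : ℝ) (m : ℕ) : MapsTo ((Ta a)^[m]) (noCrit a) (noCrit a) := by
  intro x hx n
  rw [← Function.iterate_add_apply]
  exact hx _

theorem monotoneOn_or_antitoneOn_Ta (ha : 0 < a) {Z : Set ℝ} (hZ : IsPreconnected Z)
    (h0 : (0 : ℝ) ∉ Z) : MonotoneOn (Ta a) Z ∨ AntitoneOn (Ta a) Z := by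
  have hsign : (∀ x ∈ Z, 0 < x) ∨ (∀ x ∈ Z, x < 0) := by
    by_contra! hcon
    obtain ⟨⟨x, hx, hx0⟩, y, hy, hy0⟩ := hcon
    exact h0 (hZ.ordConnected.out hx hy ⟨hx0, hy0⟩)
  rcases hsign with h | h
  · right
    intro x hx y hy hxy
    have := h x hx
    simp only [Ta]
    have : x ^ 2 ≤ y ^ 2 := by nlinarith
    nlinarith
  · left
    intro x hx y hy hxy
    have := h y hy
    simp only [Ta]
    have : y ^ 2 ≤ x ^ 2 := by nlinarith
    nlinarith

theorem monotoneOn_or_antitoneOn_iterate_Ta (ha : 0 < a) (n : ℕ) :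
    ∀ {Z : Set ℝ}, IsPreconnected Z → (∀ m < n, ∀ x ∈ Z, (Ta a)^[m] x ≠ 0) →
    MonotoneOn ((Ta a)^[n]) Z ∨ AntitoneOn ((Ta a)^[n]) Z := by
  induction n with
  | zero => intro Z _ _; left; simpa using monotoneOn_id
  | succ n ih =>
    intro Z hZ hne
    have hZ' : IsPreconnected (Ta a '' Z) := hZ.image _ (continuous_Ta a).continuousOn
    have h1 := ih hZ' (by
      rintro m hm _ ⟨x, hx, rfl⟩
      rw [← Function.iterate_succ_apply]
      exact hne (m + 1) (by omega) x hx)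
    have h2 := monotoneOn_or_antitoneOn_Ta ha hZ (fun h => hne 0 (by omega) 0 h rfl)
    rw [Function.iterate_succ]
    have hm : MapsTo (Ta a) Z (Ta a '' Z) := mapsTo_image _ _
    rcases h1 with h1 | h1 <;> rcases h2 with h2 | h2
    · exact Or.inl (h1.comp h2 hm)
    · exact Or.inr (h1.comp_AntitoneOn h2 hm)
    · exact Or.inr (h1.comp_MonotoneOn h2 hm)
    · exact Or.inl (h1.comp h2 hm)

open Polynomial in
theorem finite_fixedPoints_iterate_Ta (ha : a ≠ 0) {n : ℕ} (hn : 1 ≤ n) :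
    {x | (Ta a)^[n] x = x}.Finite := by
  set P : ℝ[X] := 1 - C a * X ^ 2 with hP
  have hdeg : P.natDegree = 2 := by
    rw [hP]; compute_degree!
  have hQ : ((P.comp)^[n] X).natDegree = 2 ^ n := by
    rw [natDegree_iterate_comp, hdeg]
    simp
  have heval : ∀ x, ((P.comp)^[n] X).eval x = (Ta a)^[n] x := by
    intro x
    rw [iterate_comp_eval]
    have : (fun x => P.eval x) = Ta a := by ext x; simp [hP, Ta]
    rw [this]; simp
  have hne : (P.comp)^[n] X - X ≠ 0 := by
    intro h
    rw [sub_eq_zero] at h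
    rw [h, natDegree_X] at hQ
    have : 2 ^ 1 ≤ 2 ^ n := Nat.pow_le_pow_right (by norm_num) hn
    omega
  refine (Polynomial.finite_setOfPred_isRoot hne).subset fun x hx => ?_
  have hx : (Ta a)^[n] x = x := hx
  simp [IsRoot, heval, hx]

theorem measure_connectedComponentIn_noCrit (ha : 0 < a) {μ : Measure ℝ} [IsFiniteMeasure μ]
    [NullSingletonClass μ] (hT : MeasurePreserving (Ta a) μ μ) (z : ℝ) :
    μ (connectedComponentIn (noCrit a) z) = 0 := by
  set D := connectedComponentIn (noCrit a) z with hD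
  have hDpre : IsPreconnected D := isPreconnected_connectedComponentIn
  have hDsub : D ⊆ noCrit a := connectedComponentIn_subset _ _
  have hDm : MeasurableSet D := hDpre.ordConnected.measurableSet
  by_contra hpos
  obtain ⟨x₀, hx₀, m, hm, hmx⟩ := hT.exists_mem_iterate_mem hDm.nullMeasurableSet hpos
  have hmaps : MapsTo ((Ta a)^[m]) D D := by
    have himg : IsPreconnected ((Ta a)^[m] '' D) :=
      hDpre.image _ ((continuous_Ta a).iterate m).continuousOn
    have hz : z ∈ noCrit a := by
      by_contra hz
      rw [hD, connectedComponentIn_eq_empty hz] at hx₀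
      exact hx₀
    have h1 : (Ta a)^[m] '' D ⊆ noCrit a := by
      rintro _ ⟨x, hx, rfl⟩; exact mapsTo_noCrit a m (hDsub hx)
    have h2 := himg.subset_connectedComponentIn (mem_image_of_mem _ hx₀) h1
    rw [← connectedComponentIn_eq hmx] at h2
    exact fun x hx => h2 (mem_image_of_mem _ hx)
  have hmono : MonotoneOn ((Ta a)^[m * 2]) D := by
    have h := monotoneOn_or_antitoneOn_iterate_Ta ha m hDpre (fun k _ x hx => hDsub hx k)
    rw [mul_two, Function.iterate_add]
    rcases h with h | h
    · exact h.comp h hmaps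
    · exact h.comp h hmaps
  have hmaps2 : MapsTo ((Ta a)^[m * 2]) D D := by
    rw [mul_two, Function.iterate_add]; exact hmaps.comp hmaps
  set f := (Ta a)^[m * 2] with hf
  have hfpres : MeasurePreserving f μ μ := hT.iterate _
  have hup : ∀ x ∈ D, x ≤ f x → ∀ n, f^[n] x ≤ f^[n + 1] x ∧ f^[n] x ∈ D := by
    intro x hx hxf n
    induction n with
    | zero => exact ⟨hxf, hx⟩
    | succ n ih =>
      have hD1 : f^[n + 1] x ∈ D := by rw [Function.iterate_succ_apply']; exact hmaps2 ih.2
      refine ⟨?_, hD1⟩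
      rw [Function.iterate_succ_apply' f (n + 1)]
      conv_lhs => rw [Function.iterate_succ_apply']
      exact hmono ih.2 hD1 ih.1
  have hdown : ∀ x ∈ D, f x ≤ x → ∀ n, f^[n + 1] x ≤ f^[n] x ∧ f^[n] x ∈ D := by
    intro x hx hxf n
    induction n with
    | zero => exact ⟨hxf, hx⟩
    | succ n ih =>
      have hD1 : f^[n + 1] x ∈ D := by rw [Function.iterate_succ_apply']; exact hmaps2 ih.2
      refine ⟨?_, hD1⟩
      rw [Function.iterate_succ_apply' f (n + 1)]
      conv_rhs => rw [Function.iterate_succ_apply']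
      exact hmono hD1 ih.2 ih.1
  have hfm : Measurable f := hfpres.measurable
  have hup0 : ∀ q : ℚ, μ (D ∩ {x | x < q ∧ (q : ℝ) < f x}) = 0 := by
    intro q
    by_contra hne
    obtain ⟨x, hx, n, hn, hnx⟩ := hfpres.exists_mem_iterate_mem
      (hDm.inter ((measurableSet_lt measurable_id measurable_const).inter
        (measurableSet_lt measurable_const hfm))).nullMeasurableSet hne
    have hxf : x ≤ f x := (hx.2.1.trans hx.2.2).le
    have hmon : Monotone fun n => f^[n] x := monotone_nat_of_le_succ fun n => (hup x hx.1 hxf n).1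
    have h1 : f^[1] x ≤ f^[n] x := hmon (Nat.one_le_iff_ne_zero.2 hn)
    have h2 : f^[n] x < q := hnx.2.1
    have h3 : (q : ℝ) < f x := hx.2.2
    simp only [Function.iterate_one] at h1
    linarith
  have hdown0 : ∀ q : ℚ, μ (D ∩ {x | (q : ℝ) < x ∧ f x < q}) = 0 := by
    intro q
    by_contra hne
    obtain ⟨x, hx, n, hn, hnx⟩ := hfpres.exists_mem_iterate_mem
      (hDm.inter ((measurableSet_lt measurable_const measurable_id).inter
        (measurableSet_lt hfm measurable_const))).nullMeasurableSet hne
    have hxf : f x ≤ x := (hx.2.2.trans hx.2.1).le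
    have hmon : Antitone fun n => f^[n] x := antitone_nat_of_succ_le fun n => (hdown x hx.1 hxf n).1
    have h1 : f^[n] x ≤ f^[1] x := hmon (Nat.one_le_iff_ne_zero.2 hn)
    have h2 : (q : ℝ) < f^[n] x := hnx.2.1
    have h3 : f x < q := hx.2.2
    simp only [Function.iterate_one] at h1
    linarith
  have hfix : μ {x | f x = x} = 0 :=
    (finite_fixedPoints_iterate_Ta ha.ne' (by omega)).measure_zero μ
  refine hpos (measure_mono_null (t := ((⋃ q : ℚ, D ∩ {x | x < q ∧ (q : ℝ) < f x}) ∪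
    ⋃ q : ℚ, D ∩ {x | (q : ℝ) < x ∧ f x < q}) ∪ {x | f x = x}) ?_ ?_)
  · intro x hx
    rcases lt_trichotomy x (f x) with h | h | h
    · obtain ⟨q, h1, h2⟩ := exists_rat_btwn h
      exact Or.inl (Or.inl (mem_iUnion.2 ⟨q, hx, h1, h2⟩))
    · exact Or.inr h.symm
    · obtain ⟨q, h1, h2⟩ := exists_rat_btwn h
      exact Or.inl (Or.inr (mem_iUnion.2 ⟨q, hx, h2, h1⟩))
  · rw [measure_union_null_iff, measure_union_null_iff, measure_iUnion_null_iff,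
      measure_iUnion_null_iff]
    exact ⟨⟨hup0, hdown0⟩, hfix⟩

theorem ae_forall_uIcc_meets_noCrit_compl (ha : 0 < a) {μ : Measure ℝ} [IsFiniteMeasure μ]
    [NullSingletonClass μ] (hT : MeasurePreserving (Ta a) μ μ) :
    ∀ᵐ x ∂μ, ∀ y, y ≠ x → ∃ v ∈ uIcc x y, ∃ n, (Ta a)^[n] v = 0 := by
  have h : ∀ᵐ x ∂μ, ∀ q : ℚ, x ∉ connectedComponentIn (noCrit a) q := by
    rw [ae_all_iff]
    intro q
    rw [ae_iff]
    simpa using measure_connectedComponentIn_noCrit ha hT q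
  filter_upwards [h] with x hx y hy
  by_contra! hcon
  have hlt : min x y < max x y := by simpa using hy
  obtain ⟨q, hq1, hq2⟩ := exists_rat_btwn hlt
  refine hx q ((isPreconnected_uIcc (a := x) (b := y)).subset_connectedComponentIn
    ⟨hq1.le, hq2.le⟩ (fun v hv => ?_) left_mem_uIcc)
  exact fun n => hcon v hv n

end Homterval

section Density

variable {a : ℝ}

/-- The forward orbit of the critical value. -/
def postCrit (a : ℝ) : Set ℝ := range fun m : ℕ => (Ta a)^[m + 1] 0

theorem one_mem_postCrit (a : ℝ) : (1 : ℝ) ∈ postCrit a := ⟨0, by simp [Ta]⟩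

theorem Ta_mem_postCrit {x : ℝ} (hx : x ∈ postCrit a) : Ta a x ∈ postCrit a := by
  obtain ⟨m, rfl⟩ := hx
  exact ⟨m + 1, by simp only [Function.iterate_succ_apply']⟩

theorem iterate_mem_postCrit {x : ℝ} (hx : x ∈ postCrit a) (n : ℕ) :
    (Ta a)^[n] x ∈ postCrit a := by
  induction n with
  | zero => exact hx
  | succ n ih => rw [Function.iterate_succ_apply']; exact Ta_mem_postCrit ih

/-- Points not mapped into the postcritical set by the `n`-th iterate. -/
def offPost (a : ℝ) (n : ℕ) : Set ℝ := {x | (Ta a)^[n] x ∉ postCrit a}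

theorem isOpen_offPost (hfin : (postCrit a).Finite) (n : ℕ) : IsOpen (offPost a n) :=
  hfin.isClosed.isOpen_compl.preimage ((continuous_Ta a).iterate n)

theorem offPost_antitone (a : ℝ) : Antitone (offPost a) := by
  refine antitone_nat_of_succ_le fun n x hx hx' => hx ?_
  rw [Function.iterate_succ_apply']
  exact Ta_mem_postCrit hx'

theorem one_notMem_offPost (a : ℝ) (n : ℕ) : (1 : ℝ) ∉ offPost a n := fun h =>
  h (iterate_mem_postCrit (one_mem_postCrit a) n)

/-- The transfer operator of `Ta a`. -/
noncomputable def transfer (a : ℝ) (f : ℝ → ℝ≥0∞) : ℝ → ℝ≥0∞ :=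
  branchOp a 1 f + branchOp a (-1) f

theorem measurable_transfer {f : ℝ → ℝ≥0∞} (hf : Measurable f) : Measurable (transfer a f) :=
  (measurable_branchOp 1 hf).add (measurable_branchOp (-1) hf)

theorem setLIntegral_transfer (ha : 0 < a) {f : ℝ → ℝ≥0∞} (hf : Measurable f) {A : Set ℝ}
    (hA : MeasurableSet A) : ∫⁻ x in A, transfer a f x = ∫⁻ x in Ta a ⁻¹' A, f x := by
  simp only [transfer, Pi.add_apply]
  rw [lintegral_add_left (measurable_branchOp 1 hf), lintegral_branchOp ha (by norm_num) f hA,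
    lintegral_branchOp ha (by norm_num) f hA]
  have hm : MeasurableSet (Ta a ⁻¹' A) := measurable_Ta a hA
  rw [← lintegral_union (hm.inter (measurableSet_lt measurable_const (by fun_prop)))
    (by
      rw [disjoint_left]
      rintro x ⟨-, h1⟩ ⟨-, h2⟩
      have h1 : 0 < 1 * x := h1
      have h2 : 0 < -1 * x := h2
      linarith)]
  refine setLIntegral_congr ?_
  have h0 : ∀ᵐ x ∂(volume : Measure ℝ), x ≠ 0 := by simp [ae_iff]
  filter_upwards [h0] with x hx
  apply propext
  change ((x ∈ Ta a ⁻¹' A ∧ 0 < 1 * x) ∨ (x ∈ Ta a ⁻¹' A ∧ 0 < -1 * x)) ↔ x ∈ Ta a ⁻¹' A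
  rcases lt_or_gt_of_ne hx with h | h
  · simp [h, h.le]
  · simp [h, h.le]

theorem lintegral_transfer (ha : 0 < a) {f : ℝ → ℝ≥0∞} (hf : Measurable f) :
    ∫⁻ x, transfer a f x = ∫⁻ x, f x := by
  simpa using setLIntegral_transfer ha hf MeasurableSet.univ

theorem transfer_le_add {f g e : ℝ → ℝ≥0∞} (h : ∀ x, f x ≤ g x + e x) (x : ℝ) :
    transfer a f x ≤ transfer a g x + transfer a e x := by
  have hb : ∀ σ, branchOp a σ f x ≤ branchOp a σ g x + branchOp a σ e x := by
    intro σ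
    unfold branchOp
    by_cases hx : x ∈ Iio (1 : ℝ)
    · simp only [indicator_of_mem hx]
      rw [← mul_add]
      gcongr
      exact h _
    · simp [indicator_of_notMem hx]
  simp only [transfer, Pi.add_apply]
  calc _ ≤ _ := add_le_add (hb 1) (hb (-1))
    _ = _ := by ring

theorem Harnack.transfer (ha : 0 < a) {f : ℝ → ℝ≥0∞} {n : ℕ} (hf : Harnack f (offPost a (n + 1))) :
    Harnack (transfer a f) (offPost a n) :=
  (hf.branchOp ha (by norm_num) (fun v _ hv => by
      change (Ta a)^[n + 1] v ∉ _; rw [Function.iterate_succ_apply]; exact hv)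
    (one_notMem_offPost a n)).add
  (hf.branchOp ha (by norm_num) (fun v _ hv => by
      change (Ta a)^[n + 1] v ∉ _; rw [Function.iterate_succ_apply]; exact hv)
    (one_notMem_offPost a n))

theorem transfer_ae_eq (ha : 0 < a) {h : ℝ → ℝ≥0∞} (hh : Measurable h)
    (hT : MeasurePreserving (Ta a) (volume.withDensity h) (volume.withDensity h)) :
    transfer a h =ᵐ[volume] h := by
  refine ae_eq_of_forall_setLIntegral_eq_of_sigmaFinite (measurable_transfer hh) hh
    fun s hs _ => ?_
  rw [setLIntegral_transfer ha hh hs, ← withDensity_apply _ (measurable_Ta a hs),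
    ← withDensity_apply _ hs, hT.measure_preimage hs.nullMeasurableSet]

/-- The infimum of `g` over the interval components of `S`. -/
noncomputable def infOn (g : ℝ → ℝ≥0∞) (S : Set ℝ) (x : ℝ) : ℝ≥0∞ :=
  S.indicator (fun x => ⨅ y, ⨅ _ : uIcc x y ⊆ S, g y) x

theorem infOn_le (g : ℝ → ℝ≥0∞) (S : Set ℝ) (x : ℝ) : infOn g S x ≤ g x := by
  unfold infOn
  by_cases hx : x ∈ S
  · rw [indicator_of_mem hx]
    exact iInf₂_le x (by simpa using hx)
  · rw [indicator_of_notMem hx]; exact bot_le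

theorem infOn_congr (g : ℝ → ℝ≥0∞) {S : Set ℝ} {x z : ℝ} (h : uIcc x z ⊆ S) :
    infOn g S x = infOn g S z := by
  have aux : ∀ {x z : ℝ}, uIcc x z ⊆ S → infOn g S x ≤ infOn g S z := by
    intro x z h
    unfold infOn
    rw [indicator_of_mem (h left_mem_uIcc), indicator_of_mem (h right_mem_uIcc)]
    refine le_iInf₂ fun y hy => iInf₂_le y ?_
    exact uIcc_subset_uIcc_union_uIcc.trans (union_subset h hy)
  exact le_antisymm (aux h) (aux (by rwa [uIcc_comm]))

theorem harnack_infOn (g : ℝ → ℝ≥0∞) (S : Set ℝ) : Harnack (infOn g S) S := by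
  intro x y z hxy hz
  rw [infOn_congr g ((uIcc_subset_uIcc left_mem_uIcc hz).trans hxy)]
  refine mul_le_mul_right (ENNReal.ofReal_le_ofReal ?_) _
  rcases mem_uIcc.1 hz with h | h <;> nlinarith [h.1, h.2]

theorem measurable_infOn (g : ℝ → ℝ≥0∞) {S : Set ℝ} (hS : IsOpen S) :
    Measurable (infOn g S) := by
  refine measurable_of_Ioi fun c => IsOpen.measurableSet ?_
  rw [Metric.isOpen_iff]
  intro x hx
  have hxS : x ∈ S := by
    by_contra hcon
    have hx : c < infOn g S x := hx
    rw [infOn, indicator_of_notMem hcon] at hx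
    exact not_lt_bot hx
  obtain ⟨ε, hε, hball⟩ := Metric.isOpen_iff.1 hS x hxS
  refine ⟨ε, hε, fun z hz => ?_⟩
  have hsub : uIcc x z ⊆ S := by
    rw [← segment_eq_uIcc]
    exact ((convex_ball x ε).segment_subset (Metric.mem_ball_self hε) hz).trans hball
  change c < infOn g S z
  rwa [← infOn_congr g hsub]

theorem tendsto_infOn_offPost {g : ℝ → ℝ≥0∞} (hg : LowerSemicontinuous g) {x : ℝ}
    (hx0 : ∀ n, x ∈ offPost a n)
    (hx : ∀ y, y ≠ x → ∃ v ∈ uIcc x y, ∃ n, v ∉ offPost a n) :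
    Tendsto (fun n => infOn g (offPost a n) x) atTop (𝓝 (g x)) := by
  refine tendsto_order.2 ⟨fun c hc => ?_, fun c hc =>
    Eventually.of_forall fun n => (infOn_le _ _ _).trans_lt hc⟩
  obtain ⟨c', hc1, hc2⟩ := exists_between hc
  obtain ⟨ε, hε, hball⟩ := Metric.eventually_nhds_iff_ball.1 (hg x c' hc2)
  obtain ⟨v₁, hv₁, n₁, hn₁⟩ := hx (x - ε / 2) (by linarith)
  obtain ⟨v₂, hv₂, n₂, hn₂⟩ := hx (x + ε / 2) (by linarith)
  filter_upwards [eventually_ge_atTop (max n₁ n₂)] with n hn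
  refine hc1.trans_le ?_
  unfold infOn
  rw [indicator_of_mem (hx0 n)]
  refine le_iInf₂ fun y hy => (hball y ?_).le
  have h1 : v₁ ∉ uIcc x y := fun h =>
    hn₁ (offPost_antitone a ((le_max_left _ _).trans hn) (hy h))
  have h2 : v₂ ∉ uIcc x y := fun h =>
    hn₂ (offPost_antitone a ((le_max_right _ _).trans hn) (hy h))
  rw [uIcc_of_ge (by linarith)] at hv₁
  rw [uIcc_of_le (by linarith)] at hv₂
  rw [Metric.mem_ball, Real.dist_eq, abs_lt]
  constructor
  · by_contra! hcon
    exact h1 (mem_uIcc_of_ge (by linarith [hv₁.1]) hv₁.2)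
  · by_contra! hcon
    exact h2 (mem_uIcc_of_le hv₂.1 (by linarith [hv₂.2]))

theorem exists_harnack_approx_offPost (ha : 0 < a) (hfin : (postCrit a).Finite)
    {h : ℝ → ℝ≥0∞} (hh : Measurable h) [IsProbabilityMeasure (volume.withDensity h)]
    (hT : MeasurePreserving (Ta a) (volume.withDensity h) (volume.withDensity h))
    {ε : ℝ≥0∞} (hε : ε ≠ 0) :
    ∃ n f, Measurable f ∧ Harnack f (offPost a n) ∧
      (∫⁻ x, (h x - f x) + (f x - h x)) ≤ ε := by
  have hInt : ∫⁻ x, h x = 1 := by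
    rw [← setLIntegral_univ, ← withDensity_apply _ MeasurableSet.univ, measure_univ]
  have hε2 : ε / 2 ≠ 0 := by simpa using hε
  obtain ⟨g, hhg, hg, hgint⟩ := exists_le_lowerSemicontinuous_lintegral_ge volume h hh
    (ε := min (ε / 2) 1) (by simp [hε])
  have hgtop : ∫⁻ x, g x ≠ ⊤ := by
    refine ne_top_of_le_ne_top ?_ hgint
    rw [hInt]
    exact ENNReal.add_ne_top.2 ⟨ENNReal.one_ne_top, ne_top_of_le_ne_top ENNReal.one_ne_top
      (min_le_right _ _)⟩
  have hgood1 := ae_forall_uIcc_meets_noCrit_compl ha hT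
  have hgood2 : ∀ᵐ x ∂(volume.withDensity h), ∀ n, x ∈ offPost a n := by
    rw [ae_all_iff]
    intro n
    have := (hT.iterate n).measure_preimage (s := postCrit a)
      hfin.measurableSet.nullMeasurableSet
    rw [hfin.measure_zero] at this
    rw [ae_iff]
    convert this using 2
    ext x
    simp [offPost]
  have hlim : Tendsto (fun n => ∫⁻ x, (h x - infOn g (offPost a n) x)) atTop
      (𝓝 (∫⁻ _ : ℝ, 0)) := by
    refine tendsto_lintegral_of_dominated_convergence h
      (fun n => hh.sub (measurable_infOn g (isOpen_offPost hfin n)))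
      (fun n => Eventually.of_forall fun x => tsub_le_self) (by rw [hInt]; simp) ?_
    rw [ae_withDensity_iff hh] at hgood1 hgood2
    filter_upwards [hgood1, hgood2, ae_lt_top hg.measurable hgtop] with x h1 h2 h3
    by_cases hx : h x = 0
    · simp [hx]
    · have := tendsto_infOn_offPost hg (h2 hx) (fun y hy => by
        obtain ⟨v, hv, n, hn⟩ := h1 hx y hy
        refine ⟨v, hv, n + 1, fun hmem => hmem ?_⟩
        rw [Function.iterate_succ_apply', hn]
        exact ⟨0, by simp⟩)
      have h4 := ENNReal.Tendsto.sub (tendsto_const_nhds (x := h x)) this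
        (Or.inr h3.ne)
      rwa [tsub_eq_zero_of_le (hhg x)] at h4
  rw [lintegral_zero] at hlim
  obtain ⟨n, hn⟩ := ((tendsto_order.1 hlim).2 (ε / 2) (pos_iff_ne_zero.2 hε2)).exists
  have hfm := measurable_infOn g (isOpen_offPost hfin n)
  refine ⟨n, infOn g (offPost a n), hfm, harnack_infOn _ _, ?_⟩
  rw [lintegral_add_left (f := fun x => h x - infOn g (offPost a n) x) (hh.sub hfm)]
  calc _ ≤ ε / 2 + ε / 2 := by
        refine add_le_add hn.le ?_
        calc _ ≤ ∫⁻ x, (g x - h x) := lintegral_mono fun x => by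
              gcongr; exact infOn_le _ _ _
          _ = (∫⁻ x, g x) - ∫⁻ x, h x :=
              lintegral_sub hh (by rw [hInt]; simp) (Eventually.of_forall hhg)
          _ ≤ min (ε / 2) 1 := by rw [tsub_le_iff_left]; exact hgint
          _ ≤ _ := min_le_left _ _
    _ = ε := ENNReal.add_halves ε

theorem exists_harnack_approx (ha : 0 < a) (hfin : (postCrit a).Finite)
    {h : ℝ → ℝ≥0∞} (hh : Measurable h) [IsProbabilityMeasure (volume.withDensity h)]
    (hT : MeasurePreserving (Ta a) (volume.withDensity h) (volume.withDensity h))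
    {ε : ℝ≥0∞} (hε : ε ≠ 0) :
    ∃ f, Measurable f ∧ Harnack f (offPost a 0) ∧ (∫⁻ x, (h x - f x) + (f x - h x)) ≤ ε := by
  obtain ⟨n, f, hf, hHf, hle⟩ := exists_harnack_approx_offPost ha hfin hh hT hε
  induction n generalizing f with
  | zero => exact ⟨f, hf, hHf, hle⟩
  | succ n ih =>
    refine ih (transfer a f) (measurable_transfer hf) (hHf.transfer ha) (le_trans ?_ hle)
    rw [lintegral_add_left (f := fun x => h x - transfer a f x) (hh.sub (measurable_transfer hf)),
      lintegral_add_left (f := fun x => h x - f x) (hh.sub hf)]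
    refine add_le_add ?_ ?_
    · calc _ ≤ ∫⁻ x, transfer a (fun x => h x - f x) x := by
            refine lintegral_mono_ae ?_
            filter_upwards [transfer_ae_eq ha hh hT] with x hx
            rw [tsub_le_iff_left, ← hx]
            exact transfer_le_add (fun x => le_add_tsub) x
        _ = _ := lintegral_transfer ha (hh.sub hf)
    · calc _ ≤ ∫⁻ x, transfer a (fun x => f x - h x) x := by
            refine lintegral_mono_ae ?_
            filter_upwards [transfer_ae_eq ha hh hT] with x hx
            rw [tsub_le_iff_left, ← hx]
            exact transfer_le_add (fun x => le_add_tsub) x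
        _ = _ := lintegral_transfer ha (hf.sub hh)

/-- An absolutely continuous invariant probability of a postcritically finite quadratic map has a
density satisfying the Harnack inequality off the postcritical set. -/
theorem exists_harnack_density (ha : 0 < a) (hfin : (postCrit a).Finite)
    {μ : Measure ℝ} [IsProbabilityMeasure μ] (hT : MeasurePreserving (Ta a) μ μ)
    (hac : μ ≪ volume) :
    ∃ H, Measurable H ∧ Harnack H (postCrit a)ᶜ ∧ μ = volume.withDensity H := by
  set h := μ.rnDeriv volume with hdef
  have hh : Measurable h := Measure.measurable_rnDeriv _ _
  have hμ : volume.withDensity h = μ := Measure.withDensity_rnDeriv_eq _ _ hac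
  have : IsProbabilityMeasure (volume.withDensity h) := by rw [hμ]; infer_instance
  have hT' : MeasurePreserving (Ta a) (volume.withDensity h) (volume.withDensity h) := by
    rwa [hμ]
  choose F hF hHF hle using fun k : ℕ => exists_harnack_approx ha hfin hh hT'
    (ε := (2⁻¹ : ℝ≥0∞) ^ k) (by simp)
  have hoff : offPost a 0 = (postCrit a)ᶜ := by ext; simp [offPost]
  refine ⟨fun x => limsup (fun k => F k x) atTop, Measurable.limsup hF, ?_, ?_⟩
  · rw [← hoff]; exact Harnack.limsup hHF
  · rw [← hμ]
    refine withDensity_congr_ae ?_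
    have hsum : ∀ᵐ x, ∑' k, ((h x - F k x) + (F k x - h x)) < ⊤ := by
      have hm : ∀ k, Measurable fun x => (h x - F k x) + (F k x - h x) := fun k =>
        (hh.sub (hF k)).add ((hF k).sub hh)
      refine ae_lt_top (Measurable.tsum hm) ?_
      rw [lintegral_tsum fun k => (hm k).aemeasurable]
      refine ne_top_of_le_ne_top ?_ (ENNReal.tsum_le_tsum hle)
      rw [ENNReal.tsum_geometric]
      simp
    have hfinite : ∀ᵐ x, h x < ⊤ := Measure.rnDeriv_lt_top μ volume
    filter_upwards [hsum, hfinite] with x hx hxfin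
    have h0 := ENNReal.tendsto_atTop_zero_of_tsum_ne_top hx.ne
    have hup : Tendsto (fun k => h x + ((h x - F k x) + (F k x - h x))) atTop (𝓝 (h x)) := by
      simpa using tendsto_const_nhds.add h0
    have hlo : Tendsto (fun k => h x - ((h x - F k x) + (F k x - h x))) atTop (𝓝 (h x)) := by
      simpa using ENNReal.Tendsto.sub (tendsto_const_nhds (x := h x)) h0 (Or.inl hxfin.ne)
    refine (tendsto_of_tendsto_of_tendsto_of_le_of_le hlo hup (fun k => ?_) (fun k => ?_)).limsup_eq.symm
    · change h x - _ ≤ F k x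
      rw [tsub_le_iff_right]
      calc h x ≤ F k x + (h x - F k x) := le_add_tsub
        _ ≤ _ := by gcongr; exact le_self_add
    · change F k x ≤ _
      calc F k x ≤ h x + (F k x - h x) := le_add_tsub
        _ ≤ _ := by gcongr; exact le_add_self

end Density

section DensityProperties

variable {a : ℝ} {H : ℝ → ℝ≥0∞} {S : Set ℝ}

theorem Harnack.center_le (hH : Harnack H S) {x w η : ℝ} (hη : 0 < η)
    (hS : Metric.closedBall x η ⊆ S) (hw : |w - x| ≤ η) :
    H x * ENNReal.ofReal (η ^ 2) ≤ H w * ENNReal.ofReal ((η + |w - x|) ^ 2) := by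
  rw [Real.closedBall_eq_Icc] at hS
  have := abs_le.1 hw
  rcases le_total w x with h | h
  · have := hH w (x + η) x (by
      rw [uIcc_of_le (by linarith)]
      exact (Icc_subset_Icc (by linarith) le_rfl).trans hS) (mem_uIcc_of_le h (by linarith))
    rw [abs_of_nonpos (by linarith)]
    convert this using 4 <;> ring
  · have := hH w (x - η) x (by
      rw [uIcc_of_ge (by linarith)]
      exact (Icc_subset_Icc le_rfl (by linarith)).trans hS) (mem_uIcc_of_ge (by linarith) h)
    rw [abs_of_nonneg (by linarith)]
    convert this using 3 <;> ring

theorem Harnack.le_center (hH : Harnack H S) {x w η : ℝ} (hη : 0 < η)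
    (hS : Metric.closedBall x η ⊆ S) (hw : |w - x| ≤ η) :
    H w * ENNReal.ofReal ((η - |w - x|) ^ 2) ≤ H x * ENNReal.ofReal (η ^ 2) := by
  rw [Real.closedBall_eq_Icc] at hS
  have := abs_le.1 hw
  rcases le_total w x with h | h
  · have := hH x (x - η) w (by
      rw [uIcc_of_ge (by linarith)]
      exact (Icc_subset_Icc le_rfl (by linarith)).trans hS) (mem_uIcc_of_ge (by linarith) h)
    rw [abs_of_nonpos (by linarith)]
    convert this using 3 <;> ring
  · have := hH x (x + η) w (by
      rw [uIcc_of_le (by linarith)]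
      exact (Icc_subset_Icc (by linarith) le_rfl).trans hS) (mem_uIcc_of_le h (by linarith))
    rw [abs_of_nonneg (by linarith)]
    convert this using 4 <;> ring

theorem withDensity_ball_le (hH : Harnack H S) {x η s : ℝ}
    (hS : Metric.closedBall x η ⊆ S) (hs : 0 < s) (hsη : s < η) :
    (volume.withDensity H) (Metric.ball x s) ≤
      H x * ENNReal.ofReal (2 * s * (η ^ 2 / (η - s) ^ 2)) := by
  have hη : 0 < η := hs.trans hsη
  rw [withDensity_apply _ Metric.isOpen_ball.measurableSet]
  calc _ ≤ ∫⁻ _ in Metric.ball x s, H x * ENNReal.ofReal (η ^ 2 / (η - s) ^ 2) := by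
        refine setLIntegral_mono' Metric.isOpen_ball.measurableSet fun w hw => ?_
        rw [Metric.mem_ball, Real.dist_eq] at hw
        rw [ENNReal.ofReal_div_of_pos (by nlinarith), ← mul_div_assoc]
        rw [ENNReal.le_div_iff_mul_le (Or.inl (by
          simpa using sub_ne_zero.2 hsη.ne')) (Or.inl ENNReal.ofReal_ne_top)]
        refine le_trans (mul_le_mul_right (ENNReal.ofReal_le_ofReal ?_) _)
          (hH.le_center hη hS (hw.le.trans hsη.le))
        nlinarith
    _ = _ := by
        rw [setLIntegral_const, Real.volume_ball, mul_assoc, ← ENNReal.ofReal_mul (by positivity)]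
        ring_nf

theorem le_withDensity_ball (hH : Harnack H S) {x η s : ℝ}
    (hS : Metric.closedBall x η ⊆ S) (hs : 0 < s) (hsη : s < η) :
    H x * ENNReal.ofReal (2 * s * (η ^ 2 / (η + s) ^ 2)) ≤
      (volume.withDensity H) (Metric.ball x s) := by
  have hη : 0 < η := hs.trans hsη
  rw [withDensity_apply _ Metric.isOpen_ball.measurableSet]
  calc _ = ∫⁻ _ in Metric.ball x s, H x * ENNReal.ofReal (η ^ 2 / (η + s) ^ 2) := by
        rw [setLIntegral_const, Real.volume_ball, mul_assoc (H x), ← ENNReal.ofReal_mul (by positivity)]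
        ring_nf
    _ ≤ _ := by
        refine setLIntegral_mono' Metric.isOpen_ball.measurableSet fun w hw => ?_
        rw [Metric.mem_ball, Real.dist_eq] at hw
        rw [ENNReal.ofReal_div_of_pos (by positivity), ← mul_div_assoc]
        refine ENNReal.div_le_of_le_mul ?_
        refine (hH.center_le hη hS (hw.le.trans hsη.le)).trans
          (mul_le_mul_right (ENNReal.ofReal_le_ofReal ?_) _)
        gcongr

theorem exists_closedBall_subset_compl (hfin : (postCrit a).Finite) {x : ℝ}
    (hx : x ∉ postCrit a) : ∃ η > 0, Metric.closedBall x η ⊆ (postCrit a)ᶜ :=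
  Metric.nhds_basis_closedBall.mem_iff.1 (hfin.isClosed.isOpen_compl.mem_nhds hx)

theorem Harnack.lt_top [IsFiniteMeasure (volume.withDensity H)]
    (hH : Harnack H (postCrit a)ᶜ) (hfin : (postCrit a).Finite) {x : ℝ} (hx : x ∉ postCrit a) :
    H x < ⊤ := by
  obtain ⟨η, hη, hS⟩ := exists_closedBall_subset_compl hfin hx
  have h := le_withDensity_ball hH hS (half_pos hη) (half_lt_self hη)
  by_contra hcon
  rw [not_lt_top_iff.1 hcon, ENNReal.top_mul] at h
  · exact (h.trans_lt (measure_lt_top _ _)).false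
  · have : 0 < 2 * (η / 2) * (η ^ 2 / (η + η / 2) ^ 2) := by positivity
    simpa using this

theorem tendsto_ball_div_of_notMem [IsFiniteMeasure (volume.withDensity H)]
    (hH : Harnack H (postCrit a)ᶜ) (hfin : (postCrit a).Finite) {x : ℝ} (hx : x ∉ postCrit a) :
    Tendsto (fun s => (volume.withDensity H).real (Metric.ball x s) / s) (𝓝[>] 0)
      (𝓝 (2 * (H x).toReal)) := by
  obtain ⟨η, hη, hS⟩ := exists_closedBall_subset_compl hfin hx
  have hxt := hH.lt_top hfin hx
  have hsmall : ∀ᶠ s : ℝ in 𝓝[>] 0, 0 < s ∧ s < η := Ioo_mem_nhdsGT hη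
  have hup : Tendsto (fun s : ℝ => 2 * (H x).toReal * (η ^ 2 / (η - s) ^ 2)) (𝓝[>] 0)
      (𝓝 (2 * (H x).toReal)) := by
    have : ContinuousAt (fun s : ℝ => 2 * (H x).toReal * (η ^ 2 / (η - s) ^ 2)) 0 := by
      refine ContinuousAt.mul continuousAt_const (ContinuousAt.div continuousAt_const
        (by fun_prop) (by simpa using hη.ne'))
    have h2 := this.tendsto
    simp only [sub_zero, div_self (pow_ne_zero 2 hη.ne'), mul_one] at h2
    exact h2.mono_left nhdsWithin_le_nhds
  have hlo : Tendsto (fun s : ℝ => 2 * (H x).toReal * (η ^ 2 / (η + s) ^ 2)) (𝓝[>] 0)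
      (𝓝 (2 * (H x).toReal)) := by
    have : ContinuousAt (fun s : ℝ => 2 * (H x).toReal * (η ^ 2 / (η + s) ^ 2)) 0 := by
      refine ContinuousAt.mul continuousAt_const (ContinuousAt.div continuousAt_const
        (by fun_prop) (by simpa using hη.ne'))
    have h2 := this.tendsto
    simp only [add_zero, div_self (pow_ne_zero 2 hη.ne'), mul_one] at h2
    exact h2.mono_left nhdsWithin_le_nhds
  refine tendsto_of_tendsto_of_tendsto_of_le_of_le' hlo hup ?_ ?_
  · filter_upwards [hsmall] with s hs
    have h := ENNReal.toReal_mono (measure_ne_top _ _) (le_withDensity_ball hH hS hs.1 hs.2)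
    have h0 : 0 < s := hs.1
    rw [ENNReal.toReal_mul, ENNReal.toReal_ofReal (by positivity)] at h
    rw [le_div_iff₀ hs.1]
    refine le_trans (le_of_eq ?_) h
    ring
  · filter_upwards [hsmall] with s hs
    have h0 : 0 < s := hs.1
    have h := ENNReal.toReal_mono (ENNReal.mul_ne_top hxt.ne ENNReal.ofReal_ne_top)
      (withDensity_ball_le hH hS hs.1 hs.2)
    rw [ENNReal.toReal_mul, ENNReal.toReal_ofReal (by positivity)] at h
    rw [div_le_iff₀ hs.1]
    refine h.trans (le_of_eq ?_)
    ring

theorem density_pos_at_zero (ha : 0 < a) (hHm : Measurable H)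
    [IsProbabilityMeasure (volume.withDensity H)]
    (hT : MeasurePreserving (Ta a) (volume.withDensity H) (volume.withDensity H))
    (hH : Harnack H (postCrit a)ᶜ) (hfin : (postCrit a).Finite) (h0 : (0 : ℝ) ∉ postCrit a) :
    0 < (H 0).toReal := by
  set μ := volume.withDensity H with hμ
  have h1 : ∀ᵐ x ∂μ, H x ≠ 0 := (ae_withDensity_iff hHm).2 (Eventually.of_forall fun x h => h)
  have h2 : ∀ᵐ x ∂μ, x ∉ postCrit a := by
    rw [ae_iff]; simpa using hfin.measure_zero μ
  obtain ⟨x, hx1, hx2, hx3⟩ := (h1.and (h2.and (ae_forall_uIcc_meets_noCrit_compl ha hT))).exists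
  obtain ⟨η, hη, hS⟩ := exists_closedBall_subset_compl hfin hx2
  obtain ⟨v, hv, n, hn⟩ := hx3 (x + η / 2) (by linarith)
  have hpos : ∀ w ∈ Metric.ball x η, H w ≠ 0 := by
    intro w hw h
    rw [Metric.mem_ball, Real.dist_eq] at hw
    have := hH.center_le hη hS hw.le
    rw [h, zero_mul, nonpos_iff_eq_zero, mul_eq_zero] at this
    rcases this with h | h
    · exact hx1 h
    · rw [ENNReal.ofReal_eq_zero] at h
      have : 0 < η ^ 2 := by positivity
      linarith
  obtain ⟨η', hη', hS'⟩ := exists_closedBall_subset_compl hfin h0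
  refine ENNReal.toReal_pos (fun hzero => ?_) (hH.lt_top hfin h0).ne
  have hball := withDensity_ball_le hH hS' (half_pos hη') (half_lt_self hη')
  rw [hzero, zero_mul, nonpos_iff_eq_zero, ← (hT.iterate n).measure_preimage
    Metric.isOpen_ball.measurableSet.nullMeasurableSet] at hball
  have hopen : IsOpen ((Ta a)^[n] ⁻¹' Metric.ball 0 (η' / 2) ∩ Metric.ball x η) :=
    (Metric.isOpen_ball.preimage ((continuous_Ta a).iterate n)).inter Metric.isOpen_ball
  have hnull := measure_mono_null (inter_subset_left (t := Metric.ball x η)) hball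
  rw [hμ, withDensity_apply _ hopen.measurableSet, setLIntegral_eq_zero_iff hopen.measurableSet hHm]
    at hnull
  have hvol : volume ((Ta a)^[n] ⁻¹' Metric.ball 0 (η' / 2) ∩ Metric.ball x η) = 0 := by
    refine measure_mono_null (fun w hw => ?_) (ae_iff.1 hnull)
    exact fun h => hpos w hw.2 (h hw)
  refine (hopen.measure_pos volume ⟨v, ?_, ?_⟩).ne' hvol
  · rw [mem_preimage, hn]; exact Metric.mem_ball_self (half_pos hη')
  · rw [uIcc_of_le (by linarith)] at hv
    rw [Metric.mem_ball, Real.dist_eq, abs_lt]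
    constructor <;> linarith [hv.1, hv.2]

end DensityProperties

section Mass

variable {a : ℝ} {μ : Measure ℝ}

/-- The mass of the balls of radius `s` around `z` is asymptotic to `Q √s`. -/
def MassLim (μ : Measure ℝ) (z Q : ℝ) : Prop :=
  Tendsto (fun s => μ.real (Metric.ball z s) / √s) (𝓝[>] 0) (𝓝 Q)

theorem tendsto_sqrt_nhdsGT_zero : Tendsto (fun s : ℝ => √s) (𝓝[>] 0) (𝓝[>] 0) := by
  refine tendsto_nhdsWithin_iff.2 ⟨?_, ?_⟩
  · have := (Real.continuous_sqrt.tendsto 0).mono_left (nhdsWithin_le_nhds (s := Ioi 0))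
    simpa using this
  · filter_upwards [self_mem_nhdsWithin] with s hs
    exact Real.sqrt_pos.2 hs

theorem MassLim.of_div {z Q : ℝ}
    (h : Tendsto (fun s => μ.real (Metric.ball z s) / s) (𝓝[>] 0) (𝓝 Q)) : MassLim μ z 0 := by
  have h2 := h.mul (tendsto_sqrt_nhdsGT_zero.mono_right nhdsWithin_le_nhds)
  rw [mul_zero] at h2
  refine h2.congr' ?_
  filter_upwards [self_mem_nhdsWithin] with s hs
  have hs : 0 < s := hs
  have : √s ≠ 0 := (Real.sqrt_pos.2 hs).ne'
  field_simp
  rw [Real.sq_sqrt hs.le]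

theorem tendsto_nhdsGT_zero_of_div {t : ℝ → ℝ} {κ : ℝ} (hκ : 0 < κ)
    (ht : Tendsto (fun s => t s / s) (𝓝[>] 0) (𝓝 κ)) : Tendsto t (𝓝[>] 0) (𝓝[>] 0) := by
  refine tendsto_nhdsWithin_iff.2 ⟨?_, ?_⟩
  · have h := ht.mul (tendsto_id.mono_right (nhdsWithin_le_nhds (a := (0 : ℝ)) (s := Ioi 0)))
    rw [mul_zero] at h
    refine h.congr' ?_
    filter_upwards [self_mem_nhdsWithin] with s hs
    have hs : 0 < s := hs
    simp only [id]
    field_simp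
  · filter_upwards [self_mem_nhdsWithin, (tendsto_order.1 ht).1 0 hκ] with s hs h
    have hs : 0 < s := hs
    exact (div_pos_iff_of_pos_right hs).1 h

theorem tendsto_comp_div_sqrt {g t : ℝ → ℝ} {κ P : ℝ} (hκ : 0 < κ)
    (hg : Tendsto (fun s => g s / √s) (𝓝[>] 0) (𝓝 P))
    (ht : Tendsto (fun s => t s / s) (𝓝[>] 0) (𝓝 κ)) :
    Tendsto (fun s => g (t s) / √s) (𝓝[>] 0) (𝓝 (P * √κ)) := by
  have ht0 := tendsto_nhdsGT_zero_of_div hκ ht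
  have h := (hg.comp ht0).mul ((Real.continuous_sqrt.tendsto κ).comp ht)
  refine h.congr' ?_
  filter_upwards [self_mem_nhdsWithin, ht0 self_mem_nhdsWithin] with s hs hts
  have hs : 0 < s := hs
  have hts : 0 < t s := hts
  simp only [Function.comp]
  rw [Real.sqrt_div hts.le]
  have h1 : √s ≠ 0 := (Real.sqrt_pos.2 hs).ne'
  have h2 : √(t s) ≠ 0 := (Real.sqrt_pos.2 hts).ne'
  field_simp

theorem massLim_one (ha : 0 < a) (hT : MeasurePreserving (Ta a) μ μ) {q : ℝ}
    (h : Tendsto (fun s => μ.real (Metric.ball 0 s) / s) (𝓝[>] 0) (𝓝 q)) :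
    MassLim μ 1 (q / √a) := by
  have h1 : Tendsto (fun s : ℝ => √(s / a)) (𝓝[>] 0) (𝓝[>] 0) := by
    refine tendsto_sqrt_nhdsGT_zero.comp (tendsto_nhdsGT_zero_of_div (κ := a⁻¹) (by positivity) ?_)
    refine tendsto_const_nhds.congr' ?_
    filter_upwards [self_mem_nhdsWithin] with s hs
    have hs : 0 < s := hs
    field_simp
  have h2 := (h.comp h1).div_const (√a)
  refine h2.congr' ?_
  filter_upwards [self_mem_nhdsWithin] with s hs
  have hs : 0 < s := hs
  simp only [Function.comp]
  have hpre : Ta a ⁻¹' Metric.ball 1 s = Metric.ball 0 √(s / a) := by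
    ext x
    rw [mem_preimage, Metric.mem_ball, Metric.mem_ball, Real.dist_eq, Real.dist_eq, sub_zero,
      Real.lt_sqrt (abs_nonneg x), sq_abs, lt_div_iff₀ ha]
    simp only [Ta]
    rw [show 1 - a * x ^ 2 - 1 = -(a * x ^ 2) by ring, abs_neg, abs_of_nonneg (by positivity),
      mul_comm]
  rw [← hpre, measureReal_def, hT.measure_preimage
    Metric.isOpen_ball.measurableSet.nullMeasurableSet, ← measureReal_def,
    Real.sqrt_div hs.le]
  have h1 : √s ≠ 0 := (Real.sqrt_pos.2 hs).ne'
  have h2 : √a ≠ 0 := (Real.sqrt_pos.2 ha).ne'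
  field_simp

theorem abs_Ta_sub_Ta (ha : 0 < a) (x z : ℝ) : |Ta a x - Ta a z| = a * (|x - z| * |x + z|) := by
  rw [← abs_mul, ← abs_of_pos ha, ← abs_mul, abs_of_pos ha, ← abs_neg]
  congr 1
  simp only [Ta]; ring

theorem mass_step_lower [IsFiniteMeasure μ] (ha : 0 < a) (hT : MeasurePreserving (Ta a) μ μ)
    {z t : ℝ} (ht0 : 0 < t) (ht : t ≤ |z|) :
    μ.real (Metric.ball z t) + μ.real (Metric.ball (-z) t) ≤
      μ.real (Metric.ball (Ta a z) (a * t * (2 * |z| + t))) := by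
  have hdisj : Disjoint (Metric.ball z t) (Metric.ball (-z) t) := by
    refine Metric.ball_disjoint_ball ?_
    rw [Real.dist_eq, sub_neg_eq_add, ← two_mul, ← two_mul, abs_mul, abs_two]
    linarith
  rw [← measureReal_union hdisj Metric.isOpen_ball.measurableSet]
  have : μ.real (Metric.ball (Ta a z) (a * t * (2 * |z| + t))) =
      μ.real (Ta a ⁻¹' Metric.ball (Ta a z) (a * t * (2 * |z| + t))) := by
    rw [measureReal_def, measureReal_def, hT.measure_preimage
      Metric.isOpen_ball.measurableSet.nullMeasurableSet]
  rw [this]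
  refine measureReal_mono ?_
  intro x hx
  rw [mem_preimage, Metric.mem_ball, Real.dist_eq, abs_Ta_sub_Ta ha, mul_assoc]
  refine mul_lt_mul_of_pos_left ?_ ha
  have h0 : 0 ≤ |z| := abs_nonneg z
  rcases hx with hx | hx
  · rw [Metric.mem_ball, Real.dist_eq] at hx
    have h2 : |x + z| ≤ 2 * |z| + t := by
      calc |x + z| = |(x - z) + 2 * z| := by ring_nf
        _ ≤ |x - z| + |2 * z| := abs_add_le _ _
        _ ≤ _ := by rw [abs_mul]; norm_num; linarith
    calc |x - z| * |x + z| ≤ |x - z| * (2 * |z| + t) := by gcongr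
      _ < _ := by gcongr
  · rw [Metric.mem_ball, Real.dist_eq, sub_neg_eq_add] at hx
    have h2 : |x - z| ≤ 2 * |z| + t := by
      calc |x - z| = |(x + z) - 2 * z| := by ring_nf
        _ ≤ |x + z| + |2 * z| := abs_sub _ _
        _ ≤ _ := by rw [abs_mul]; norm_num; linarith
    calc |x - z| * |x + z| ≤ (2 * |z| + t) * |x + z| := by gcongr
      _ < (2 * |z| + t) * t := by gcongr
      _ = _ := by ring

theorem mass_step_upper [IsFiniteMeasure μ] (ha : 0 < a) (hT : MeasurePreserving (Ta a) μ μ)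
    {z t : ℝ} (ht0 : 0 < t) (ht : t ≤ |z|) :
    μ.real (Metric.ball (Ta a z) (a * t * (2 * |z| - t))) ≤
      μ.real (Metric.ball z t) + μ.real (Metric.ball (-z) t) := by
  have : μ.real (Metric.ball (Ta a z) (a * t * (2 * |z| - t))) =
      μ.real (Ta a ⁻¹' Metric.ball (Ta a z) (a * t * (2 * |z| - t))) := by
    rw [measureReal_def, measureReal_def, hT.measure_preimage
      Metric.isOpen_ball.measurableSet.nullMeasurableSet]
  rw [this]
  refine (measureReal_mono ?_).trans (measureReal_union_le _ _)
  intro x hx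
  rw [mem_preimage, Metric.mem_ball, Real.dist_eq, abs_Ta_sub_Ta ha, mul_assoc] at hx
  have hx := lt_of_mul_lt_mul_left hx ha.le
  by_contra hcon
  rw [mem_union, not_or, Metric.mem_ball, Metric.mem_ball, Real.dist_eq, Real.dist_eq,
    sub_neg_eq_add, not_lt, not_lt] at hcon
  obtain ⟨h1, h2⟩ := hcon
  refine absurd hx (not_lt.2 ?_)
  have hprod : |x - z| * |x + z| = |(|x| - |z|)| * (|x| + |z|) := by
    have e : (|x| - |z|) * (|x| + |z|) = (x - z) * (x + z) := by
      have := sq_abs x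
      have := sq_abs z
      nlinarith
    rw [← abs_mul, ← e, abs_mul, abs_of_nonneg (by positivity : 0 ≤ |x| + |z|)]
  have hmin : t ≤ |(|x| - |z|)| := by
    rcases le_total 0 x with hx0 | hx0 <;> rcases le_total 0 z with hz0 | hz0
    · rwa [abs_of_nonneg hx0, abs_of_nonneg hz0]
    · rwa [abs_of_nonneg hx0, abs_of_nonpos hz0, sub_neg_eq_add]
    · rw [abs_of_nonpos hx0, abs_of_nonneg hz0, ← abs_neg]
      rwa [show -(-x - z) = x + z by ring]
    · rw [abs_of_nonpos hx0, abs_of_nonpos hz0, ← abs_neg]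
      rwa [show -(-x - -z) = x - z by ring]
  rw [hprod]
  have hxz : 0 ≤ |x| := abs_nonneg x
  rcases le_total |x| |z| with h | h
  · rw [abs_of_nonpos (sub_nonpos.2 h)] at hmin ⊢
    nlinarith
  · rw [abs_of_nonneg (sub_nonneg.2 h)] at hmin ⊢
    nlinarith

/-- The radius around `z` (with `w = |z|`) whose image covers exactly the radius `s`, on the side
selected by the sign `ε`. -/
noncomputable def radiusInv (a w ε s : ℝ) : ℝ := s / a / (w + √(w ^ 2 + ε * (s / a)))

theorem tendsto_radiusInv (ha : 0 < a) {w : ℝ} (hw : 0 < w) (ε : ℝ) :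
    Tendsto (fun s => radiusInv a w ε s / s) (𝓝[>] 0) (𝓝 (2 * a * w)⁻¹) := by
  have hc : ContinuousAt (fun s : ℝ => (a * (w + √(w ^ 2 + ε * (s / a))))⁻¹) 0 := by
    refine ContinuousAt.inv₀ (by fun_prop) ?_
    simp only [zero_div, mul_zero, add_zero, Real.sqrt_sq hw.le]
    positivity
  have h := hc.tendsto.mono_left (nhdsWithin_le_nhds (s := Ioi 0))
  simp only [zero_div, mul_zero, add_zero, Real.sqrt_sq hw.le] at h
  rw [show 2 * a * w = a * (w + w) by ring]
  refine h.congr' ?_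
  filter_upwards [self_mem_nhdsWithin] with s hs
  have hs : 0 < s := hs
  have : 0 < w + √(w ^ 2 + ε * (s / a)) := by positivity
  unfold radiusInv
  field_simp

theorem radiusInv_pos (ha : 0 < a) {w ε s : ℝ} (hw : 0 < w) (hs : 0 < s) :
    0 < radiusInv a w ε s := by
  unfold radiusInv; positivity

theorem radiusInv_eq (ha : 0 < a) {w ε s : ℝ} (hw : 0 < w) (hε : ε ^ 2 = 1)
    (h : 0 ≤ w ^ 2 + ε * (s / a)) :
    a * radiusInv a w ε s * (2 * w + ε * radiusInv a w ε s) = s := by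
  set R := √(w ^ 2 + ε * (s / a)) with hR
  have hR0 : 0 ≤ R := Real.sqrt_nonneg _
  have hR2 : R ^ 2 = w ^ 2 + ε * (s / a) := Real.sq_sqrt h
  have hne : w + R ≠ 0 := by positivity
  have ht : radiusInv a w ε s = ε * (R - w) := by
    unfold radiusInv
    rw [← hR, div_eq_iff hne]
    have : ε * (R - w) * (w + R) = ε * (R ^ 2 - w ^ 2) := by ring
    rw [this, hR2, show ε * (w ^ 2 + ε * (s / a) - w ^ 2) = ε ^ 2 * (s / a) by ring, hε, one_mul]
  rw [ht, show a * (ε * (R - w)) * (2 * w + ε * (ε * (R - w))) =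
    a * ε * (R - w) * (2 * w + ε ^ 2 * (R - w)) by ring, hε,
    show a * ε * (R - w) * (2 * w + 1 * (R - w)) = a * ε * (R ^ 2 - w ^ 2) by ring, hR2,
    show a * ε * (w ^ 2 + ε * (s / a) - w ^ 2) = ε ^ 2 * (a * (s / a)) by ring, hε]
  field_simp

theorem mass_step [IsFiniteMeasure μ] (ha : 0 < a) (hT : MeasurePreserving (Ta a) μ μ)
    {z : ℝ} (hz : z ≠ 0) : ∀ᶠ s in 𝓝[>] 0,
      (μ.real (Metric.ball z (radiusInv a |z| 1 s)) +
        μ.real (Metric.ball (-z) (radiusInv a |z| 1 s)) ≤ μ.real (Metric.ball (Ta a z) s)) ∧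
      (μ.real (Metric.ball (Ta a z) s) ≤ μ.real (Metric.ball z (radiusInv a |z| (-1) s)) +
        μ.real (Metric.ball (-z) (radiusInv a |z| (-1) s))) := by
  have hw : 0 < |z| := abs_pos.2 hz
  have hlim : ∀ ε, ∀ᶠ s in 𝓝[>] 0, radiusInv a |z| ε s < |z| := fun ε =>
    ((tendsto_order.1 ((tendsto_nhdsGT_zero_of_div (by positivity)
      (tendsto_radiusInv ha hw ε)).mono_right nhdsWithin_le_nhds)).2 _ hw)
  have hsmall : ∀ᶠ s : ℝ in 𝓝[>] 0, s < a * |z| ^ 2 :=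
    nhdsWithin_le_nhds (Iio_mem_nhds (by positivity))
  filter_upwards [hlim 1, hlim (-1), hsmall, self_mem_nhdsWithin] with s h1 h2 h3 hs
  have hs : 0 < s := hs
  constructor
  · have h := mass_step_lower ha hT (radiusInv_pos ha (ε := 1) hw hs) h1.le
    have e := radiusInv_eq ha (ε := 1) (s := s) hw (by norm_num) (by positivity)
    rw [one_mul] at e
    rwa [e] at h
  · have h := mass_step_upper ha hT (radiusInv_pos ha (ε := -1) hw hs) h2.le
    have e := radiusInv_eq ha (ε := -1) (s := s) hw (by norm_num) (by
      have : s / a ≤ |z| ^ 2 := by rw [div_le_iff₀ ha]; linarith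
      linarith)
    rw [neg_one_mul, ← sub_eq_add_neg] at e
    rwa [e] at h

theorem MassLim.step [IsFiniteMeasure μ] (ha : 0 < a) (hT : MeasurePreserving (Ta a) μ μ)
    {z Q Q' : ℝ} (hz : z ≠ 0) (h : MassLim μ z Q) (h' : MassLim μ (-z) Q') :
    MassLim μ (Ta a z) ((Q + Q') * √(2 * a * |z|)⁻¹) := by
  have hw : 0 < |z| := abs_pos.2 hz
  have hκ : 0 < (2 * a * |z|)⁻¹ := by positivity
  have key : ∀ ε, Tendsto (fun s => (μ.real (Metric.ball z (radiusInv a |z| ε s)) +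
        μ.real (Metric.ball (-z) (radiusInv a |z| ε s))) / √s) (𝓝[>] 0)
        (𝓝 ((Q + Q') * √(2 * a * |z|)⁻¹)) := fun ε => by
    have := (tendsto_comp_div_sqrt hκ h (tendsto_radiusInv ha hw ε)).add
      (tendsto_comp_div_sqrt hκ h' (tendsto_radiusInv ha hw ε))
    rw [← add_mul] at this
    simpa [add_div] using this
  refine tendsto_of_tendsto_of_tendsto_of_le_of_le' (key 1) (key (-1)) ?_ ?_
  · filter_upwards [mass_step ha hT hz] with s hs
    gcongr; exact hs.1
  · filter_upwards [mass_step ha hT hz] with s hs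
    gcongr; exact hs.2

end Mass

section CycleMass

variable {a : ℝ} {μ : Measure ℝ}

theorem nonpos_of_le_scale {D : ℝ → ℝ} (hD : Tendsto D (𝓝[>] 0) (𝓝 0)) {ρ s₀ : ℝ} (hρ0 : 0 < ρ)
    (hρ1 : ρ < 1) (h : ∀ s, 0 < s → s < s₀ → D s ≤ D (ρ * s)) {s : ℝ} (hs : 0 < s)
    (hs0 : s < s₀) : D s ≤ 0 := by
  have hlim : Tendsto (fun n : ℕ => ρ ^ n * s) atTop (𝓝[>] 0) := by
    refine tendsto_nhdsWithin_iff.2 ⟨?_, Eventually.of_forall fun n => ?_⟩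
    · simpa using (tendsto_pow_atTop_nhds_zero_of_lt_one hρ0.le hρ1).mul_const s
    · exact mul_pos (pow_pos hρ0 n) hs
  refine ge_of_tendsto' (hD.comp hlim) fun n => ?_
  simp only [Function.comp]
  induction n with
  | zero => simp
  | succ n ih =>
    refine ih.trans ?_
    rw [pow_succ', mul_assoc]
    refine h _ (mul_pos (pow_pos hρ0 n) hs) (lt_of_le_of_lt ?_ hs0)
    exact mul_le_of_le_one_left hs.le (pow_le_one₀ hρ0.le hρ1.le)

/-- `m` is squeezed between rescalings of `m₀` plus multiples of `√s`. -/
def ScaleSandwich (m₀ m : ℝ → ℝ) (κ P : ℝ) : Prop :=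
  ∃ (τ₁ τ₂ g₁ g₂ : ℝ → ℝ) (C : ℝ), 0 ≤ C ∧
    (∀ᶠ s in 𝓝[>] 0, m₀ (τ₁ s) + g₁ s ≤ m s ∧ m s ≤ m₀ (τ₂ s) + g₂ s ∧
      κ * s - C * s ^ 2 ≤ τ₁ s) ∧
    Tendsto (fun s => τ₁ s / s) (𝓝[>] 0) (𝓝 κ) ∧ Tendsto (fun s => τ₂ s / s) (𝓝[>] 0) (𝓝 κ) ∧
    Tendsto (fun s => g₁ s / √s) (𝓝[>] 0) (𝓝 P) ∧ Tendsto (fun s => g₂ s / √s) (𝓝[>] 0) (𝓝 P)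

theorem ScaleSandwich.refl (m : ℝ → ℝ) : ScaleSandwich m m 1 0 := by
  have h1 : Tendsto (fun s : ℝ => s / s) (𝓝[>] 0) (𝓝 1) := by
    refine tendsto_const_nhds.congr' ?_
    filter_upwards [self_mem_nhdsWithin] with s hs
    have hs : 0 < s := hs
    field_simp
  exact ⟨id, id, 0, 0, 0, le_rfl, Eventually.of_forall fun s => by simp, h1, h1, by simp, by simp⟩

theorem ScaleSandwich.step [IsFiniteMeasure μ] (ha : 0 < a) (hT : MeasurePreserving (Ta a) μ μ)
    {m₀ : ℝ → ℝ} {z κ P Q : ℝ} (hz : z ≠ 0) (hκ : 0 < κ)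
    (h : ScaleSandwich m₀ (fun s => μ.real (Metric.ball z s)) κ P) (hQ : MassLim μ (-z) Q) :
    ScaleSandwich m₀ (fun s => μ.real (Metric.ball (Ta a z) s)) (κ * (2 * a * |z|)⁻¹)
      ((P + Q) * √(2 * a * |z|)⁻¹) := by
  obtain ⟨τ₁, τ₂, g₁, g₂, C, hC, hev, hτ₁, hτ₂, hg₁, hg₂⟩ := h
  have hw : 0 < |z| := abs_pos.2 hz
  set b := 2 * a * |z| with hb
  have hb0 : 0 < b := by positivity
  have hr := fun ε => tendsto_radiusInv ha hw ε
  have hr0 := fun ε => tendsto_nhdsGT_zero_of_div (inv_pos.2 hb0) (hr ε)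
  have hcomp : ∀ {τ : ℝ → ℝ} (ε : ℝ), Tendsto (fun s => τ s / s) (𝓝[>] 0) (𝓝 κ) →
      Tendsto (fun s => τ (radiusInv a |z| ε s) / s) (𝓝[>] 0) (𝓝 (κ * b⁻¹)) := by
    intro τ ε hτ
    refine ((hτ.comp (hr0 ε)).mul (hr ε)).congr' ?_
    filter_upwards [self_mem_nhdsWithin] with s hs
    have hs : 0 < s := hs
    have := radiusInv_pos ha (ε := ε) hw hs
    simp only [Function.comp]
    field_simp
  have hg : ∀ {g : ℝ → ℝ} (ε : ℝ), Tendsto (fun s => g s / √s) (𝓝[>] 0) (𝓝 P) →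
      Tendsto (fun s => (g (radiusInv a |z| ε s) +
        μ.real (Metric.ball (-z) (radiusInv a |z| ε s))) / √s) (𝓝[>] 0)
        (𝓝 ((P + Q) * √b⁻¹)) := by
    intro g ε hg
    have := (tendsto_comp_div_sqrt (inv_pos.2 hb0) hg (hr ε)).add
      (tendsto_comp_div_sqrt (inv_pos.2 hb0) hQ (hr ε))
    rw [← add_mul] at this
    simpa only [add_div] using this
  refine ⟨fun s => τ₁ (radiusInv a |z| 1 s), fun s => τ₂ (radiusInv a |z| (-1) s), _, _,
    κ * a / b ^ 3 + C / b ^ 2, by positivity, ?_, hcomp 1 hτ₁, hcomp (-1) hτ₂, hg 1 hg₁,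
    hg (-1) hg₂⟩
  filter_upwards [mass_step ha hT hz, (hr0 1).eventually hev, (hr0 (-1)).eventually hev,
    self_mem_nhdsWithin] with s h1 h2 h3 hs
  have hs : 0 < s := hs
  refine ⟨by linarith [h1.1, h2.1], by linarith [h1.2, h3.2.1], le_trans ?_ h2.2.2⟩
  have e := radiusInv_eq ha (ε := 1) (s := s) hw (by norm_num) (by positivity)
  have ht0 := radiusInv_pos ha (ε := 1) hw hs
  set t := radiusInv a |z| 1 s with ht
  have e' : t * b + a * t ^ 2 = s := by rw [hb]; linarith
  have hta : t ≤ s / b := by rw [le_div_iff₀ hb0]; nlinarith [sq_nonneg t]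
  have ht2 : t ^ 2 ≤ s ^ 2 / b ^ 2 := by rw [← div_pow]; gcongr
  have htb : s / b - a * s ^ 2 / b ^ 3 ≤ t := by
    have : s / b = t + a * t ^ 2 / b := by rw [← e']; field_simp
    have h4 : a * t ^ 2 / b ≤ a * (s ^ 2 / b ^ 2) / b := by gcongr
    have h5 : a * (s ^ 2 / b ^ 2) / b = a * s ^ 2 / b ^ 3 := by field_simp
    linarith
  calc κ * b⁻¹ * s - (κ * a / b ^ 3 + C / b ^ 2) * s ^ 2
      = κ * (s / b - a * s ^ 2 / b ^ 3) - C * (s ^ 2 / b ^ 2) := by field_simp; ring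
    _ ≤ κ * t - C * t ^ 2 := by
        have := mul_le_mul_of_nonneg_left htb hκ.le
        have := mul_le_mul_of_nonneg_left ht2 hC
        linarith

theorem ScaleSandwich.scale_lt_one {m : ℝ → ℝ} (hm : Monotone m) (hm0 : ∀ s, 0 ≤ m s) {κ P : ℝ}
    (hP : 0 < P) (h : ScaleSandwich m m κ P) : κ < 1 := by
  by_contra! hκ
  obtain ⟨τ₁, τ₂, g₁, g₂, C, hC, hev, -, -, hg₁, -⟩ := h
  have hsmall : ∀ᶠ s : ℝ in 𝓝[>] 0, s < 1 := nhdsWithin_le_nhds (Iio_mem_nhds one_pos)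
  have hgood : ∀ᶠ s in 𝓝[>] 0, m (s - C * s ^ 2) + P / 2 * s ≤ m s := by
    filter_upwards [hev, (tendsto_order.1 hg₁).1 (P / 2) (by linarith), hsmall,
      self_mem_nhdsWithin] with s h1 h2 h3 hs
    have hs : 0 < s := hs
    have hsq : 0 < √s := Real.sqrt_pos.2 hs
    rw [lt_div_iff₀ hsq] at h2
    have hle : s ≤ √s := Real.le_sqrt_of_sq_le (by nlinarith)
    have : m (s - C * s ^ 2) ≤ m (τ₁ s) := hm (le_trans (by nlinarith) h1.2.2)
    nlinarith [h1.1]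
  set D := 2 * C + 1 with hD
  have hD0 : 0 < D := by positivity
  have hlim : Tendsto (fun k : ℕ => 1 / (D * ((k : ℝ) + 1))) atTop (𝓝[>] 0) := by
    refine tendsto_nhdsWithin_iff.2 ⟨?_, Eventually.of_forall fun n => ?_⟩
    · have := (tendsto_one_div_add_atTop_nhds_zero_nat (𝕜 := ℝ)).const_mul D⁻¹
      rw [mul_zero] at this
      refine this.congr fun k => ?_
      field_simp
    · exact mem_Ioi.2 (by positivity)
  obtain ⟨K, hK⟩ := eventually_atTop.1 (hlim.eventually hgood)
  have hstep : ∀ k ≥ K, m (1 / (D * ((k + 1 : ℕ) + 1))) + P / 2 * (1 / (D * ((k : ℝ) + 1))) ≤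
      m (1 / (D * ((k : ℝ) + 1))) := by
    intro k hk
    refine le_trans ?_ (hK k hk)
    gcongr
    refine hm ?_
    have hk0 : (0 : ℝ) ≤ k := k.cast_nonneg
    push_cast
    have e : 1 / (D * ((k : ℝ) + 1)) - C * (1 / (D * ((k : ℝ) + 1))) ^ 2 -
        1 / (D * ((k : ℝ) + 1 + 1)) =
        (D * (k + 1) - C * (k + 2)) / (D ^ 2 * (k + 1) ^ 2 * (k + 2)) := by
      field_simp
      ring
    have : 0 ≤ (D * (k + 1) - C * (k + 2)) / (D ^ 2 * (k + 1) ^ 2 * (k + 2)) := by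
      refine div_nonneg ?_ (by positivity)
      rw [hD]; nlinarith [mul_nonneg hC hk0]
    linarith
  have hsum : ∀ n, (∑ k ∈ Finset.range n, P / (2 * D) * (1 / (((k + K : ℕ) : ℝ) + 1))) ≤
      m (1 / (D * ((K : ℝ) + 1))) - m (1 / (D * (((n + K : ℕ) : ℝ) + 1))) := by
    intro n
    induction n with
    | zero => simp
    | succ n ih =>
      rw [Finset.sum_range_succ]
      have h1 := hstep (n + K) (by omega)
      have h2 : P / (2 * D) * (1 / (((n + K : ℕ) : ℝ) + 1)) =
        P / 2 * (1 / (D * (((n + K : ℕ) : ℝ) + 1))) := by field_simp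
      rw [show n + 1 + K = n + K + 1 by ring, h2]
      linarith
  have hdiv : ¬ Summable fun k : ℕ => P / (2 * D) * (1 / (((k + K : ℕ) : ℝ) + 1)) := by
    rw [summable_mul_left_iff (by positivity)]
    have h1 : ¬ Summable fun k : ℕ => 1 / (k : ℝ) := Real.not_summable_one_div_natCast
    rw [← summable_nat_add_iff (K + 1)] at h1
    refine fun h2 => h1 (h2.congr fun k => ?_)
    push_cast; ring_nf
  refine hdiv (summable_of_sum_range_le (c := m (1 / (D * ((K : ℝ) + 1)))) (fun k => ?_)
    fun n => ?_)
  · positivity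
  · linarith [hsum n, hm0 (1 / (D * (((n + K : ℕ) : ℝ) + 1)))]

theorem ScaleSandwich.tendsto {m : ℝ → ℝ} (hm : Monotone m) (hm0 : Tendsto m (𝓝[>] 0) (𝓝 0))
    {κ P : ℝ} (hκ0 : 0 < κ) (hκ1 : κ < 1) (h : ScaleSandwich m m κ P) :
    Tendsto (fun s => m s / √s) (𝓝[>] 0) (𝓝 (P / (1 - √κ))) := by
  obtain ⟨τ₁, τ₂, g₁, g₂, C, -, hev, hτ₁, hτ₂, hg₁, hg₂⟩ := h
  have hsq1 : √κ < 1 := by rw [Real.sqrt_lt' one_pos]; simpa using hκ1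
  have hA : ContinuousAt (fun e : ℝ => (P + e) / (1 - √(κ + e))) 0 := by
    refine ContinuousAt.div (by fun_prop) (by fun_prop) ?_
    simp only [add_zero]; linarith
  have hA' : Tendsto (fun e : ℝ => (P + e) / (1 - √(κ + e))) (𝓝 0) (𝓝 (P / (1 - √κ))) := by
    have := hA.tendsto
    simpa only [add_zero] using this
  have hDlim : ∀ A : ℝ, Tendsto (fun s => m s - A * √s) (𝓝[>] 0) (𝓝 0) := fun A => by
    have := hm0.sub ((tendsto_sqrt_nhdsGT_zero.mono_right nhdsWithin_le_nhds).const_mul A)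
    simpa using this
  have hscale : ∀ {ρ s p : ℝ}, 0 < ρ → ρ < 1 →
      p / (1 - √ρ) * √s - p / (1 - √ρ) * √(ρ * s) = p * √s := by
    intro ρ s p hρ0 hρ1
    have : √ρ < 1 := by rw [Real.sqrt_lt' one_pos]; simpa using hρ1
    have h0 : 1 - √ρ ≠ 0 := by linarith
    rw [Real.sqrt_mul hρ0.le]
    field_simp
  have hrange : ∀ᶠ e : ℝ in 𝓝 0, 0 < κ + e ∧ κ + e < 1 := by
    have h1 : Tendsto (fun e : ℝ => κ + e) (𝓝 0) (𝓝 κ) := by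
      have : ContinuousAt (fun e : ℝ => κ + e) 0 := by fun_prop
      simpa only [ContinuousAt, add_zero] using this
    exact ((tendsto_order.1 h1).1 0 hκ0).and ((tendsto_order.1 h1).2 1 hκ1)
  refine tendsto_order.2 ⟨fun c hc => ?_, fun c hc => ?_⟩
  · obtain ⟨e, ⟨⟨hρ0, hρ1⟩, hec⟩, he⟩ :=
      (((hrange.and ((tendsto_order.1 hA').1 c hc)).filter_mono
        (nhdsWithin_le_nhds (s := Iio 0))).and self_mem_nhdsWithin).exists
    have he : e < 0 := he
    have hgood : ∀ᶠ s in 𝓝[>] 0, m ((κ + e) * s) + (P + e) * √s ≤ m s := by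
      filter_upwards [hev, (tendsto_order.1 hg₁).1 (P + e) (by linarith),
        (tendsto_order.1 hτ₁).1 (κ + e) (by linarith), self_mem_nhdsWithin] with s h1 h2 h3 hs
      have hs : 0 < s := hs
      rw [lt_div_iff₀ (Real.sqrt_pos.2 hs)] at h2
      rw [lt_div_iff₀ hs] at h3
      linarith [hm h3.le, h1.1]
    obtain ⟨s₀, hs₀, hs⟩ := mem_nhdsGT_iff_exists_Ioo_subset.1 hgood
    have hs₀ : 0 < s₀ := hs₀
    filter_upwards [Ioo_mem_nhdsGT hs₀] with s hss
    refine hec.trans_le ?_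
    rw [le_div_iff₀ (Real.sqrt_pos.2 hss.1)]
    have hD := hDlim ((P + e) / (1 - √(κ + e)))
    have hD := hD.neg
    rw [neg_zero] at hD
    have := nonpos_of_le_scale hD hρ0 hρ1 (s₀ := s₀) (fun s h1 h2 => by
      have h3 : m ((κ + e) * s) + (P + e) * √s ≤ m s := hs ⟨h1, h2⟩
      have h4 := hscale (s := s) (p := P + e) hρ0 hρ1
      linarith) hss.1 hss.2
    linarith
  · obtain ⟨e, ⟨⟨hρ0, hρ1⟩, hec⟩, he⟩ :=
      (((hrange.and ((tendsto_order.1 hA').2 c hc)).filter_mono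
        (nhdsWithin_le_nhds (s := Ioi 0))).and self_mem_nhdsWithin).exists
    have he : 0 < e := he
    have hgood : ∀ᶠ s in 𝓝[>] 0, m s ≤ m ((κ + e) * s) + (P + e) * √s := by
      filter_upwards [hev, (tendsto_order.1 hg₂).2 (P + e) (by linarith),
        (tendsto_order.1 hτ₂).2 (κ + e) (by linarith), self_mem_nhdsWithin] with s h1 h2 h3 hs
      have hs : 0 < s := hs
      rw [div_lt_iff₀ (Real.sqrt_pos.2 hs)] at h2
      rw [div_lt_iff₀ hs] at h3
      linarith [hm h3.le, h1.2.1]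
    obtain ⟨s₀, hs₀, hs⟩ := mem_nhdsGT_iff_exists_Ioo_subset.1 hgood
    have hs₀ : 0 < s₀ := hs₀
    filter_upwards [Ioo_mem_nhdsGT hs₀] with s hss
    refine lt_of_le_of_lt ?_ hec
    rw [div_le_iff₀ (Real.sqrt_pos.2 hss.1)]
    have := nonpos_of_le_scale (hDlim ((P + e) / (1 - √(κ + e)))) hρ0 hρ1 (s₀ := s₀)
      (fun s h1 h2 => by
        have h3 : m s ≤ m ((κ + e) * s) + (P + e) * √s := hs ⟨h1, h2⟩
        have h4 := hscale (s := s) (p := P + e) hρ0 hρ1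
        linarith) hss.1 hss.2
    linarith

end CycleMass

section CriticalOrbit

variable {a : ℝ}

theorem eq_or_eq_neg_of_Ta_eq (ha : 0 < a) {x y : ℝ} (h : Ta a x = Ta a y) : x = y ∨ x = -y := by
  rw [← sq_eq_sq_iff_eq_or_eq_neg]
  have : a * x ^ 2 = a * y ^ 2 := by simp only [Ta] at h; linarith
  exact mul_left_cancel₀ ha.ne' this

theorem finite_postCrit_of_preperiodic {k p : ℕ} (hp : 1 ≤ p)
    (h : (Ta a)^[k + p] 0 = (Ta a)^[k] 0) : (postCrit a).Finite := by
  have hper : Function.IsPeriodicPt (Ta a) p ((Ta a)^[k] 0) := by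
    rw [Function.IsPeriodicPt, Function.IsFixedPt, ← Function.iterate_add_apply, add_comm, h]
  refine ((Finset.range (k + p)).finite_toSet.image fun m => (Ta a)^[m] 0).subset ?_
  rintro _ ⟨m, rfl⟩
  by_cases hm : m + 1 < k
  · exact ⟨m + 1, by simpa using by omega, rfl⟩
  · refine ⟨(m + 1 - k) % p + k, ?_, ?_⟩
    · have := Nat.mod_lt (m + 1 - k) hp
      simpa using by omega
    · simp only
      rw [Function.iterate_add_apply, hper.iterate_mod_apply, ← Function.iterate_add_apply]
      congr 1
      omega

/-- The first time at which the critical orbit is periodic. -/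
theorem exists_first_periodic {k p : ℕ} (hp : 1 ≤ p) (h : (Ta a)^[k + p] 0 = (Ta a)^[k] 0) :
    ∃ k₀, (Ta a)^[k₀] 0 ∈ Function.periodicPts (Ta a) ∧
      ∀ i < k₀, (Ta a)^[i] 0 ∉ Function.periodicPts (Ta a) := by
  classical
  have hex : ∃ k, (Ta a)^[k] 0 ∈ Function.periodicPts (Ta a) := by
    refine ⟨k, p, hp, ?_⟩
    rw [Function.IsPeriodicPt, Function.IsFixedPt, ← Function.iterate_add_apply, add_comm, h]
  exact ⟨Nat.find hex, Nat.find_spec hex, fun i hi => Nat.find_min hex hi⟩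

theorem mem_periodicPts_iterate {x : ℝ} (hx : x ∈ Function.periodicPts (Ta a)) (n : ℕ) :
    (Ta a)^[n] x ∈ Function.periodicPts (Ta a) := by
  obtain ⟨q, hq, h⟩ := hx
  exact ⟨q, hq, h.apply_iterate n⟩

theorem two_le_first_periodic (ha : 0 < a) (h0 : ∀ m, 1 ≤ m → (Ta a)^[m] 0 ≠ 0) {k₀ : ℕ}
    (hk : (Ta a)^[k₀] 0 ∈ Function.periodicPts (Ta a)) : 2 ≤ k₀ := by
  by_contra! hlt
  obtain ⟨q, hq, h⟩ := hk
  interval_cases k₀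
  · exact h0 q hq h
  · obtain ⟨n, rfl⟩ : ∃ n, q = n + 1 := ⟨q - 1, by omega⟩
    have e : Ta a ((Ta a)^[n] ((Ta a)^[1] 0)) = Ta a 0 := by
      rw [← Function.iterate_succ_apply' (Ta a)]; exact h
    have := eq_or_eq_neg_of_Ta_eq ha e
    rw [neg_zero, or_self, ← Function.iterate_add_apply] at this
    exact h0 (n + 1) (by omega) this

variable {k₀ : ℕ}

theorem eq_of_iterate_eq_neg (h0 : ∀ m, 1 ≤ m → (Ta a)^[m] 0 ≠ 0)
    (hmin : ∀ i < k₀, (Ta a)^[i] 0 ∉ Function.periodicPts (Ta a))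
    (hk : (Ta a)^[k₀] 0 ∈ Function.periodicPts (Ta a)) {i j : ℕ} (hi : 1 ≤ i)
    (hij : i < j) (h : (Ta a)^[i] 0 = -(Ta a)^[j] 0) : i = k₀ - 1 := by
  have hT : Ta a ((Ta a)^[i] 0) = Ta a ((Ta a)^[j] 0) := by rw [h]; simp [Ta]
  have hper : (Ta a)^[i + 1] 0 ∈ Function.periodicPts (Ta a) := by
    refine ⟨j - i, by omega, ?_⟩
    rw [Function.IsPeriodicPt, Function.IsFixedPt, ← Function.iterate_add_apply,
      show j - i + (i + 1) = j + 1 by omega, Function.iterate_succ_apply',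
      Function.iterate_succ_apply', hT]
  have h1 : k₀ ≤ i + 1 := by
    by_contra! hlt
    exact hmin _ hlt hper
  have h2 : i < k₀ := by
    by_contra! hle
    have hp : ∀ l, k₀ ≤ l → (Ta a)^[l] 0 ∈ Function.periodicPts (Ta a) := fun l hl => by
      have := mem_periodicPts_iterate hk (l - k₀)
      rwa [← Function.iterate_add_apply, Nat.sub_add_cancel hl] at this
    obtain ⟨q, hq, hpi⟩ := hp i hle
    obtain ⟨q', hq', hpj⟩ := hp j (by omega)
    have := hpi.eq_of_apply_eq hpj hq hq' hT
    exact h0 i hi (by linarith)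
  omega

theorem neg_iterate_notMem_postCrit (h0 : ∀ m, 1 ≤ m → (Ta a)^[m] 0 ≠ 0)
    (hmin : ∀ i < k₀, (Ta a)^[i] 0 ∉ Function.periodicPts (Ta a))
    (hk : (Ta a)^[k₀] 0 ∈ Function.periodicPts (Ta a)) {l : ℕ} (hl : 1 ≤ l)
    (hlk : l + 1 < k₀) : -(Ta a)^[l] 0 ∉ postCrit a := by
  rintro ⟨m, hm⟩
  simp only at hm
  rcases lt_trichotomy l (m + 1) with h | h | h
  · have := eq_of_iterate_eq_neg h0 hmin hk hl h (by linarith)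
    omega
  · subst h
    exact h0 _ hl (by linarith)
  · have := eq_of_iterate_eq_neg h0 hmin hk (by omega) h hm
    omega

theorem neg_notMem_postCrit_or_eq (h0 : ∀ m, 1 ≤ m → (Ta a)^[m] 0 ≠ 0)
    (hmin : ∀ i < k₀, (Ta a)^[i] 0 ∉ Function.periodicPts (Ta a))
    (hk : (Ta a)^[k₀] 0 ∈ Function.periodicPts (Ta a)) {z : ℝ} (hz : z ∈ postCrit a)
    (hzp : z ∈ Function.periodicPts (Ta a)) :
    -z ∉ postCrit a ∨ -z = (Ta a)^[k₀ - 1] 0 := by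
  by_contra! hcon
  obtain ⟨⟨m, hm⟩, hne⟩ := hcon
  obtain ⟨i, rfl⟩ := hz
  simp only at hm hne hzp
  rcases lt_trichotomy (i + 1) (m + 1) with h | h | h
  · have := eq_of_iterate_eq_neg h0 hmin hk (by omega) h (by linarith)
    exact hmin (i + 1) (by have : k₀ ≠ 0 := (by rintro rfl; omega); omega) hzp
  · rw [h] at hm
    exact h0 (m + 1) (by omega) (by linarith)
  · have := eq_of_iterate_eq_neg h0 hmin hk (by omega) h hm
    exact hne (by rw [← this, hm])

theorem exists_neg_iterate_eq (ha : 0 < a) (hk1 : 1 ≤ k₀)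
    (hmin : ∀ i < k₀, (Ta a)^[i] 0 ∉ Function.periodicPts (Ta a))
    (hk : (Ta a)^[k₀] 0 ∈ Function.periodicPts (Ta a)) {ζ : ℝ} {p m : ℕ} (hp : 1 ≤ p)
    (hper : (Ta a)^[p] ζ = ζ) (hm : (Ta a)^[m] 0 = ζ) :
    ∃ j < p, -(Ta a)^[j] ζ = (Ta a)^[k₀ - 1] 0 := by
  have hζ : Function.IsPeriodicPt (Ta a) p ζ := hper
  have hmk : k₀ ≤ m := by
    by_contra! hlt
    exact hmin m hlt (hm ▸ ⟨p, hp, hper⟩)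
  obtain ⟨q, hq, hqp⟩ := hk
  have hy : Ta a ((Ta a)^[q * (m + 1) - 1] ((Ta a)^[k₀] 0)) = Ta a ((Ta a)^[k₀ - 1] 0) := by
    rw [← Function.iterate_succ_apply' (Ta a), ← Function.iterate_succ_apply' (Ta a),
      show (q * (m + 1) - 1).succ = q * (m + 1) by
        have : 1 ≤ q * (m + 1) := Nat.mul_pos hq (by omega)
        omega,
      show (k₀ - 1).succ = k₀ by omega]
    exact hqp.mul_const _
  have hqm : m + 1 ≤ q * (m + 1) := Nat.le_mul_of_pos_left _ hq
  have he : (Ta a)^[q * (m + 1) - 1] ((Ta a)^[k₀] 0) =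
      (Ta a)^[q * (m + 1) - 1 + k₀ - m] ζ := by
    rw [← hm, ← Function.iterate_add_apply, ← Function.iterate_add_apply]
    congr 1
    omega
  refine ⟨(q * (m + 1) - 1 + k₀ - m) % p, Nat.mod_lt _ hp, ?_⟩
  rw [hζ.iterate_mod_apply, ← he]
  rcases eq_or_eq_neg_of_Ta_eq ha hy with h | h
  · refine absurd ?_ (hmin (k₀ - 1) (by omega))
    rw [← h]
    exact mem_periodicPts_iterate ⟨q, hq, hqp⟩ _
  · rw [h, neg_neg]

/-- The mass of small balls around a periodic point of the critical orbit. -/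
theorem exists_massLim_periodic (ha : 0 < a) {H : ℝ → ℝ≥0∞} (hHm : Measurable H)
    [IsProbabilityMeasure (volume.withDensity H)]
    (hT : MeasurePreserving (Ta a) (volume.withDensity H) (volume.withDensity H))
    (hH : Harnack H (postCrit a)ᶜ) (h0 : ∀ m, 1 ≤ m → (Ta a)^[m] 0 ≠ 0) {k p' : ℕ}
    (hp' : 1 ≤ p') (hMis : (Ta a)^[k + p'] 0 = (Ta a)^[k] 0) {ζ : ℝ} {p m : ℕ} (hp : 1 ≤ p)
    (hper : (Ta a)^[p] ζ = ζ) (hm : (Ta a)^[m] 0 = ζ) :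
    1 < ∏ i ∈ Finset.range p, 2 * a * |(Ta a)^[i] ζ| ∧
      ∃ Q > 0, MassLim (volume.withDensity H) ζ Q := by
  set μ := volume.withDensity H with hμ
  have hfin := finite_postCrit_of_preperiodic hp' hMis
  obtain ⟨k₀, hk, hmin⟩ := exists_first_periodic hp' hMis
  have hk2 := two_le_first_periodic ha h0 hk
  have h0V : (0 : ℝ) ∉ postCrit a := by
    rintro ⟨i, hi⟩
    exact h0 (i + 1) (by omega) hi
  have hzero : ∀ z ∉ postCrit a, MassLim μ z 0 := fun z hz =>
    MassLim.of_div (tendsto_ball_div_of_notMem hH hfin hz)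
  have hnz : ∀ z ∈ postCrit a, z ≠ 0 := fun z hz h => h0V (h ▸ hz)
  have hpos : ∀ l, l + 1 < k₀ → ∃ Q > 0, MassLim μ ((Ta a)^[l + 1] 0) Q := by
    intro l
    induction l with
    | zero =>
      intro _
      have := density_pos_at_zero ha hHm hT hH hfin h0V
      exact ⟨2 * (H 0).toReal / √a, by positivity, by
        simpa [Ta] using massLim_one ha hT (tendsto_ball_div_of_notMem hH hfin h0V)⟩
    | succ l ih =>
      intro hl
      obtain ⟨Q, hQ, hlim⟩ := ih (by omega)
      have hz : (Ta a)^[l + 1] 0 ≠ 0 := h0 _ (by omega)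
      have hz' := abs_pos.2 hz
      refine ⟨(Q + 0) * √(2 * a * |(Ta a)^[l + 1] 0|)⁻¹, by positivity, ?_⟩
      rw [Function.iterate_succ_apply' _ (l + 1)]
      exact hlim.step ha hT hz (hzero _ (neg_iterate_notMem_postCrit h0 hmin hk (by omega) hl))
  obtain ⟨Q₀, hQ₀, hlim₀⟩ := hpos (k₀ - 2) (by omega)
  rw [show k₀ - 2 + 1 = k₀ - 1 by omega] at hlim₀
  have hζV : ζ ∈ postCrit a := by
    rcases Nat.eq_zero_or_pos m with rfl | hm0
    · refine absurd ?_ (h0 p hp)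
      simp only [Function.iterate_zero, id] at hm
      rw [hm]; exact hper
    · exact ⟨m - 1, by simp only; rw [Nat.sub_add_cancel hm0, hm]⟩
  have hζi : ∀ i, (Ta a)^[i] ζ ∈ postCrit a := iterate_mem_postCrit hζV
  have hζp : ∀ i, (Ta a)^[i] ζ ∈ Function.periodicPts (Ta a) :=
    mem_periodicPts_iterate ⟨p, hp, hper⟩
  have hQ : ∀ i, ∃ Q, 0 ≤ Q ∧ MassLim μ (-(Ta a)^[i] ζ) Q ∧
      (-(Ta a)^[i] ζ = (Ta a)^[k₀ - 1] 0 → 0 < Q) := by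
    intro i
    by_cases he : -(Ta a)^[i] ζ = (Ta a)^[k₀ - 1] 0
    · exact ⟨Q₀, hQ₀.le, he ▸ hlim₀, fun _ => hQ₀⟩
    · exact ⟨0, le_rfl, hzero _ ((neg_notMem_postCrit_or_eq h0 hmin hk (hζi i)
        (hζp i)).resolve_right he), fun h => absurd h he⟩
  have hsand : ∀ j, ∃ P, 0 ≤ P ∧ ScaleSandwich (fun s => μ.real (Metric.ball ζ s))
      (fun s => μ.real (Metric.ball ((Ta a)^[j] ζ) s))
      (∏ i ∈ Finset.range j, (2 * a * |(Ta a)^[i] ζ|)⁻¹) P ∧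
      ((∃ i < j, -(Ta a)^[i] ζ = (Ta a)^[k₀ - 1] 0) → 0 < P) := by
    intro j
    induction j with
    | zero => exact ⟨0, le_rfl, by simpa using ScaleSandwich.refl _, by simp⟩
    | succ j ih =>
      obtain ⟨P, hP, hS, hPi⟩ := ih
      obtain ⟨Q, hQ0, hQl, hQi⟩ := hQ j
      have hz := hnz _ (hζi j)
      have hz' := abs_pos.2 hz
      refine ⟨(P + Q) * √(2 * a * |(Ta a)^[j] ζ|)⁻¹, by positivity, ?_, ?_⟩
      · rw [Function.iterate_succ_apply', Finset.prod_range_succ]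
        refine hS.step ha hT hz ?_ hQl
        exact Finset.prod_pos fun i _ => by
          have := abs_pos.2 (hnz _ (hζi i))
          positivity
      · rintro ⟨i, hi, he⟩
        have : 0 < P + Q := by
          rcases Nat.lt_succ_iff_lt_or_eq.1 hi with h | rfl
          · linarith [hPi ⟨i, h, he⟩]
          · linarith [hQi he]
        positivity
  obtain ⟨P, -, hS, hP⟩ := hsand p
  have hP := hP (exists_neg_iterate_eq ha (by omega) hmin hk hp hper hm)
  rw [hper, Finset.prod_inv_distrib] at hS
  set L := ∏ i ∈ Finset.range p, 2 * a * |(Ta a)^[i] ζ| with hL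
  have hL0 : 0 < L := Finset.prod_pos fun i _ => by
    have := abs_pos.2 (hnz _ (hζi i))
    positivity
  have hmono : Monotone fun s => μ.real (Metric.ball ζ s) := fun s t hst =>
    measureReal_mono (Metric.ball_subset_ball hst)
  have hL1 : L⁻¹ < 1 := hS.scale_lt_one hmono (fun s => measureReal_nonneg) hP
  have hlim : Tendsto (fun s => μ.real (Metric.ball ζ s)) (𝓝[>] 0) (𝓝 0) := by
    have hvol : Tendsto (fun s => volume (Metric.ball ζ s)) (𝓝[>] 0) (𝓝 0) := by
      have h : Tendsto (fun s : ℝ => ENNReal.ofReal (2 * s)) (𝓝[>] 0) (𝓝 0) := by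
        have : Continuous fun s : ℝ => ENNReal.ofReal (2 * s) :=
          ENNReal.continuous_ofReal.comp (by fun_prop)
        simpa using (this.tendsto 0).mono_left nhdsWithin_le_nhds
      simpa [Real.volume_ball] using h
    have h := tendsto_setLIntegral_zero (μ := volume) (f := H) (s := fun s => Metric.ball ζ s)
      (l := 𝓝[>] 0) (by
        rw [← setLIntegral_univ, ← withDensity_apply _ MeasurableSet.univ]
        exact measure_ne_top _ _) hvol
    have h' := (ENNReal.tendsto_toReal ENNReal.zero_ne_top).comp h
    refine h'.congr fun s => ?_
    simp [Measure.real, hμ, withDensity_apply _ Metric.isOpen_ball.measurableSet]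
  refine ⟨by rwa [inv_lt_one₀ hL0] at hL1, _, ?_, hS.tendsto hmono hlim (by positivity) hL1⟩
  refine div_pos hP ?_
  have : √L⁻¹ < 1 := by rw [Real.sqrt_lt' one_pos]; simpa using hL1
  linarith

end CriticalOrbit

section Push

variable {a : ℝ}

/-- The density of the image under `(Ta a)^[N]` of a measure living on an interval which avoids
the critical point up to time `N`. -/
theorem exists_harnack_push (ha : 0 < a) (N : ℕ) : ∀ {K : Set ℝ} {h : ℝ → ℝ≥0∞},
    IsPreconnected K → (∀ m < N, ∀ x ∈ K, (Ta a)^[m] x ≠ 0) → Measurable h → Harnack h K →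
    ∃ w, Measurable w ∧ Harnack w ((Ta a)^[N] '' K) ∧ ∀ A, MeasurableSet A →
      ∫⁻ y in A, w y = ∫⁻ x in K ∩ (Ta a)^[N] ⁻¹' A, h x := by
  induction N with
  | zero =>
    intro K h hK _ hh hH
    have hKm : MeasurableSet K := hK.ordConnected.measurableSet
    refine ⟨K.indicator h, hh.indicator hKm, ?_, fun A hA => ?_⟩
    · intro x y z hxy hz
      simp only [Function.iterate_zero, image_id] at hxy
      rw [indicator_of_mem (hxy hz), indicator_of_mem (hxy left_mem_uIcc)]
      exact hH x y z hxy hz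
    · rw [setLIntegral_indicator hKm]
      simp
  | succ N ih =>
    intro K h hK h0 hh hH
    have hKm : MeasurableSet K := hK.ordConnected.measurableSet
    have h00 : ∀ x ∈ K, x ≠ 0 := fun x hx => by simpa using h0 0 (by omega) x hx
    obtain ⟨σ, hσ, hpos⟩ : ∃ σ : ℝ, σ ^ 2 = 1 ∧ ∀ x ∈ K, 0 < σ * x := by
      by_cases hex : ∃ x ∈ K, 0 < x
      · obtain ⟨x, hx, hx0⟩ := hex
        refine ⟨1, by norm_num, fun y hy => ?_⟩
        by_contra! hy0
        exact h00 0 (hK.ordConnected.out hy hx ⟨by linarith, hx0.le⟩) rfl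
      · push Not at hex
        exact ⟨-1, by norm_num, fun y hy => by
          have := lt_of_le_of_ne (hex y hy) (h00 y hy)
          linarith⟩
    have hKi : IsPreconnected (Ta a '' K) := hK.image _ (continuous_Ta a).continuousOn
    have hmem : ∀ v, 0 < σ * v → Ta a v ∈ Ta a '' K → v ∈ K := by
      rintro v hv ⟨x, hx, hxv⟩
      have hsq : x ^ 2 = v ^ 2 := by
        have : a * x ^ 2 = a * v ^ 2 := by simp only [Ta] at hxv; linarith
        exact mul_left_cancel₀ ha.ne' this
      rcases sq_eq_sq_iff_eq_or_eq_neg.1 hsq with rfl | rfl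
      · exact hx
      · have := hpos _ hx
        linarith
    have hHK : Harnack (K.indicator h) K := by
      intro x y z hxy hz
      rw [indicator_of_mem (hxy hz), indicator_of_mem (hxy left_mem_uIcc)]
      exact hH x y z hxy hz
    have h1 : (1 : ℝ) ∉ Ta a '' K := by
      rintro ⟨x, hx, hx1⟩
      have : a * x ^ 2 = 0 := by simp only [Ta] at hx1; linarith
      have hx0 : x ^ 2 = 0 := (mul_eq_zero.1 this).resolve_left ha.ne'
      exact h00 x hx (by simpa using hx0)
    obtain ⟨w, hw, hwH, hwA⟩ := ih (h := branchOp a σ (K.indicator h)) hKi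
      (by
        rintro m hm _ ⟨x, hx, rfl⟩
        rw [← Function.iterate_succ_apply]
        exact h0 (m + 1) (by omega) x hx)
      (measurable_branchOp σ (hh.indicator hKm)) (hHK.branchOp ha hσ hmem h1)
    refine ⟨w, hw, ?_, fun A hA => ?_⟩
    · rwa [Function.iterate_succ, image_comp]
    · have hNm : Measurable ((Ta a)^[N]) := (measurable_Ta a).iterate N
      rw [hwA A hA, lintegral_branchOp ha hσ _
        (hKi.ordConnected.measurableSet.inter (hNm hA)), setLIntegral_indicator hKm]
      congr 2
      ext x
      simp only [mem_inter_iff, mem_preimage, mem_image, Function.iterate_succ_apply,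
        mem_ofPred_eq]
      constructor
      · rintro ⟨hx, ⟨-, hA⟩, -⟩
        exact ⟨hx, hA⟩
      · rintro ⟨hx, hA⟩
        exact ⟨hx, ⟨⟨x, hx, rfl⟩, hA⟩, hpos x hx⟩

end Push

section Side

variable {σ ζ : ℝ}

theorem side_mul_self (hσ : σ ^ 2 = 1) (v : ℝ) : σ * ((ζ + σ * v) - ζ) = v := by
  linear_combination v * hσ

theorem side_eq (hσ : σ ^ 2 = 1) (y : ℝ) : ζ + σ * (σ * (y - ζ)) = y := by
  linear_combination (y - ζ) * hσ

theorem mem_uIcc_side (hσ : σ ^ 2 = 1) {x y z : ℝ} :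
    z ∈ uIcc x y ↔ σ * (z - ζ) ∈ uIcc (σ * (x - ζ)) (σ * (y - ζ)) := by
  rcases eq_one_or_eq_neg_one_of_sq hσ with rfl | rfl <;> simp only [mem_uIcc] <;> constructor <;>
    rintro (h | h)
  · left; constructor <;> linarith [h.1, h.2]
  · right; constructor <;> linarith [h.1, h.2]
  · left; constructor <;> linarith [h.1, h.2]
  · right; constructor <;> linarith [h.1, h.2]
  · right; constructor <;> linarith [h.1, h.2]
  · left; constructor <;> linarith [h.1, h.2]
  · right; constructor <;> linarith [h.1, h.2]
  · left; constructor <;> linarith [h.1, h.2]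

theorem measurable_side (σ ζ : ℝ) : Measurable fun y : ℝ => σ * (y - ζ) := by fun_prop

theorem volume_side (hσ : σ ^ 2 = 1) (s t : ℝ) :
    volume ((fun y => σ * (y - ζ)) ⁻¹' Ico s t) = ENNReal.ofReal (t - s) := by
  rcases eq_one_or_eq_neg_one_of_sq hσ with rfl | rfl
  · have : (fun y => 1 * (y - ζ)) ⁻¹' Ico s t = Ico (ζ + s) (ζ + t) := by
      ext y
      simp only [mem_preimage, mem_Ico]
      constructor <;> intro h <;> constructor <;> linarith [h.1, h.2]
    rw [this, Real.volume_Ico]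
    congr 1; ring
  · have : (fun y => -1 * (y - ζ)) ⁻¹' Ico s t = Ioc (ζ - t) (ζ - s) := by
      ext y
      simp only [mem_preimage, mem_Ico, mem_Ioc]
      constructor <;> intro h <;> constructor <;> linarith [h.1, h.2]
    rw [this, Real.volume_Ioc]
    congr 1; ring

theorem Harnack.side {H : ℝ → ℝ≥0∞} {S : Set ℝ} (hH : Harnack H S) (hσ : σ ^ 2 = 1) {x e z : ℝ}
    (hS : ∀ v ∈ uIcc x e, ζ + σ * v ∈ S) (hz : z ∈ uIcc x e) :
    H (ζ + σ * z) * ENNReal.ofReal ((e - z) ^ 2) ≤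
      H (ζ + σ * x) * ENNReal.ofReal ((e - x) ^ 2) := by
  have h := hH (ζ + σ * x) (ζ + σ * e) (ζ + σ * z) (fun y hy => by
    rw [mem_uIcc_side (ζ := ζ) hσ, side_mul_self hσ, side_mul_self hσ] at hy
    simpa only [side_eq hσ] using hS _ hy) (by
    rw [mem_uIcc_side (ζ := ζ) hσ, side_mul_self hσ, side_mul_self hσ, side_mul_self hσ]
    exact hz)
  have e1 : ∀ s t : ℝ, (ζ + σ * s - (ζ + σ * t)) ^ 2 = (s - t) ^ 2 := fun s t => by
    linear_combination (s - t) ^ 2 * hσ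
  rwa [e1, e1] at h

theorem Harnack.side_eq_zero_or_pos {H : ℝ → ℝ≥0∞} {δ δ₁ β : ℝ} (hσ : σ ^ 2 = 1)
    (hH : Harnack H {y | 0 < σ * (y - ζ) ∧ σ * (y - ζ) < δ}) (hδ₁ : 0 < δ₁) (hβ : δ₁ < β)
    (hβδ : β < δ) :
    (∀ y, 0 < σ * (y - ζ) → σ * (y - ζ) < δ → H y = 0) ∨
      ∃ c > 0, ∀ y, σ * (y - ζ) ∈ Ico δ₁ β → ENNReal.ofReal c ≤ H y := by
  have hS : ∀ x e : ℝ, 0 < x → 0 < e → x < δ → e < δ → ∀ v ∈ uIcc x e,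
      ζ + σ * v ∈ {y | 0 < σ * (y - ζ) ∧ σ * (y - ζ) < δ} := by
    intro x e hx he hx' he' v hv
    simp only [mem_ofPred_eq, side_mul_self hσ]
    rcases mem_uIcc.1 hv with h | h <;> constructor <;> linarith [h.1, h.2]
  by_cases hc : H (ζ + σ * δ₁) = 0
  · left
    intro y hy hyδ
    set t := σ * (y - ζ) with ht
    rw [← side_eq (ζ := ζ) hσ y, ← ht]
    obtain ⟨e, he0, heδ, het, hmem⟩ : ∃ e, 0 < e ∧ e < δ ∧ e ≠ t ∧ t ∈ uIcc δ₁ e := by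
      rcases le_total t δ₁ with h | h
      · exact ⟨t / 2, by linarith, by linarith, by linarith,
          mem_uIcc.2 (Or.inr ⟨by linarith, h⟩)⟩
      · exact ⟨(t + δ) / 2, by linarith, by linarith, by linarith,
          mem_uIcc.2 (Or.inl ⟨h, by linarith⟩)⟩
    have := hH.side (x := δ₁) (e := e) (z := t) hσ
      (hS _ _ hδ₁ he0 (by linarith) heδ) hmem
    rw [hc, zero_mul, nonpos_iff_eq_zero, mul_eq_zero] at this
    refine this.resolve_right ?_
    rw [ENNReal.ofReal_eq_zero, not_le]
    have : e - t ≠ 0 := sub_ne_zero.2 het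
    positivity
  · right
    set q := min (H (ζ + σ * δ₁)) 1 with hq
    have hq0 : q ≠ 0 := by
      rw [hq]; simp [hc]
    have hq1 : q ≠ ⊤ := ne_top_of_le_ne_top ENNReal.one_ne_top (min_le_right _ _)
    have hqr : 0 < q.toReal := ENNReal.toReal_pos hq0 hq1
    have hβ0 : 0 < β := hδ₁.trans hβ
    refine ⟨q.toReal * (δ₁ / 2) ^ 2 / β ^ 2, by positivity, fun y hy => ?_⟩
    set t := σ * (y - ζ) with ht
    have h := hH.side (x := t) (e := δ₁ / 2) (z := δ₁) hσ
      (hS _ _ (by linarith [hy.1]) (by linarith) (by linarith [hy.2]) (by linarith))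
      (mem_uIcc.2 (Or.inr ⟨by linarith, hy.1⟩))
    rw [ht, side_eq hσ, ← ht] at h
    have h2 : q * ENNReal.ofReal ((δ₁ / 2) ^ 2) ≤ H y * ENNReal.ofReal (β ^ 2) := by
      calc q * ENNReal.ofReal ((δ₁ / 2) ^ 2)
          ≤ H (ζ + σ * δ₁) * ENNReal.ofReal ((δ₁ / 2 - δ₁) ^ 2) := by
            refine mul_le_mul' (min_le_left _ _) (ENNReal.ofReal_le_ofReal (le_of_eq ?_))
            ring
        _ ≤ _ := h.trans (mul_le_mul' le_rfl (ENNReal.ofReal_le_ofReal (by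
            nlinarith [hy.1, hy.2])))
    rw [ENNReal.ofReal_div_of_pos (by positivity), ENNReal.ofReal_mul hqr.le,
      ENNReal.ofReal_toReal hq1]
    exact ENNReal.div_le_of_le_mul h2

/-- A monotone function cut off to an interval is a difference of monotone functions. -/
theorem exists_monotone_sub_eq_indicator {J : Set ℝ} (hJ : J.OrdConnected) {φ : ℝ → ℝ}
    (hφ : MonotoneOn φ J) (h0 : ∀ v ∈ J, 0 ≤ φ v) (h1 : ∀ v ∈ J, φ v ≤ 1) :
    ∃ M₁ M₂ : ℝ → ℝ, (Monotone M₁ ∧ (∀ v, 0 ≤ M₁ v) ∧ ∀ v, M₁ v ≤ 1) ∧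
      (Monotone M₂ ∧ (∀ v, 0 ≤ M₂ v) ∧ ∀ v, M₂ v ≤ 1) ∧ ∀ v, M₁ v - M₂ v = J.indicator φ v := by
  classical
  have hout : ∀ {s t}, s ∉ J → (∃ i ∈ J, i ≤ s) → s ≤ t → t ∉ J := by
    rintro s t hs ⟨i, hi, his⟩ hst ht
    exact hs (hJ.out hi ht ⟨his, hst⟩)
  refine ⟨fun v => if v ∈ J then φ v else if ∃ i ∈ J, i ≤ v then 1 else 0,
    fun v => if v ∈ J then 0 else if ∃ i ∈ J, i ≤ v then 1 else 0,
    ⟨fun s t hst => ?_, fun v => ?_, fun v => ?_⟩, ⟨fun s t hst => ?_, fun v => ?_, fun v => ?_⟩,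
    fun v => ?_⟩
  · have habove : (∃ i ∈ J, i ≤ s) → ∃ i ∈ J, i ≤ t := fun ⟨i, hi, h⟩ => ⟨i, hi, h.trans hst⟩
    by_cases hs : s ∈ J
    · have hs' : ∃ i ∈ J, i ≤ t := ⟨s, hs, hst⟩
      by_cases ht : t ∈ J
      · simpa [hs, ht] using hφ hs ht hst
      · simpa [hs, ht, hs'] using h1 s hs
    · by_cases hs' : ∃ i ∈ J, i ≤ s
      · simp only [hs, hout hs hs' hst, hs', habove hs', if_true, if_false, le_refl]
      · simp only [hs, hs', if_false]
        split_ifs with h2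
        · exact h0 t h2
        · exact zero_le_one
        · exact le_rfl
  · simp only
    split_ifs with h2
    · exact h0 v h2
    · exact zero_le_one
    · exact le_rfl
  · simp only
    split_ifs with h2
    · exact h1 v h2
    · exact le_rfl
    · exact zero_le_one
  · have habove : (∃ i ∈ J, i ≤ s) → ∃ i ∈ J, i ≤ t := fun ⟨i, hi, h⟩ => ⟨i, hi, h.trans hst⟩
    by_cases hs : s ∈ J
    · simp only [hs, if_true]
      split_ifs <;> norm_num
    · by_cases hs' : ∃ i ∈ J, i ≤ s
      · simp only [hs, hout hs hs' hst, hs', habove hs', if_true, if_false, le_refl]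
      · simp only [hs, hs', if_false]
        split_ifs <;> norm_num
  · simp only
    split_ifs <;> norm_num
  · simp only
    split_ifs <;> norm_num
  · by_cases hv : v ∈ J
    · simp [hv]
    · simp [hv]

end Side

section IntervalMixing

variable {a σ ζ : ℝ}

/-- The density of an expanded interval, weighted by the squared distance to an anchor point, is
bounded by the mass of the interval. -/
theorem Harnack.anchor_bound {w : ℝ → ℝ≥0∞} {S : Set ℝ} (hw : Harnack w S)
    (hσ : σ ^ 2 = 1) {v₀ v b η β : ℝ} (hv₀ : 0 < v₀) (hv : v₀ ≤ v) (hvb : v ≤ b)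
    (hbβ : b + η ≤ β)
    (hS : ∀ y, 0 < σ * (y - ζ) → σ * (y - ζ) < b + η → y ∈ S) :
    w (ζ + σ * v) * ENNReal.ofReal ((v - v₀) ^ 2) * ENNReal.ofReal η ≤
      ENNReal.ofReal (β ^ 2) * ∫⁻ y, w y := by
  set A := (fun y => σ * (y - ζ)) ⁻¹' Ico b (b + η) with hA
  have hAm : MeasurableSet A := measurable_side σ ζ measurableSet_Ico
  calc w (ζ + σ * v) * ENNReal.ofReal ((v - v₀) ^ 2) * ENNReal.ofReal η
      = ∫⁻ _ in A, w (ζ + σ * v) * ENNReal.ofReal ((v - v₀) ^ 2) := by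
        rw [setLIntegral_const, hA, volume_side hσ, add_sub_cancel_left]
    _ ≤ ∫⁻ y in A, ENNReal.ofReal (β ^ 2) * w y := by
        refine setLIntegral_mono' hAm fun y hy => ?_
        have hy : b ≤ σ * (y - ζ) ∧ σ * (y - ζ) < b + η := hy
        set t := σ * (y - ζ) with ht
        have h := hw.side (ζ := ζ) (x := t) (e := v₀) (z := v) hσ (fun s hs => by
          rw [mem_uIcc] at hs
          refine hS _ ?_ ?_ <;> rw [side_mul_self hσ] <;> rcases hs with h | h <;>
            linarith [h.1, h.2, hy.1, hy.2])
          (mem_uIcc.2 (Or.inr ⟨hv, by linarith⟩))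
        rw [ht, side_eq hσ, ← ht] at h
        rw [mul_comm (ENNReal.ofReal (β ^ 2)), show (v - v₀) ^ 2 = (v₀ - v) ^ 2 by ring]
        refine h.trans (mul_le_mul' le_rfl (ENNReal.ofReal_le_ofReal ?_))
        nlinarith
    _ ≤ ∫⁻ y, ENNReal.ofReal (β ^ 2) * w y := setLIntegral_le_lintegral _ _
    _ = _ := lintegral_const_mul' _ _ ENNReal.ofReal_ne_top

theorem setIntegral_comp_push (N : ℕ) {H w : ℝ → ℝ≥0∞}
    {K U : Set ℝ} (hw : Measurable w)
    (hwA : ∀ A, MeasurableSet A →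
      ∫⁻ y in A, w y = ∫⁻ x in K ∩ (Ta a)^[N] ⁻¹' A, H x)
    (hK : IsPreconnected K) (hinj : InjOn ((Ta a)^[N]) K) (hUK : U ⊆ K) (hU : IsPreconnected U)
    (hfin : ∀ x ∈ U, w ((Ta a)^[N] x) < ⊤) {g : ℝ → ℝ} (hg : Measurable g) :
    ∫ x in U, g ((Ta a)^[N] x) ∂(volume.withDensity H) =
      ∫ y in (Ta a)^[N] '' U, (w y).toReal * g y := by
  have hKm : MeasurableSet K := hK.ordConnected.measurableSet
  have hNc : Continuous ((Ta a)^[N]) := (continuous_Ta a).iterate N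
  have hIm : MeasurableSet ((Ta a)^[N] '' U) :=
    (hU.image _ hNc.continuousOn).ordConnected.measurableSet
  have hmap : ((volume.withDensity H).restrict K).map ((Ta a)^[N]) = volume.withDensity w := by
    ext A hA
    rw [Measure.map_apply hNc.measurable hA, Measure.restrict_apply (hNc.measurable hA),
      withDensity_apply _ hA, hwA A hA, inter_comm,
      withDensity_apply _ (hKm.inter (hNc.measurable hA))]
  have hset : (Ta a)^[N] ⁻¹' ((Ta a)^[N] '' U) ∩ K = U := by
    ext x
    constructor
    · rintro ⟨⟨u, hu, hux⟩, hx⟩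
      exact hinj (hUK hu) hx hux ▸ hu
    · exact fun hx => ⟨⟨x, hx, rfl⟩, hUK hx⟩
  have h1 := setIntegral_map (μ := (volume.withDensity H).restrict K) (g := (Ta a)^[N]) (f := g)
    hIm hg.aestronglyMeasurable hNc.measurable.aemeasurable
  rw [Measure.restrict_restrict (hNc.measurable hIm), hset, hmap] at h1
  rw [← h1, setIntegral_withDensity_eq_setIntegral_toReal_smul hw ?_ _ hIm]
  · simp only [smul_eq_mul]
  · refine (ae_restrict_iff' hIm).2 (Eventually.of_forall ?_)
    rintro _ ⟨x, hx, rfl⟩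
    exact hfin x hx

theorem push_interval_independence (ha : 0 < a) {H : ℝ → ℝ≥0∞} (hHm : Measurable H)
    [IsProbabilityMeasure (volume.withDensity H)] (hErg : Ergodic (Ta a) (volume.withDensity H))
    {G : ℕ → ℝ → ℝ} (hG : ∀ n, Measurable (G n)) (h0 : ∀ n x, 0 ≤ G n x)
    (h1 : ∀ n x, G n x ≤ 1)
    (hGT : Tendsto (fun n => ∫ x, |G n (Ta a x) - G n x| ∂(volume.withDensity H)) atTop (𝓝 0))
    {δ δ₁ β η : ℝ} (hσ : σ ^ 2 = 1) (hδ₁ : 0 < δ₁) (hβ : δ₁ < β) (hβδ : β < δ) (hη : 0 < η)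
    (hH : Harnack H {y | 0 < σ * (y - ζ) ∧ σ * (y - ζ) < δ}) {ε : ℝ} (hε : 0 < ε) :
    ∀ᶠ n in atTop, ∀ (N : ℕ) (K U : Set ℝ) (b : ℝ), IsPreconnected K →
      K ⊆ {y | 0 < σ * (y - ζ) ∧ σ * (y - ζ) < δ} → (∀ m < N, ∀ x ∈ K, (Ta a)^[m] x ≠ 0) →
      InjOn ((Ta a)^[N]) K → U ⊆ K → IsPreconnected U →
      (∀ x ∈ U, δ₁ ≤ σ * ((Ta a)^[N] x - ζ) ∧ σ * ((Ta a)^[N] x - ζ) ≤ b) → b + η ≤ β →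
      (∀ y, 0 < σ * (y - ζ) → σ * (y - ζ) < b + η → y ∈ (Ta a)^[N] '' K) →
      |∫ x in U, (G n ((Ta a)^[N] x) - ∫ y, G n y ∂(volume.withDensity H))
        ∂(volume.withDensity H)| ≤ ε * (volume.withDensity H).real K := by
  set μ := volume.withDensity H with hμ
  have htriv : ∀ {U K : Set ℝ}, U ⊆ K → μ K = 0 → ∀ g : ℝ → ℝ, ∫ x in U, g x ∂μ = 0 := by
    intro U K hUK hK g
    rw [Measure.restrict_eq_zero.2 (measure_mono_null hUK hK), integral_zero_measure]
  rcases hH.side_eq_zero_or_pos hσ hδ₁ hβ hβδ with hz | ⟨c, hc, hcH⟩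
  · refine Eventually.of_forall fun n N K U b _ hKS _ _ hUK _ _ _ _ => ?_
    have hsm : MeasurableSet {y : ℝ | 0 < σ * (y - ζ) ∧ σ * (y - ζ) < δ} :=
      (measurable_side σ ζ) measurableSet_Ioo
    rw [htriv hUK (measure_mono_null hKS ?_), abs_zero]
    · exact mul_nonneg hε.le measureReal_nonneg
    · rw [hμ, withDensity_apply _ hsm]
      exact setLIntegral_eq_zero hsm fun y hy => hz y hy.1 hy.2
  have hβ0 : 0 < β := hδ₁.trans hβ
  set v₀ := δ₁ / 2 with hv₀
  set s : ℝ → ℝ := (Ico δ₁ β).indicator fun v => ((v - v₀) ^ 2)⁻¹ with hs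
  have hsm : Measurable s := Measurable.indicator (by fun_prop) measurableSet_Ico
  have hs0 : ∀ v, 0 ≤ s v := fun v => indicator_nonneg (fun v _ => by positivity) v
  have hsC : ∀ v, s v ≤ (v₀ ^ 2)⁻¹ := by
    intro v
    by_cases hv : v ∈ Ico δ₁ β
    · rw [hs, indicator_of_mem hv]
      have : v₀ ≤ v - v₀ := by linarith [hv.1]
      gcongr
    · rw [hs, indicator_of_notMem hv]
      positivity
  set u : ℝ → ℝ := fun y => s (σ * (y - ζ)) / max (H y).toReal c with hu
  have hum : Measurable u := (hsm.comp (measurable_side σ ζ)).div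
    (hHm.ennreal_toReal.max measurable_const)
  have hu0 : ∀ y, 0 ≤ u y := fun y => div_nonneg (hs0 _) (hc.le.trans (le_max_right _ _))
  have huC : ∀ y, u y ≤ (v₀ ^ 2)⁻¹ / c := fun y =>
    div_le_div₀ (by positivity) (hsC _) hc (le_max_right _ _)
  have hsupp : ∀ y, σ * (y - ζ) ∉ Ico δ₁ β → u y = 0 := fun y hy => by
    simp only [hu, hs, indicator_of_notMem hy, zero_div]
  have hHtop : ∀ᵐ y, H y < ⊤ := ae_lt_top hHm (by
    rw [← setLIntegral_univ, ← withDensity_apply _ MeasurableSet.univ]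
    exact measure_ne_top _ _)
  have huH : ∀ᵐ y, (H y).toReal * u y = s (σ * (y - ζ)) := by
    filter_upwards [hHtop] with y hy
    by_cases hmem : σ * (y - ζ) ∈ Ico δ₁ β
    · have hcy : c ≤ (H y).toReal := (ENNReal.ofReal_le_iff_le_toReal hy.ne).1 (hcH y hmem)
      simp only [hu, max_eq_left hcy]
      have : (H y).toReal ≠ 0 := by linarith
      field_simp
    · rw [hsupp y hmem]
      simp only [hs, indicator_of_notMem hmem, mul_zero]
  have hden : ∀ g : ℝ → ℝ, ∫ y, g y ∂μ = ∫ y, (H y).toReal * g y := fun g => by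
    rw [hμ, integral_withDensity_eq_integral_toReal_smul hHm hHtop]
    simp only [smul_eq_mul]
  have hstrip : ∀ s' t, δ₁ ≤ s' → s' ≤ t → t ≤ β →
      ∫ x in (fun y => σ * (y - ζ)) ⁻¹' Ico s' t, u x ∂μ ≤ (v₀ ^ 2)⁻¹ * (t - s') := by
    intro s' t _ hst _
    have hAm : MeasurableSet ((fun y => σ * (y - ζ)) ⁻¹' Ico s' t) :=
      measurable_side σ ζ measurableSet_Ico
    have hvol : volume.real ((fun y => σ * (y - ζ)) ⁻¹' Ico s' t) = t - s' := by
      rw [Measure.real, volume_side hσ, ENNReal.toReal_ofReal (by linarith)]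
    have hb := norm_setIntegral_le_of_norm_le_const (μ := volume)
      (s := (fun y => σ * (y - ζ)) ⁻¹' Ico s' t) (f := fun y => s (σ * (y - ζ)))
      (C := (v₀ ^ 2)⁻¹) (by rw [volume_side hσ]; exact ENNReal.ofReal_lt_top)
      (fun y _ => by rw [Real.norm_of_nonneg (hs0 _)]; exact hsC _)
    rw [hvol] at hb
    refine le_trans (le_of_eq ?_) ((le_abs_self _).trans hb)
    rw [← integral_indicator hAm, hden, ← integral_indicator hAm]
    refine integral_congr_ae ?_
    filter_upwards [huH] with y hy
    by_cases hm : y ∈ (fun y => σ * (y - ζ)) ⁻¹' Ico s' t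
    · rw [indicator_of_mem hm, indicator_of_mem hm, hy]
    · rw [indicator_of_notMem hm, indicator_of_notMem hm, mul_zero]
  have hε' : 0 < ε * η / (2 * β ^ 2) := by positivity
  filter_upwards [ergodic_monotone_independence hErg hG h0 h1 hGT hum hu0 huC
    (measurable_side σ ζ) hβ hsupp hstrip hε'] with n hn N K U b hK hKS hK0 hinj hUK hU hUb hbβ
    himg
  by_cases hμK : μ K = 0
  · rw [htriv hUK hμK, abs_zero]
    exact mul_nonneg hε.le measureReal_nonneg
  have hμKr : 0 < μ.real K := ENNReal.toReal_pos hμK (measure_ne_top _ _)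
  obtain ⟨w, hwm, hwH, hwA⟩ := exists_harnack_push ha N hK hK0 hHm (hH.mono hKS)
  have hKm : MeasurableSet K := hK.ordConnected.measurableSet
  have hwint : ∫⁻ y, w y = μ K := by
    rw [← setLIntegral_univ, hwA _ MeasurableSet.univ, preimage_univ, inter_univ, hμ,
      withDensity_apply _ hKm]
  set C := β ^ 2 / η * μ.real K with hC
  have hC0 : 0 < C := by positivity
  have hbound : ∀ v, δ₁ ≤ v → v ≤ b → w (ζ + σ * v) < ⊤ ∧
      (w (ζ + σ * v)).toReal * (v - v₀) ^ 2 ≤ C := by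
    intro v hv hvb
    have h := hwH.anchor_bound (ζ := ζ) hσ (v₀ := v₀) (v := v) (by positivity) (by linarith) hvb
      hbβ himg
    rw [hwint] at h
    have hpos : 0 < (v - v₀) ^ 2 := by
      have : 0 < v - v₀ := by linarith
      positivity
    have hlt : ENNReal.ofReal (β ^ 2) * μ K ≠ ⊤ :=
      ENNReal.mul_ne_top ENNReal.ofReal_ne_top (measure_ne_top _ _)
    constructor
    · by_contra htop
      rw [not_lt, top_le_iff] at htop
      rw [htop, ENNReal.top_mul (ENNReal.ofReal_pos.2 hpos).ne',
        ENNReal.top_mul (ENNReal.ofReal_pos.2 hη).ne'] at h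
      exact hlt (top_le_iff.1 h)
    · have := ENNReal.toReal_mono hlt h
      rw [ENNReal.toReal_mul, ENNReal.toReal_mul, ENNReal.toReal_mul,
        ENNReal.toReal_ofReal hpos.le, ENNReal.toReal_ofReal hη.le,
        ENNReal.toReal_ofReal (by positivity)] at this
      rw [hC, div_mul_eq_mul_div, le_div_iff₀ hη]
      exact this
  set I := (Ta a)^[N] '' U with hI
  have hIb : ∀ y ∈ I, δ₁ ≤ σ * (y - ζ) ∧ σ * (y - ζ) ≤ b := by
    rintro _ ⟨x, hx, rfl⟩
    exact hUb x hx
  have hIc : I.OrdConnected :=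
    (hU.image _ ((continuous_Ta a).iterate N).continuousOn).ordConnected
  set J : Set ℝ := {v | ζ + σ * v ∈ I} with hJ
  have hJb : ∀ v ∈ J, δ₁ ≤ v ∧ v ≤ b := fun v hv => by
    have := hIb _ hv
    rwa [side_mul_self hσ] at this
  have hJc : J.OrdConnected := by
    refine ⟨fun x hx y hy z hz => ?_⟩
    have : ζ + σ * z ∈ uIcc (ζ + σ * x) (ζ + σ * y) := by
      rw [mem_uIcc_side (ζ := ζ) hσ, side_mul_self hσ, side_mul_self hσ, side_mul_self hσ]
      exact Icc_subset_uIcc hz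
    exact hIc.uIcc_subset hx hy this
  set φ : ℝ → ℝ := fun v => (w (ζ + σ * v)).toReal * (v - v₀) ^ 2 / C with hφ
  have hφmono : MonotoneOn φ J := by
    intro x hx y hy hxy
    have hx' := hJb x hx
    have hy' := hJb y hy
    have h := hwH.side (ζ := ζ) (x := y) (e := v₀) (z := x) hσ (fun t ht => by
      rw [mem_uIcc] at ht
      refine himg _ ?_ ?_ <;> rw [side_mul_self hσ] <;> rcases ht with h | h <;>
        linarith [h.1, h.2]) (mem_uIcc.2 (Or.inr ⟨by linarith, hxy⟩))
    have h' := ENNReal.toReal_mono (ENNReal.mul_ne_top (hbound y hy'.1 hy'.2).1.ne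
      ENNReal.ofReal_ne_top) h
    rw [ENNReal.toReal_mul, ENNReal.toReal_mul, ENNReal.toReal_ofReal (by positivity),
      ENNReal.toReal_ofReal (by positivity), ← neg_sub x, ← neg_sub y, neg_sq, neg_sq] at h'
    simp only [hφ]
    gcongr
  obtain ⟨M₁, M₂, ⟨hM₁, hM₁0, hM₁1⟩, ⟨hM₂, hM₂0, hM₂1⟩, hM⟩ :=
    exists_monotone_sub_eq_indicator hJc hφmono (fun v _ => by positivity)
      (fun v hv => (div_le_one hC0).2 (hbound v (hJb v hv).1 (hJb v hv).2).2)
  have hn₁ := hn M₁ hM₁ hM₁0 hM₁1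
  have hn₂ := hn M₂ hM₂ hM₂0 hM₂1
  set E := ∫ y, G n y ∂μ with hE
  have hE0 : 0 ≤ E := integral_nonneg (h0 n)
  have hE1 : E ≤ 1 := by
    have := integral_mono (μ := μ) (integrable_of_mem_unit (hG n) (h0 n) (h1 n))
      (integrable_const 1) (h1 n)
    simpa using this
  have hInt : ∀ M : ℝ → ℝ, Monotone M → (∀ v, 0 ≤ M v) → (∀ v, M v ≤ 1) →
      Integrable (fun x => (G n x - E) * (M (σ * (x - ζ)) * u x)) μ := by
    intro M hMm hM0 hM1
    refine Integrable.of_bound (((hG n).sub_const E).mul ((hMm.measurable.comp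
      (measurable_side σ ζ)).mul hum)).aestronglyMeasurable (1 * (1 * ((v₀ ^ 2)⁻¹ / c)))
      (Eventually.of_forall fun x => ?_)
    rw [norm_mul, norm_mul, Real.norm_of_nonneg (hM0 _), Real.norm_of_nonneg (hu0 x)]
    gcongr
    · exact mul_nonneg (hM0 _) (hu0 x)
    · rw [Real.norm_eq_abs, abs_le]
      constructor <;> linarith [h0 n x, h1 n x]
    · exact hu0 x
    · exact hM1 _
    · exact huC x
  have hmain : ∫ x in U, (G n ((Ta a)^[N] x) - E) ∂μ =
      C * (∫ x, (G n x - E) * (M₁ (σ * (x - ζ)) * u x) ∂μ -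
        ∫ x, (G n x - E) * (M₂ (σ * (x - ζ)) * u x) ∂μ) := by
    rw [← integral_sub (hInt M₁ hM₁ hM₁0 hM₁1) (hInt M₂ hM₂ hM₂0 hM₂1), ← integral_const_mul,
      hden, hμ, setIntegral_comp_push N hwm hwA hK hinj hUK hU (g := fun y => G n y - E)
      (fun x hx => by
        have := (hbound _ (hUb x hx).1 (hUb x hx).2).1
        rwa [side_eq hσ] at this) ((hG n).sub_const E), ← integral_indicator
        hIc.measurableSet]
    refine integral_congr_ae ?_
    filter_upwards [huH] with y hy
    have e : (H y).toReal * (C * ((G n y - E) * (M₁ (σ * (y - ζ)) * u y) -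
        (G n y - E) * (M₂ (σ * (y - ζ)) * u y))) =
        C * (G n y - E) * (M₁ (σ * (y - ζ)) - M₂ (σ * (y - ζ))) * ((H y).toReal * u y) := by ring
    rw [e, hM, hy]
    by_cases hyI : y ∈ I
    · have hyJ : σ * (y - ζ) ∈ J := by
        change ζ + σ * (σ * (y - ζ)) ∈ I
        rwa [side_eq hσ]
      have hy' := hIb y hyI
      have hmem : σ * (y - ζ) ∈ Ico δ₁ β := ⟨hy'.1, by linarith⟩
      simp only [hs, indicator_of_mem hyI, indicator_of_mem hyJ, indicator_of_mem hmem, hφ,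
        side_eq hσ]
      have : σ * (y - ζ) - v₀ ≠ 0 := by
        have : 0 < σ * (y - ζ) - v₀ := by linarith
        exact this.ne'
      field_simp
    · have hyJ : σ * (y - ζ) ∉ J := fun h => hyI (by
        have : ζ + σ * (σ * (y - ζ)) ∈ I := h
        rwa [side_eq hσ] at this)
      rw [indicator_of_notMem hyI, indicator_of_notMem hyJ]
      ring
  rw [hmain, abs_mul, abs_of_pos hC0]
  calc C * _ ≤ C * (ε * η / (2 * β ^ 2) + ε * η / (2 * β ^ 2)) := by
        refine mul_le_mul_of_nonneg_left ?_ hC0.le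
        exact (abs_sub _ _).trans (add_le_add hn₁ hn₂)
    _ = ε * μ.real K := by rw [hC]; field_simp; ring

end IntervalMixing

section LocalDynamics

variable {a ζ : ℝ} {p : ℕ}

theorem hasDerivAt_iterate_Ta (a : ℝ) (n : ℕ) (x : ℝ) :
    HasDerivAt ((Ta a)^[n]) (∏ i ∈ Finset.range n, (-(2 * a * (Ta a)^[i] x))) x := by
  induction n with
  | zero => simpa using hasDerivAt_id x
  | succ n ih =>
    have h : HasDerivAt (Ta a) (-(2 * a * (Ta a)^[n] x)) ((Ta a)^[n] x) := by
      have h1 : HasDerivAt (fun y : ℝ => 1 - a * y ^ 2) _ ((Ta a)^[n] x) :=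
        ((hasDerivAt_pow 2 ((Ta a)^[n] x)).const_mul a).const_sub 1
      have h2 : -(a * (((2 : ℕ) : ℝ) * ((Ta a)^[n] x) ^ (2 - 1))) = -(2 * a * (Ta a)^[n] x) := by
        push_cast
        ring
      rw [h2] at h1
      exact h1
    rw [Function.iterate_succ', Finset.prod_range_succ, mul_comm]
    exact h.comp x ih

theorem abs_deriv_iterate_Ta (ha : 0 < a) (n : ℕ) (x : ℝ) :
    |deriv ((Ta a)^[n]) x| = ∏ i ∈ Finset.range n, 2 * a * |(Ta a)^[i] x| := by
  rw [(hasDerivAt_iterate_Ta a n x).deriv, Finset.abs_prod]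
  refine Finset.prod_congr rfl fun i _ => ?_
  rw [abs_neg, abs_mul, abs_of_pos (by positivity)]

theorem injOn_iterate_Ta (ha : 0 < a) (n : ℕ) : ∀ {Z : Set ℝ}, IsPreconnected Z →
    (∀ m < n, ∀ x ∈ Z, (Ta a)^[m] x ≠ 0) → InjOn ((Ta a)^[n]) Z := by
  induction n with
  | zero => intro Z _ _; exact injOn_id Z
  | succ n ih =>
    intro Z hZ h0
    rw [Function.iterate_succ]
    refine InjOn.comp (t := Ta a '' Z) (ih (hZ.image _ (continuous_Ta a).continuousOn) ?_) ?_
      (mapsTo_image _ _)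
    · rintro m hm _ ⟨x, hx, rfl⟩
      rw [← Function.iterate_succ_apply]
      exact h0 (m + 1) (by omega) x hx
    · intro x hx y hy hxy
      rcases eq_or_eq_neg_of_Ta_eq ha hxy with h | h
      · exact h
      · refine absurd rfl (h0 0 (by omega) 0 (hZ.ordConnected.uIcc_subset hx hy ?_))
        rw [h, mem_uIcc]
        rcases le_total 0 y with h | h
        · left; constructor <;> linarith
        · right; constructor <;> linarith

/-- Near `ζ` the map `(Ta a)^[p]` expands distances to its fixed point `ζ`, and the intermediate
iterates stay away from `ζ` and from the critical point. -/
structure LocalExpansion (a ζ : ℝ) (p : ℕ) (δ l L : ℝ) : Prop where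
  pos : 0 < δ
  one_lt : 1 < l
  le : l ≤ L
  fixed : (Ta a)^[p] ζ = ζ
  lower : ∀ x, |x - ζ| < δ → l * |x - ζ| ≤ |(Ta a)^[p] x - ζ|
  upper : ∀ x, |x - ζ| < δ → |(Ta a)^[p] x - ζ| ≤ L * |x - ζ|
  ne_zero : ∀ x, |x - ζ| < δ → ∀ j < p, (Ta a)^[j] x ≠ 0
  far : ∀ x, |x - ζ| < δ → ∀ j, 0 < j → j < p → δ ≤ |(Ta a)^[j] x - ζ|

theorem exists_localExpansion (ha : 0 < a) (hper : (Ta a)^[p] ζ = ζ)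
    (hprime : ∀ j, 1 ≤ j → j < p → (Ta a)^[j] ζ ≠ ζ) (h0 : ∀ j, (Ta a)^[j] ζ ≠ 0)
    (hexp : 1 < ∏ i ∈ Finset.range p, 2 * a * |(Ta a)^[i] ζ|) :
    ∃ l L : ℝ, ∀ᶠ δ in 𝓝[>] 0, LocalExpansion a ζ p δ l L := by
  set D := ∏ i ∈ Finset.range p, (-(2 * a * (Ta a)^[i] ζ)) with hD
  have hDabs : |D| = ∏ i ∈ Finset.range p, 2 * a * |(Ta a)^[i] ζ| := by
    rw [← abs_deriv_iterate_Ta ha, (hasDerivAt_iterate_Ta a p ζ).deriv]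
  rw [← hDabs] at hexp
  set e := (|D| - 1) / 2 with he
  have hball : ∀ {P : ℝ → Prop}, (∀ᶠ x in 𝓝 ζ, P x) →
      ∀ᶠ δ in 𝓝[>] (0 : ℝ), ∀ x, |x - ζ| < δ → P x := by
    intro P hP
    obtain ⟨ε, hε, h⟩ := Metric.eventually_nhds_iff.1 hP
    filter_upwards [Ioo_mem_nhdsGT hε] with δ hδ x hx
    exact h (by rw [Real.dist_eq]; exact hx.trans hδ.2)
  have hder : ∀ᶠ x in 𝓝 ζ, |(Ta a)^[p] x - ζ - D * (x - ζ)| ≤ e * |x - ζ| := by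
    have := (hasDerivAt_iff_isLittleO.1 (hasDerivAt_iterate_Ta a p ζ)).def
      (show 0 < e by rw [he]; linarith)
    filter_upwards [this] with x hx
    rw [hper] at hx
    rw [← hD] at hx
    simpa only [smul_eq_mul, Real.norm_eq_abs, mul_comm (x - ζ) D] using hx
  have hne : ∀ᶠ x in 𝓝 ζ, ∀ j ∈ Finset.range p, (Ta a)^[j] x ≠ 0 :=
    (Finset.range p).eventually_all.2 fun j _ =>
      ((continuous_Ta a).iterate j).continuousAt.eventually_ne (h0 j)
  have hfar : ∀ᶠ δ in 𝓝[>] (0 : ℝ), ∀ j ∈ Finset.Ioo 0 p, ∀ x, |x - ζ| < δ →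
      δ ≤ |(Ta a)^[j] x - ζ| := by
    refine (Finset.Ioo 0 p).eventually_all.2 fun j hj => ?_
    rw [Finset.mem_Ioo] at hj
    have hd : 0 < |(Ta a)^[j] ζ - ζ| := abs_pos.2 (sub_ne_zero.2 (hprime j hj.1 hj.2))
    have hc : ContinuousAt (fun x => |(Ta a)^[j] x - ζ|) ζ := by
      have := ((continuous_Ta a).iterate j)
      exact (by fun_prop : Continuous fun x => |(Ta a)^[j] x - ζ|).continuousAt
    have hev := hball (hc.eventually_const_lt (half_lt_self hd))
    filter_upwards [hev, Ioo_mem_nhdsGT (half_pos hd)] with δ h1 h2 x hx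
    exact h2.2.le.trans (h1 x hx).le
  refine ⟨|D| - e, |D| + e, ?_⟩
  filter_upwards [hball hder, hball hne, hfar, self_mem_nhdsWithin] with δ h1 h2 h3 h4
  refine ⟨h4, by rw [he]; linarith, by rw [he]; linarith, hper, fun x hx => ?_, fun x hx => ?_,
    fun x hx j hj => h2 x hx j (Finset.mem_range.2 hj),
    fun x hx j hj0 hj => h3 j (Finset.mem_Ioo.2 ⟨hj0, hj⟩) x hx⟩
  · have hh := h1 x hx
    have := abs_sub_abs_le_abs_sub (D * (x - ζ)) ((Ta a)^[p] x - ζ)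
    rw [abs_sub_comm (D * (x - ζ)) ((Ta a)^[p] x - ζ), abs_mul] at this
    linarith
  · have hh := h1 x hx
    have := abs_sub_abs_le_abs_sub ((Ta a)^[p] x - ζ) (D * (x - ζ))
    rw [abs_mul] at this
    linarith

theorem exists_escape {g : ℝ → ℝ} {l L : ℝ} (hl1 : 1 < l) (hL0 : 0 < L)
    (hl : ∀ u, 0 ≤ u → l * u ≤ g u) (hL : ∀ u, 0 ≤ u → g u ≤ L * u) {δ₀ r : ℝ} (hr : 0 < r)
    (hrδ : r < δ₀) : ∃ M : ℕ, δ₀ / L ≤ g^[M] r ∧ g^[M] r < δ₀ := by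
  classical
  have hlow : ∀ m, l ^ m * r ≤ g^[m] r := by
    intro m
    induction m with
    | zero => simp
    | succ m ih =>
      rw [Function.iterate_succ_apply', pow_succ', mul_assoc]
      have h0 : 0 ≤ l ^ m * r := by positivity
      exact (mul_le_mul_of_nonneg_left ih (by linarith)).trans (hl _ (h0.trans ih))
  have hex : ∃ m, δ₀ ≤ g^[m] r := by
    obtain ⟨m, hm⟩ := pow_unbounded_of_one_lt (δ₀ / r) hl1
    exact ⟨m, ((div_lt_iff₀ hr).1 hm).le.trans (hlow m)⟩
  have hspec := Nat.find_spec hex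
  have hne : Nat.find hex ≠ 0 := fun h => by
    rw [h] at hspec
    exact absurd hspec (not_le.2 hrδ)
  obtain ⟨M, hM⟩ := Nat.exists_eq_succ_of_ne_zero hne
  refine ⟨M, ?_, not_le.1 (Nat.find_min hex (by omega))⟩
  rw [hM, Function.iterate_succ_apply'] at hspec
  rw [div_le_iff₀ hL0, mul_comm]
  have h0 : 0 ≤ l ^ M * r := by positivity
  exact hspec.trans (hL _ (h0.trans (hlow M)))

theorem iterate_bounds {g : ℝ → ℝ} {l L : ℝ} (hl0 : 0 ≤ l) (hL0 : 0 ≤ L)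
    (hl : ∀ u, 0 ≤ u → l * u ≤ g u) (hL : ∀ u, 0 ≤ u → g u ≤ L * u) (m : ℕ) {u : ℝ}
    (hu : 0 ≤ u) : l ^ m * u ≤ g^[m] u ∧ g^[m] u ≤ L ^ m * u := by
  induction m with
  | zero => simp
  | succ m ih =>
    have h0 : 0 ≤ g^[m] u := le_trans (by positivity) ih.1
    rw [Function.iterate_succ_apply', pow_succ', pow_succ', mul_assoc, mul_assoc]
    exact ⟨(mul_le_mul_of_nonneg_left ih.1 hl0).trans (hl _ h0),
      (hL _ h0).trans (mul_le_mul_of_nonneg_left ih.2 hL0)⟩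

end LocalDynamics

section Escape

variable {a ζ δ l L σ : ℝ} {p : ℕ}

theorem LocalExpansion.monotoneOn_iterate_two_mul (ha : 0 < a) (h : LocalExpansion a ζ p δ l L) :
    MonotoneOn ((Ta a)^[2 * p]) (Metric.ball ζ (δ / L)) := by
  have hL : 1 < L := h.one_lt.trans_le h.le
  have hsub : Metric.ball ζ (δ / L) ⊆ Metric.ball ζ δ :=
    Metric.ball_subset_ball (div_le_self h.pos.le hL.le)
  have hmaps : MapsTo ((Ta a)^[p]) (Metric.ball ζ (δ / L)) (Metric.ball ζ δ) := by
    intro x hx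
    have hx' := hsub hx
    rw [Metric.mem_ball, Real.dist_eq] at hx hx' ⊢
    refine (h.upper x hx').trans_lt ?_
    rwa [lt_div_iff₀ (by linarith), mul_comm] at hx
  rw [two_mul, Function.iterate_add]
  rcases monotoneOn_or_antitoneOn_iterate_Ta ha p
    (convex_ball ζ δ).isPreconnected
    (fun m hm x hx => h.ne_zero x (by rwa [Metric.mem_ball, Real.dist_eq] at hx) m hm) with hm | hm
  · exact hm.comp (hm.mono hsub) hmaps
  · exact hm.comp (hm.mono hsub) hmaps

theorem LocalExpansion.iterate_two_mul_bounds (h : LocalExpansion a ζ p δ l L) {x : ℝ}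
    (hx : |x - ζ| < δ / L) : |(Ta a)^[p] x - ζ| < δ ∧
    l ^ 2 * |x - ζ| ≤ |(Ta a)^[2 * p] x - ζ| ∧ |(Ta a)^[2 * p] x - ζ| ≤ L ^ 2 * |x - ζ| := by
  have hL : 1 < L := h.one_lt.trans_le h.le
  have hl := h.one_lt
  have hx' : |x - ζ| < δ := hx.trans_le (div_le_self h.pos.le hL.le)
  have h1 := h.upper x hx'
  have h1' := h.lower x hx'
  have h2 : |(Ta a)^[p] x - ζ| < δ := by
    refine h1.trans_lt ?_
    rwa [lt_div_iff₀ (by linarith), mul_comm] at hx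
  have h3 := h.upper _ h2
  have h3' := h.lower _ h2
  rw [← Function.iterate_add_apply, ← two_mul] at h3 h3'
  refine ⟨h2, ?_, ?_⟩ <;> nlinarith

/-- The map induced by `(Ta a)^[2 * p]` in the coordinate `σ * (x - ζ)` near `ζ`, extended to a
monotone map of the line. -/
theorem LocalExpansion.exists_sideMap (ha : 0 < a) (h : LocalExpansion a ζ p δ l L)
    (hσ : σ ^ 2 = 1) {d : ℝ} (hd0 : 0 < d) (hd : d < δ / L) : ∃ g : ℝ → ℝ, Monotone g ∧
    (∀ u, 0 ≤ u → l ^ 2 * u ≤ g u) ∧ (∀ u, 0 ≤ u → g u ≤ L ^ 2 * u) ∧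
    ∀ u, 0 ≤ u → u ≤ d → (Ta a)^[2 * p] (ζ + σ * u) = ζ + σ * g u := by
  have hl := h.one_lt
  have hlL := h.le
  have habs : |σ| = 1 := by
    rw [← sq_eq_sq₀ (abs_nonneg σ) zero_le_one, sq_abs, hσ, one_pow]
  have hcases : σ = 1 ∨ σ = -1 := sq_eq_sq_iff_eq_or_eq_neg.1 (by rw [hσ, one_pow])
  set F := (Ta a)^[2 * p] with hF
  have hmono := h.monotoneOn_iterate_two_mul ha
  have hball : ∀ u, 0 ≤ u → u ≤ d → |(ζ + σ * u) - ζ| = u ∧ u < δ / L := by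
    intro u hu hud
    refine ⟨?_, hud.trans_lt hd⟩
    rw [add_sub_cancel_left, abs_mul, habs, one_mul, abs_of_nonneg hu]
  have hmem : ∀ u, 0 ≤ u → u ≤ d → ζ + σ * u ∈ Metric.ball ζ (δ / L) := by
    intro u hu hud
    rw [Metric.mem_ball, Real.dist_eq, (hball u hu hud).1]
    exact (hball u hu hud).2
  set k : ℝ → ℝ := fun u => σ * (F (ζ + σ * u) - ζ) with hk
  have hkmono : ∀ u v, 0 ≤ u → u ≤ v → v ≤ d → k u ≤ k v := by
    intro u v hu huv hv
    have hmu := hmem u hu (huv.trans hv)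
    have hmv := hmem v (hu.trans huv) hv
    rcases hcases with rfl | rfl
    · have := hmono hmu hmv (by linarith)
      simp only [hk]; linarith
    · have := hmono hmv hmu (by linarith)
      simp only [hk]; linarith
  have hfix : F ζ = ζ := by
    rw [hF, two_mul, Function.iterate_add_apply, h.fixed, h.fixed]
  have hk0 : k 0 = 0 := by simp [hk, hfix]
  have hkb : ∀ u, 0 ≤ u → u ≤ d → l ^ 2 * u ≤ k u ∧ k u ≤ L ^ 2 * u := by
    intro u hu hud
    have hb := hball u hu hud
    have h2 := (h.iterate_two_mul_bounds (by rw [hb.1]; exact hb.2)).2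
    rw [hb.1] at h2
    have hknn : 0 ≤ k u := hk0 ▸ hkmono 0 u le_rfl hu hud
    have : |F (ζ + σ * u) - ζ| = k u := by
      rw [← abs_of_nonneg hknn, hk, abs_mul, habs, one_mul]
    rw [← this]
    exact h2
  have hc : ∀ u, 0 ≤ max 0 (min u d) ∧ max 0 (min u d) ≤ d := fun u =>
    ⟨le_max_left _ _, max_le hd0.le (min_le_right _ _)⟩
  refine ⟨fun u => k (max 0 (min u d)) + l ^ 2 * (u - max 0 (min u d)), ?_, ?_, ?_, ?_⟩
  · intro u v huv
    have h1 : max 0 (min u d) ≤ max 0 (min v d) := by gcongr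
    have h2 : u - max 0 (min u d) ≤ v - max 0 (min v d) := by
      rcases max_cases 0 (min u d) with h | h <;> rcases max_cases 0 (min v d) with h' | h' <;>
      rcases min_cases u d with h'' | h'' <;> rcases min_cases v d with h3 | h3 <;> linarith
    exact add_le_add (hkmono _ _ (hc u).1 h1 (hc v).2) (mul_le_mul_of_nonneg_left h2 (by positivity))
  · intro u _
    have := (hkb _ (hc u).1 (hc u).2).1
    simp only
    linarith
  · intro u hu
    have h1 := (hkb _ (hc u).1 (hc u).2).2
    have h2 : max 0 (min u d) ≤ u := max_le hu (min_le_left _ _)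
    have h3 : l ^ 2 ≤ L ^ 2 := by gcongr
    simp only
    nlinarith
  · intro u hu hud
    simp only [min_eq_left hud, max_eq_right hu, sub_self, mul_zero, add_zero, hk]
    linear_combination (ζ - F (ζ + σ * u)) * hσ

theorem iterate_sideMap {g : ℝ → ℝ} {d : ℝ} {f : ℝ → ℝ} (hg : ∀ u, 0 ≤ u → u ≤ g u)
    (hgf : ∀ u, 0 ≤ u → u ≤ d → f (ζ + σ * u) = ζ + σ * g u) {u : ℝ} (hu : 0 ≤ u) (i : ℕ) :
    0 ≤ g^[i] u ∧ ((∀ j < i, g^[j] u ≤ d) → f^[i] (ζ + σ * u) = ζ + σ * g^[i] u) := by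
  induction i with
  | zero => exact ⟨hu, fun _ => rfl⟩
  | succ i ih =>
    refine ⟨?_, fun h => ?_⟩
    · rw [Function.iterate_succ_apply']
      exact ih.1.trans (hg _ ih.1)
    · rw [Function.iterate_succ_apply', Function.iterate_succ_apply',
        ih.2 fun j hj => h j (by omega), hgf _ ih.1 (h i (by omega))]

/-- For a small radius `s`, the power `M` for which the orbits starting on one side of the ball of
radius `s` around `ζ` escape to a macroscopic scale, together with the macroscopic branch of
`(Ta a)^[2 * p * M]`. The constants do not depend on `s`. -/
theorem LocalExpansion.exists_escape_branch (ha : 0 < a) (hp : 1 ≤ p)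
    (h : LocalExpansion a ζ p δ l L) (hσ : σ ^ 2 = 1) {c : ℝ} (hc : 0 < c) :
    ∃ δ₀ δ₁ β η : ℝ, 0 < δ₀ ∧ δ₀ ≤ δ ∧ 0 < δ₁ ∧ δ₁ < β ∧ β < δ ∧ 0 < η ∧ ∀ s, 0 < s → s < δ₀ →
    ∃ (M : ℕ) (K : Set ℝ) (b : ℝ), (l ^ 2) ^ M * s ≤ δ ∧ δ₀ / L ^ 2 ≤ (L ^ 2) ^ M * s ∧
      IsPreconnected K ∧ K ⊆ {y | 0 < σ * (y - ζ) ∧ σ * (y - ζ) < δ} ∧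
      K ⊆ Metric.ball ζ (L ^ 2 * s) ∧ {y | 0 < σ * (y - ζ) ∧ σ * (y - ζ) < s} ⊆ K ∧
      (∀ m < p * (2 * M), ∀ x ∈ K, (Ta a)^[m] x ≠ 0) ∧
      (∀ i < 2 * M, ∀ x ∈ K, |(Ta a)^[p * i] x - ζ| < δ) ∧
      (∀ x, c * s ≤ σ * (x - ζ) → σ * (x - ζ) < s →
        δ₁ ≤ σ * ((Ta a)^[p * (2 * M)] x - ζ) ∧ σ * ((Ta a)^[p * (2 * M)] x - ζ) ≤ b) ∧
      b + η ≤ β ∧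
      ∀ y, 0 < σ * (y - ζ) → σ * (y - ζ) < b + η → y ∈ (Ta a)^[p * (2 * M)] '' K := by
  have hl := h.one_lt
  have hlL := h.le
  have hδ := h.pos
  have hL : 1 < L := hl.trans_le hlL
  have hL2 : 1 < L ^ 2 := one_lt_pow₀ hL two_ne_zero
  have hl2 : 1 < l ^ 2 := one_lt_pow₀ hl two_ne_zero
  have hlL2 : l ^ 2 ≤ L ^ 2 := by gcongr
  have habs : |σ| = 1 := by
    rw [← sq_eq_sq₀ (abs_nonneg σ) zero_le_one, sq_abs, hσ, one_pow]
  set d := δ / L / 2 with hd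
  have hd0 : 0 < d := by positivity
  have hdL : d < δ / L := half_lt_self (by positivity)
  have hdδ : d < δ := hdL.trans_le (div_le_self hδ.le hL.le)
  obtain ⟨g, hgm, hgl, hgL, hgf⟩ := h.exists_sideMap ha hσ hd0 hdL
  have hgu : ∀ u, 0 ≤ u → u ≤ g u := fun u hu => by nlinarith [hgl u hu]
  obtain ⟨k, hk⟩ := pow_unbounded_of_one_lt (1 / c) hl2
  set δ₀ := d / L ^ 2 with hδ₀
  have hδ₀0 : 0 < δ₀ := by positivity
  have hLδ₀ : L ^ 2 * δ₀ = d := by rw [hδ₀]; field_simp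
  have hδ₀L : δ₀ / L ^ 2 < δ₀ := div_lt_self hδ₀0 hL2
  have hδ₀L' : L ^ 2 * (δ₀ / L ^ 2) = δ₀ := by field_simp
  have hδ₀l : δ₀ < l ^ 2 * δ₀ := by nlinarith
  have hlδ₀d : l ^ 2 * δ₀ ≤ d := hLδ₀ ▸ mul_le_mul_of_nonneg_right hlL2 hδ₀0.le
  have hδ₀d : δ₀ < d := hδ₀l.trans_le hlδ₀d
  refine ⟨δ₀, δ₀ / L ^ 2 / (L ^ 2) ^ k, l ^ 2 * δ₀, (l ^ 2 - 1) * (δ₀ / L ^ 2), hδ₀0,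
    by linarith, by positivity, ?_, by linarith, mul_pos (by linarith) (by positivity), ?_⟩
  · exact (div_le_self (by positivity) (one_le_pow₀ hL2.le)).trans_lt (hδ₀L.trans hδ₀l)
  intro s hs hsδ
  obtain ⟨M, hM1, hM2⟩ := exists_escape hl2 (by linarith) hgl hgL hs hsδ
  have hit := fun {u : ℝ} (hu : 0 ≤ u) (i : ℕ) =>
    iterate_sideMap (ζ := ζ) (σ := σ) (f := (Ta a)^[2 * p]) hgu hgf hu i
  have hbd := fun (m : ℕ) {u : ℝ} (hu : 0 ≤ u) =>
    iterate_bounds (by linarith) (by linarith) hgl hgL m hu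
  have hgs : 0 < g s := hs.trans_le (hgu s hs.le)
  set b := g^[M] s with hb
  have hbη : b + (l ^ 2 - 1) * (δ₀ / L ^ 2) ≤ l ^ 2 * b := by
    have := mul_le_mul_of_nonneg_left hM1 (sub_nonneg.2 hl2.le)
    linarith
  have hincr : ∀ {u : ℝ}, 0 ≤ u → ∀ i, g^[i] u ≤ g^[i + 1] u := by
    intro u hu i
    rw [Function.iterate_succ_apply']
    exact hgu _ (hit hu i).1
  have hmonoi : ∀ {u : ℝ}, 0 ≤ u → ∀ i j, i ≤ j → g^[i] u ≤ g^[j] u := fun hu i j hij =>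
    monotone_nat_of_le_succ (hincr hu) hij
  have hgb : g b ≤ d := (hgL b (hit hs.le M).1).trans
    (hLδ₀ ▸ mul_le_mul_of_nonneg_left hM2.le (by positivity))
  have hgMs : g^[M] (g s) = g b := by
    rw [hb, ← Function.iterate_succ_apply, Function.iterate_succ_apply']
  -- orbits starting below `g s` stay below `d` up to time `M`
  have hstay : ∀ u, 0 ≤ u → u ≤ g s → ∀ i ≤ M, g^[i] u ≤ d := fun u hu hus i hi =>
    (hmonoi hu i M hi).trans ((hgm.iterate M hus).trans (hgMs.le.trans hgb))
  have hT : ∀ u, 0 ≤ u → u ≤ g s → ∀ i ≤ M, (Ta a)^[p * (2 * i)] (ζ + σ * u) = ζ + σ * g^[i] u := by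
    intro u hu hus i hi
    have := (hit hu i).2 fun j hj => hstay u hu hus j (by omega)
    rwa [← Function.iterate_mul, show 2 * p * i = p * (2 * i) by ring] at this
  have hτ : ∀ u, 0 ≤ u → |(ζ + σ * u) - ζ| = u := fun u hu => by
    rw [add_sub_cancel_left, abs_mul, habs, one_mul, abs_of_nonneg hu]
  have hclose : ∀ u, 0 ≤ u → u ≤ g s → ∀ i < 2 * M, |(Ta a)^[p * i] (ζ + σ * u) - ζ| < δ := by
    intro u hu hus i hi
    have hlt : |(Ta a)^[p * (2 * (i / 2))] (ζ + σ * u) - ζ| < δ / L := by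
      rw [hT u hu hus (i / 2) (by omega), hτ _ (hit hu _).1]
      exact (hstay u hu hus (i / 2) (by omega)).trans_lt hdL
    rcases Nat.mod_two_eq_zero_or_one i with h0 | h1
    · rw [show i = 2 * (i / 2) by omega]
      exact hlt.trans_le (div_le_self hδ.le hL.le)
    · have := (h.iterate_two_mul_bounds hlt).1
      rw [← Function.iterate_add_apply] at this
      rwa [show p * i = p + p * (2 * (i / 2)) by
        conv_lhs => rw [show i = 2 * (i / 2) + 1 by omega]
        ring]
  refine ⟨M, {y | 0 < σ * (y - ζ) ∧ σ * (y - ζ) < g s}, b, ?_, ?_, ?_, ?_, ?_, ?_, ?_, ?_, ?_, ?_, ?_⟩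
  · exact ((hbd M hs.le).1.trans hM2.le).trans (by linarith)
  · exact hM1.trans (hbd M hs.le).2
  · have : {y | 0 < σ * (y - ζ) ∧ σ * (y - ζ) < g s} = (fun u => ζ + σ * u) '' Ioo 0 (g s) := by
      ext y
      constructor
      · rintro ⟨h1, h2⟩
        exact ⟨_, ⟨h1, h2⟩, side_eq hσ y⟩
      · rintro ⟨u, ⟨h1, h2⟩, rfl⟩
        simp only [mem_ofPred_eq, side_mul_self hσ]
        exact ⟨h1, h2⟩
    rw [this]
    exact isPreconnected_Ioo.image _ (by fun_prop)
  · rintro y ⟨h1, h2⟩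
    exact ⟨h1, h2.trans ((hgL s hs.le).trans_lt (lt_of_le_of_lt (hLδ₀ ▸
      mul_le_mul_of_nonneg_left hsδ.le (by positivity)) hdδ))⟩
  · rintro y ⟨h1, h2⟩
    rw [Metric.mem_ball, Real.dist_eq, ← side_eq hσ y, hτ _ h1.le]
    exact h2.trans_le (hgL s hs.le)
  · rintro y ⟨h1, h2⟩
    exact ⟨h1, h2.trans_le (hgu s hs.le)⟩
  · rintro m hm y ⟨h1, h2⟩
    have h3 := hclose _ h1.le h2.le (m / p) (by
      rw [mul_comm] at hm
      exact Nat.div_lt_of_lt_mul (by linarith))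
    rw [side_eq hσ y] at h3
    have := h.ne_zero _ h3 (m % p) (Nat.mod_lt _ hp)
    rwa [← Function.iterate_add_apply, Nat.mod_add_div] at this
  · rintro i hi y ⟨h1, h2⟩
    have := hclose _ h1.le h2.le i hi
    rwa [side_eq hσ y] at this
  · intro x h1 h2
    have hx0 : 0 ≤ σ * (x - ζ) := le_trans (by positivity) h1
    have h3 := hT _ hx0 (h2.le.trans (hgu s hs.le)) M le_rfl
    rw [side_eq hσ x] at h3
    rw [h3, side_mul_self hσ]
    refine ⟨?_, hgm.iterate M h2.le⟩
    have hsk : s ≤ g^[k] (σ * (x - ζ)) := by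
      refine le_trans ?_ (hbd k hx0).1
      rw [div_lt_iff₀ hc] at hk
      have : 0 < (l ^ 2) ^ k := by positivity
      nlinarith
    have h4 : b ≤ g^[k] (g^[M] (σ * (x - ζ))) := by
      rw [← Function.iterate_add_apply, add_comm, Function.iterate_add_apply]
      exact hgm.iterate M hsk
    have h5 := (hbd k (hit hx0 M).1).2
    rw [div_le_iff₀ (by positivity)]
    linarith
  · exact hbη.trans (mul_le_mul_of_nonneg_left hM2.le (by positivity))
  · intro y h1 h2
    set φ : ℝ → ℝ := fun u => σ * ((Ta a)^[p * (2 * M)] (ζ + σ * u) - ζ) with hφ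
    have hφc : Continuous φ := by
      have := (continuous_Ta a).iterate (p * (2 * M))
      fun_prop
    have hφ0 : φ 0 = 0 := by
      have := hT 0 le_rfl hgs.le M le_rfl
      have hg0 : g^[M] 0 = 0 := by
        have := hbd M (le_refl (0 : ℝ))
        simp only [mul_zero] at this
        linarith [this.1, this.2]
      simp only [hφ, this, hg0, side_mul_self hσ]
    have hφ1 : φ (g s) = g b := by
      simp only [hφ, hT _ hgs.le le_rfl M le_rfl, side_mul_self hσ, hgMs]
    have hmem : σ * (y - ζ) ∈ Ioo (φ 0) (φ (g s)) := by
      rw [hφ0, hφ1]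
      refine ⟨h1, h2.trans_le ?_⟩
      exact hbη.trans (hgl b (hit hs.le M).1)
    obtain ⟨u, ⟨hu0, hu1⟩, hu⟩ := intermediate_value_Ioo hgs.le hφc.continuousOn hmem
    refine ⟨ζ + σ * u, ?_, ?_⟩
    · simp only [mem_ofPred_eq, side_mul_self hσ]
      exact ⟨hu0, hu1⟩
    · rw [← side_eq hσ y, ← hu, hφ]
      simp only
      rw [side_eq hσ]

end Escape

section Tubes

variable {a ζ δ l L σ s : ℝ} {p : ℕ}

/-- The points whose orbit under `(Ta a)^[p]` stays within distance `s` of `ζ` up to time `k`. -/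
def tube (a ζ : ℝ) (p : ℕ) (s : ℝ) (k : ℕ) : Set ℝ := {x | ∀ i ≤ k, |(Ta a)^[p * i] x - ζ| < s}

theorem tube_zero : tube a ζ p s 0 = Metric.ball ζ s := by
  ext x
  simp [tube, Real.dist_eq]

theorem tube_succ_subset (k : ℕ) : tube a ζ p s (k + 1) ⊆ tube a ζ p s k :=
  fun _ hx i hi => hx i (by omega)

theorem tube_subset_ball (k : ℕ) : tube a ζ p s k ⊆ Metric.ball ζ s := fun x hx => by
  simpa [Real.dist_eq] using hx 0 (Nat.zero_le k)

theorem measurableSet_tube (k : ℕ) : MeasurableSet (tube a ζ p s k) := by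
  have : tube a ζ p s k = ⋂ i ∈ Iic k, {x | |(Ta a)^[p * i] x - ζ| < s} := by
    ext x; simp [tube]
  rw [this]
  refine MeasurableSet.biInter (to_countable _) fun i _ => measurableSet_lt ?_ measurable_const
  have := (continuous_Ta a).iterate (p * i)
  exact (by fun_prop : Continuous fun x => |(Ta a)^[p * i] x - ζ|).measurable

theorem iterate_mem_tube {x : ℝ} {k : ℕ} (hx : x ∈ tube a ζ p s (k + 1)) :
    (Ta a)^[p] x ∈ tube a ζ p s k := fun i hi => by
  rw [← Function.iterate_add_apply, show p * i + p = p * (i + 1) by ring]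
  exact hx (i + 1) (by omega)

theorem mem_tube_succ {x : ℝ} {k : ℕ} :
    x ∈ tube a ζ p s (k + 1) ↔ |x - ζ| < s ∧ (Ta a)^[p] x ∈ tube a ζ p s k := by
  refine ⟨fun h => ⟨by simpa using h 0 (Nat.zero_le _), iterate_mem_tube h⟩, fun h i hi => ?_⟩
  cases i with
  | zero => simpa using h.1
  | succ i =>
    have := h.2 i (by omega)
    rwa [← Function.iterate_add_apply, show p * i + p = p * (i + 1) by ring] at this

theorem LocalExpansion.mem_tube_of_mem_uIcc (ha : 0 < a) (h : LocalExpansion a ζ p δ l L)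
    (hs : s ≤ δ) (k : ℕ) : ∀ {x y : ℝ}, x ∈ tube a ζ p s k → y ∈ uIcc ζ x → y ∈ tube a ζ p s k := by
  have hsub : ∀ {x y : ℝ}, |x - ζ| < s → y ∈ uIcc ζ x → |y - ζ| < s := fun hx hy =>
    (abs_sub_left_of_mem_uIcc hy).trans_lt hx
  induction k with
  | zero =>
    intro x y hx hy
    rw [tube_zero, Metric.mem_ball, Real.dist_eq] at hx ⊢
    exact hsub hx hy
  | succ k ih =>
    intro x y hx hy
    rw [mem_tube_succ] at hx ⊢
    refine ⟨hsub hx.1 hy, ih hx.2 ?_⟩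
    have hball : uIcc ζ x ⊆ Metric.ball ζ δ := fun z hz => by
      rw [Metric.mem_ball, Real.dist_eq]
      exact (hsub hx.1 hz).trans_le hs
    have : (Ta a)^[p] y ∈ uIcc ((Ta a)^[p] ζ) ((Ta a)^[p] x) := by
      rcases monotoneOn_or_antitoneOn_iterate_Ta ha p (convex_ball ζ δ).isPreconnected
        (fun m hm x hx => h.ne_zero x (by rwa [Metric.mem_ball, Real.dist_eq] at hx) m hm)
        with hm | hm
      · exact (hm.mono hball).image_uIcc_subset ⟨y, hy, rfl⟩
      · exact (hm.mono hball).image_uIcc_subset ⟨y, hy, rfl⟩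
    rwa [h.fixed] at this

theorem LocalExpansion.isPreconnected_tube_sdiff (ha : 0 < a) (h : LocalExpansion a ζ p δ l L)
    (hσ : σ ^ 2 = 1) (hs : s ≤ δ) (k : ℕ) :
    IsPreconnected ((tube a ζ p s k \ tube a ζ p s (k + 1)) ∩ {y | 0 < σ * (y - ζ)}) := by
  have key : ∀ {k : ℕ} {x y : ℝ}, x ∈ tube a ζ p s k → 0 < σ * (y - ζ) →
      σ * (y - ζ) ≤ σ * (x - ζ) → y ∈ tube a ζ p s k := by
    intro k x y hx h1 h2
    refine h.mem_tube_of_mem_uIcc ha hs k hx ?_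
    rw [mem_uIcc_side (ζ := ζ) hσ, mem_uIcc]
    left
    simpa using ⟨h1.le, h2⟩
  refine (OrdConnected.mk fun x hx y hy z hz => ?_ : OrdConnected _).isPreconnected
  have hz' := (mem_uIcc_side (ζ := ζ) hσ).1 (Icc_subset_uIcc hz)
  rw [mem_uIcc] at hz'
  rcases hz' with hz' | hz'
  · have h0 : 0 < σ * (z - ζ) := lt_of_lt_of_le hx.2 hz'.1
    exact ⟨⟨key hy.1.1 h0 hz'.2, fun hc => hx.1.2 (key hc hx.2 hz'.1)⟩, h0⟩
  · have h0 : 0 < σ * (z - ζ) := lt_of_lt_of_le hy.2 hz'.1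
    exact ⟨⟨key hx.1.1 h0 hz'.2, fun hc => hy.1.2 (key hc hy.2 hz'.1)⟩, h0⟩

theorem LocalExpansion.le_of_notMem_tube (h : LocalExpansion a ζ p δ l L) (hs : s ≤ δ)
    (k : ℕ) : ∀ {x : ℝ}, x ∉ tube a ζ p s k → s ≤ L ^ k * |x - ζ| := by
  have hL : 1 < L := h.one_lt.trans_le h.le
  induction k with
  | zero =>
    intro x hx
    simpa [tube_zero, Real.dist_eq] using hx
  | succ k ih =>
    intro x hx
    rw [mem_tube_succ, not_and_or] at hx
    by_cases hxs : |x - ζ| < s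
    · have h1 := ih (hx.resolve_left (not_not.2 hxs))
      have h2 := h.upper x (hxs.trans_le hs)
      rw [pow_succ, mul_assoc]
      exact h1.trans (mul_le_mul_of_nonneg_left h2 (by positivity))
    · exact (not_lt.1 hxs).trans (le_mul_of_one_le_left (abs_nonneg _) (one_le_pow₀ hL.le))

theorem numVisits_add {X : Type*} (T : X → X) (B : Set X) (M N : ℕ) : ∀ x,
    numVisits T B (M + N) x = numVisits T B M x + numVisits T B N (T^[M] x) := by
  induction M with
  | zero => intro x; simp [numVisits]
  | succ M ih =>
    intro x
    rw [show M + 1 + N = (M + N) + 1 by ring, numVisits, numVisits, ih, Function.iterate_succ_apply,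
      add_assoc]

theorem numVisits_eq_zero {X : Type*} (T : X → X) (B : Set X) (N : ℕ) : ∀ x,
    (∀ j, 0 < j → j ≤ N → T^[j] x ∉ B) → numVisits T B N x = 0 := by
  induction N with
  | zero => intro x _; rfl
  | succ N ih =>
    intro x hx
    rw [numVisits, if_neg (show T x ∉ B from hx 1 one_pos (by omega)), ih, add_zero]
    intro j hj hjN
    rw [← Function.iterate_succ_apply]
    exact hx (j + 1) (by omega) (by omega)

open Classical in
theorem LocalExpansion.numVisits_period (h : LocalExpansion a ζ p δ l L) (hp : 1 ≤ p) (hs : s ≤ δ)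
    {x : ℝ} (hx : |x - ζ| < δ) :
    numVisits (Ta a) (Metric.ball ζ s) p x = if |(Ta a)^[p] x - ζ| < s then 1 else 0 := by
  obtain ⟨q, rfl⟩ := Nat.exists_eq_add_of_le' hp
  rw [numVisits_add, numVisits_eq_zero, zero_add, numVisits, numVisits,
    ← Function.iterate_succ_apply' (Ta a), Metric.mem_ball, Real.dist_eq, add_zero]
  intro j hj hjq
  rw [Metric.mem_ball, Real.dist_eq, not_lt]
  exact hs.trans (h.far x hx j hj (by omega))

theorem LocalExpansion.numVisits_eq (h : LocalExpansion a ζ p δ l L) (hp : 1 ≤ p)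
    (hs : s ≤ δ) (I : ℕ) : ∀ (k : ℕ) {x : ℝ}, x ∈ tube a ζ p s k → k ≤ I →
    (k < I → x ∉ tube a ζ p s (k + 1)) → (∀ i < I, |(Ta a)^[p * i] x - ζ| < δ) →
    numVisits (Ta a) (Metric.ball ζ s) (p * I) x = k := by
  classical
  induction I with
  | zero =>
    intro k x _ hk _ _
    rw [Nat.le_zero.1 hk]; rfl
  | succ I ih =>
    intro k x hx hk hx' hclose
    have hxδ : |x - ζ| < δ := by simpa using hclose 0 (by omega)
    have hclose' : ∀ i < I, |(Ta a)^[p * i] ((Ta a)^[p] x) - ζ| < δ := fun i hi => by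
      rw [← Function.iterate_add_apply, show p * i + p = p * (i + 1) by ring]
      exact hclose (i + 1) (by omega)
    rw [mul_add, mul_one, add_comm, numVisits_add, h.numVisits_period hp hs hxδ]
    cases k with
    | zero =>
      have h1 : s ≤ |(Ta a)^[p] x - ζ| := by
        have h2 := hx' (by omega)
        rw [mem_tube_succ, not_and_or, tube_zero, Metric.mem_ball, Real.dist_eq] at h2
        rw [tube_zero, Metric.mem_ball, Real.dist_eq] at hx
        exact not_lt.1 (h2.resolve_left (not_not.2 hx))
      rw [if_neg (not_lt.2 h1), zero_add]
      clear ih hx hx' hk hclose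
      generalize (Ta a)^[p] x = y at *
      induction I generalizing y with
      | zero => rfl
      | succ I ih =>
        have hyδ : |y - ζ| < δ := by simpa using hclose' 0 (by omega)
        have h2 : s ≤ |(Ta a)^[p] y - ζ| :=
          h1.trans ((le_mul_of_one_le_left (abs_nonneg _) h.one_lt.le).trans (h.lower y hyδ))
        rw [mul_add, mul_one, add_comm, numVisits_add, h.numVisits_period hp hs hyδ,
          if_neg (not_lt.2 h2), zero_add]
        refine ih _ (fun i hi => ?_) h2
        rw [← Function.iterate_add_apply, show p * i + p = p * (i + 1) by ring]
        exact hclose' (i + 1) (by omega)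
    | succ k =>
      have h1 : |(Ta a)^[p] x - ζ| < s := by simpa using hx 1 (by omega)
      rw [if_pos h1, ih k (iterate_mem_tube hx) (by omega) (fun hk hc => hx' (by omega)
        (mem_tube_succ.2 ⟨by simpa using hx 0 (by omega), hc⟩)) hclose', add_comm]

theorem LocalExpansion.mem_tube_of_iterate (h : LocalExpansion a ζ p δ l L) (k : ℕ) :
    ∀ {x : ℝ}, L ^ k * |x - ζ| < δ → |(Ta a)^[p * k] x - ζ| < s → x ∈ tube a ζ p s k := by
  have hL : 1 < L := h.one_lt.trans_le h.le
  induction k with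
  | zero =>
    intro x _ hx
    simpa [tube_zero, Real.dist_eq] using hx
  | succ k ih =>
    intro x h1 h2
    have hxδ : |x - ζ| < δ :=
      (le_mul_of_one_le_left (abs_nonneg _) (one_le_pow₀ hL.le)).trans_lt h1
    have h3 : (Ta a)^[p] x ∈ tube a ζ p s k := by
      refine ih (lt_of_le_of_lt ?_ h1) ?_
      · rw [pow_succ, mul_assoc]
        exact mul_le_mul_of_nonneg_left (h.upper x hxδ) (by positivity)
      · rwa [← Function.iterate_add_apply, show p * k + p = p * (k + 1) by ring]
    refine mem_tube_succ.2 ⟨?_, h3⟩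
    have h4 := h3 0 (Nat.zero_le _)
    simp only [mul_zero, Function.iterate_zero, id_eq] at h4
    exact ((le_mul_of_one_le_left (abs_nonneg _) h.one_lt.le).trans (h.lower x hxδ)).trans_lt h4

theorem tendsto_measureReal_tube {μ : Measure ℝ} [IsFiniteMeasure μ] {Q D : ℝ}
    (h : LocalExpansion a ζ p δ l L) (hD : HasDerivAt ((Ta a)^[p]) D ζ) (hD0 : D ≠ 0)
    (hQ : MassLim μ ζ Q) (k : ℕ) :
    Tendsto (fun s => μ.real (tube a ζ p s k) / √s) (𝓝[>] 0) (𝓝 (Q * √(|D| ^ k)⁻¹)) := by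
  have hL : 1 < L := h.one_lt.trans_le h.le
  set A := |D| ^ k with hA
  have hA0 : 0 < A := pow_pos (abs_pos.2 hD0) k
  have hk := hD.iterate ζ h.fixed k
  rw [← Function.iterate_mul] at hk
  have hfix : (Ta a)^[p * k] ζ = ζ := by
    rw [Function.iterate_mul, Function.iterate_fixed h.fixed]
  have hder : ∀ e > 0, ∀ᶠ s in 𝓝[>] (0 : ℝ), ∀ x, |x - ζ| < s →
      |(Ta a)^[p * k] x - ζ| ≤ (A + e) * |x - ζ| ∧ (A - e) * |x - ζ| ≤ |(Ta a)^[p * k] x - ζ| := by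
    intro e he
    obtain ⟨ε, hε, hx⟩ := Metric.eventually_nhds_iff.1 ((hasDerivAt_iff_isLittleO.1 hk).def he)
    filter_upwards [Ioo_mem_nhdsGT hε] with s hs x hxs
    have h1 := hx (y := x) (by rw [Real.dist_eq]; exact hxs.trans hs.2)
    rw [hfix, smul_eq_mul, Real.norm_eq_abs, Real.norm_eq_abs] at h1
    have h2 := abs_sub_abs_le_abs_sub ((Ta a)^[p * k] x - ζ) ((x - ζ) * D ^ k)
    have h3 := abs_sub_abs_le_abs_sub ((x - ζ) * D ^ k) ((Ta a)^[p * k] x - ζ)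
    rw [abs_sub_comm ((x - ζ) * D ^ k)] at h3
    rw [abs_mul, abs_pow, ← hA] at h2 h3
    constructor <;> linarith
  have hmass : ∀ A', 0 < A' → Tendsto (fun s => μ.real (Metric.ball ζ (s / A')) / √s) (𝓝[>] 0)
      (𝓝 (Q * √A'⁻¹)) := by
    intro A' hA'
    refine tendsto_comp_div_sqrt (g := fun s => μ.real (Metric.ball ζ s)) (t := fun s => s / A')
      (inv_pos.2 hA') hQ ?_
    refine tendsto_const_nhds.congr' ?_
    filter_upwards [self_mem_nhdsWithin] with s hs
    have hs : 0 < s := hs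
    field_simp
  have hcont : Tendsto (fun e : ℝ => Q * √(A + e)⁻¹) (𝓝 0) (𝓝 (Q * √A⁻¹)) := by
    have : ContinuousAt (fun e : ℝ => Q * √(A + e)⁻¹) 0 := by
      refine ContinuousAt.mul continuousAt_const (Real.continuous_sqrt.continuousAt.comp ?_)
      exact ContinuousAt.inv₀ (by fun_prop) (by simpa using hA0.ne')
    simpa using this.tendsto
  have hcont' : Tendsto (fun e : ℝ => Q * √(A - e)⁻¹) (𝓝 0) (𝓝 (Q * √A⁻¹)) := by
    have := hcont.comp (show Tendsto (fun e : ℝ => -e) (𝓝 0) (𝓝 0) by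
      simpa using (continuous_neg (G := ℝ)).tendsto 0)
    simpa [Function.comp_def, sub_eq_add_neg] using this
  have hsmall : ∀ c > 0, ∀ᶠ s in 𝓝[>] (0 : ℝ), s < c := fun c hc =>
    nhdsWithin_le_nhds (Iio_mem_nhds hc)
  refine tendsto_order.2 ⟨fun v hv => ?_, fun v hv => ?_⟩
  · obtain ⟨e, he1, he⟩ := (((hcont.mono_left nhdsWithin_le_nhds).eventually_const_lt hv).and
      (self_mem_nhdsWithin (s := Ioi (0 : ℝ)))).exists
    have he : 0 < e := he
    obtain ⟨ε, hε1, hε⟩ := ((hder e he).and (self_mem_nhdsWithin (s := Ioi (0 : ℝ)))).exists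
    have hε : 0 < ε := hε
    filter_upwards [(hmass (A + e) (by positivity)).eventually_const_lt he1, self_mem_nhdsWithin,
      hsmall (ε * (A + e)) (by positivity), hsmall (δ / L ^ k * (A + e))
        (by have := h.pos; positivity)] with s h1 hs h2 h3
    have hs : 0 < s := hs
    refine h1.trans_le ?_
    gcongr
    · finiteness
    intro x hx
    rw [Metric.mem_ball, Real.dist_eq] at hx
    refine h.mem_tube_of_iterate k ?_ ?_
    · have : |x - ζ| < δ / L ^ k := hx.trans (by rwa [div_lt_iff₀ (by positivity)])
      rwa [lt_div_iff₀ (by positivity), mul_comm] at this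
    · refine (hε1 x (hx.trans (by rwa [div_lt_iff₀ (by positivity)]))).1.trans_lt ?_
      rwa [lt_div_iff₀ (by positivity), mul_comm] at hx
  · obtain ⟨e, he1, he⟩ := (((hcont'.mono_left nhdsWithin_le_nhds).eventually_lt_const hv).and
      (Ioo_mem_nhdsGT hA0)).exists
    have hAe : 0 < A - e := sub_pos.2 he.2
    filter_upwards [(hmass (A - e) hAe).eventually_lt_const he1, self_mem_nhdsWithin,
      hder e he.1] with s h1 hs h2
    have hs : 0 < s := hs
    refine lt_of_le_of_lt ?_ h1
    gcongr
    · finiteness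
    intro x hx
    have hx0 := tube_subset_ball k hx
    rw [Metric.mem_ball, Real.dist_eq] at hx0 ⊢
    rw [lt_div_iff₀ hAe, mul_comm]
    exact (h2 x hx0).2.trans_lt (hx k le_rfl)

end Tubes

section Clusters

theorem one_sub_expNeg_pow_le {c : ℝ≥0∞} (hc : c ≠ ⊤) (m : ℕ) : 1 - expNeg c ^ m ≤ m * c.toReal := by
  rw [expNeg_of_ne_top hc, ← Real.exp_nat_mul]
  have := Real.add_one_le_exp ((m : ℝ) * -c.toReal)
  linarith

theorem abs_procLap_sub_le {X : Type*} (T : X → X) (B : Set X) {c : ℝ≥0∞} (hc : c ≠ ⊤)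
    (ks : List ℕ) {N k : ℕ} {x : X} (hk : numVisits T B N x = k) :
    |procLap T B c ks x - procLap T B c (ks.drop k) (T^[N] x)| ≤ (N * ks.sum : ℕ) * c.toReal := by
  have h := procLap_bounds T B c ks N x
  rw [hk] at h
  have h1 := one_sub_expNeg_pow_le hc (N * ks.sum)
  have h2 := procLap_nonneg T B c (ks.drop k) (T^[N] x)
  have h3 := procLap_le_one T B c (ks.drop k) (T^[N] x)
  have h4 : expNeg c ^ (N * ks.sum) ≤ 1 := pow_le_one₀ (expNeg_nonneg c) (expNeg_le_one c)
  rw [abs_le]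
  constructor <;> nlinarith

theorem tendsto_escapeTime_mul {q δ : ℝ} (hq : 1 < q) {r m : ℕ → ℝ} {M : ℕ → ℕ}
    (hrpos : ∀ n, 0 < r n) (hr : Tendsto r atTop (𝓝 0)) {Q : ℝ}
    (hm : Tendsto (fun n => m n / √(r n)) atTop (𝓝 Q))
    (hM : ∀ᶠ n in atTop, q ^ M n * r n ≤ δ) : Tendsto (fun n => M n * m n) atTop (𝓝 0) := by
  have hr' : Tendsto r atTop (𝓝[>] 0) :=
    tendsto_nhdsWithin_iff.2 ⟨hr, Eventually.of_forall hrpos⟩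
  have hsq : Tendsto (fun n => √(r n)) atTop (𝓝 0) := by
    simpa [Function.comp_def] using (Real.continuous_sqrt.tendsto 0).comp hr
  have hlog : Tendsto (fun n => Real.log (r n) * √(r n)) atTop (𝓝 0) := by
    have := (tendsto_log_mul_rpow_nhdsGT_zero (show (0 : ℝ) < 1 / 2 by norm_num)).comp hr'
    simpa only [Function.comp_def, ← Real.sqrt_eq_rpow] using this
  have hlogq : 0 < Real.log q := Real.log_pos hq
  have hbound : Tendsto (fun n => (Real.log δ * √(r n) - Real.log (r n) * √(r n)) / Real.log q)
      atTop (𝓝 0) := by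
    simpa using ((hsq.const_mul (Real.log δ)).sub hlog).div_const (Real.log q)
  have hMr : Tendsto (fun n => M n * √(r n)) atTop (𝓝 0) := by
    refine squeeze_zero' (Eventually.of_forall fun n => by positivity) ?_ hbound
    filter_upwards [hM] with n hn
    have h1 := Real.log_le_log (mul_pos (by positivity) (hrpos n)) hn
    rw [Real.log_mul (by positivity) (hrpos n).ne', Real.log_pow] at h1
    rw [le_div_iff₀ hlogq]
    nlinarith [Real.sqrt_nonneg (r n)]
  have := hMr.mul hm
  rw [zero_mul] at this
  refine this.congr fun n => ?_
  have := Real.sqrt_pos.2 (hrpos n)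
  field_simp

variable {a ζ δ l L σ Q : ℝ} {p : ℕ} {H : ℝ → ℝ≥0∞}

theorem tendsto_ball_scale {μ : Measure ℝ} (hQ0 : 0 < Q) (hQ : MassLim μ ζ Q) {A : ℝ} (hA : 0 < A)
    {r : ℕ → ℝ} (hr : Tendsto r atTop (𝓝[>] 0)) :
    Tendsto (fun n => μ.real (Metric.ball ζ (A * r n)) / μ.real (Metric.ball ζ (r n))) atTop
      (𝓝 √A) := by
  have h1 : Tendsto (fun s => μ.real (Metric.ball ζ (A * s)) / √s) (𝓝[>] 0) (𝓝 (Q * √A)) := by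
    refine tendsto_comp_div_sqrt (g := fun s => μ.real (Metric.ball ζ s)) (t := fun s => A * s)
      hA hQ (tendsto_const_nhds.congr' ?_)
    filter_upwards [self_mem_nhdsWithin] with s hs
    have hs : 0 < s := hs
    field_simp
  have h2 := ((h1.comp hr).div (hQ.comp hr) hQ0.ne')
  rw [mul_div_cancel_left₀ _ hQ0.ne'] at h2
  refine h2.congr' ?_
  filter_upwards [hr self_mem_nhdsWithin] with n hn
  have hn : 0 < r n := hn
  have := Real.sqrt_pos.2 hn
  simp only [Pi.div_apply, Function.comp_apply]
  field_simp

/-- On one side of `ζ`, the points making exactly `k` further consecutive visits to the ball decouple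
from the remaining part of the process. -/
theorem tendsto_procLap_side (ha : 0 < a) (hp : 1 ≤ p) (hHm : Measurable H)
    [IsProbabilityMeasure (volume.withDensity H)] (hErg : Ergodic (Ta a) (volume.withDensity H))
    (h : LocalExpansion a ζ p δ l L) (hσ : σ ^ 2 = 1)
    (hH : Harnack H {y | 0 < σ * (y - ζ) ∧ σ * (y - ζ) < δ}) (hQ0 : 0 < Q)
    (hQ : MassLim (volume.withDensity H) ζ Q) {r : ℕ → ℝ} (hr : Tendsto r atTop (𝓝[>] 0))
    (hrpos : ∀ n, 0 < r n) {μ : Measure ℝ} (hμ : μ = volume.withDensity H)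
    (ks : List ℕ) (k : ℕ) :
    Tendsto (fun n => (∫ x in (tube a ζ p (r n) k \ tube a ζ p (r n) (k + 1)) ∩
        {y | 0 < σ * (y - ζ)},
        (procLap (Ta a) (Metric.ball ζ (r n)) (μ (Metric.ball ζ (r n))) ks x - ∫ y, procLap (Ta a)
          (Metric.ball ζ (r n)) (μ (Metric.ball ζ (r n))) (ks.drop k) y ∂μ) ∂μ) /
        μ.real (Metric.ball ζ (r n))) atTop (𝓝 0) := by
  rw [← hμ] at hErg hQ
  have hprob : IsProbabilityMeasure μ := hμ ▸ inferInstance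
  have hL : 1 < L := h.one_lt.trans_le h.le
  have hr0 : Tendsto r atTop (𝓝 0) := tendsto_nhds_of_tendsto_nhdsWithin hr
  have habs : |σ| = 1 := by
    rw [← sq_eq_sq₀ (abs_nonneg σ) zero_le_one, sq_abs, hσ, one_pow]
  set B : ℕ → Set ℝ := fun n => Metric.ball ζ (r n) with hB
  have hBm : ∀ n, MeasurableSet (B n) := fun n => Metric.isOpen_ball.measurableSet
  set U : ℕ → Set ℝ := fun n => (tube a ζ p (r n) k \ tube a ζ p (r n) (k + 1)) ∩
    {y | 0 < σ * (y - ζ)} with hU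
  have hUB : ∀ n, U n ⊆ B n := fun n x hx => tube_subset_ball k hx.1.1
  have hlim : Tendsto (fun n => μ.real (B n) / √(r n)) atTop (𝓝 Q) := hQ.comp hr
  have hpos : ∀ᶠ n in atTop, 0 < μ.real (B n) := by
    filter_upwards [hlim.eventually_const_lt hQ0] with n hn
    have := Real.sqrt_pos.2 (hrpos n)
    exact (div_pos_iff_of_pos_right this).1 hn
  have hc : Tendsto (fun n => μ.real (B n)) atTop (𝓝 0) := by
    have h1 : Tendsto (fun n => √(r n)) atTop (𝓝 0) := by
      simpa [Function.comp_def] using (Real.continuous_sqrt.tendsto 0).comp hr0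
    have h2 := hlim.mul h1
    rw [mul_zero] at h2
    refine h2.congr fun n => div_mul_cancel₀ _ (Real.sqrt_pos.2 (hrpos n)).ne'
  obtain ⟨δ₀, δ₁, β, η, hδ₀, hδ₀δ, hδ₁, hβ, hβδ, hη, hesc⟩ :=
    h.exists_escape_branch ha hp hσ (c := (L ^ (k + 1))⁻¹) (by positivity)
  have hesc' : ∀ n, ∃ (M : ℕ) (K : Set ℝ) (b : ℝ), r n < δ₀ → _ := fun n => by
    by_cases hn : r n < δ₀
    · obtain ⟨M, K, b, hh⟩ := hesc (r n) (hrpos n) hn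
      exact ⟨M, K, b, fun _ => hh⟩
    · exact ⟨0, ∅, 0, fun h => absurd h hn⟩
  choose M K b hMKb using hesc'
  have hsmall : ∀ᶠ n in atTop, r n < δ₀ := hr0.eventually_lt_const hδ₀
  have hMc : Tendsto (fun n => (M n : ℝ) * μ.real (B n)) atTop (𝓝 0) :=
    tendsto_escapeTime_mul (one_lt_pow₀ h.one_lt two_ne_zero) hrpos hr0 hlim
      (hsmall.mono fun n hn => (hMKb n hn).1)
  have hkM : ∀ᶠ n in atTop, k < 2 * M n := by
    have hlt : ∀ᶠ n in atTop, r n < δ₀ / L ^ 2 / (L ^ 2) ^ k :=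
      hr0.eventually_lt_const (by positivity)
    filter_upwards [hsmall, hlt] with n hn hn'
    have h1 := (hMKb n hn).2.1
    by_contra! hle
    have h2 : (L ^ 2) ^ M n ≤ (L ^ 2) ^ k :=
      pow_le_pow_right₀ (one_le_pow₀ hL.le) (by omega)
    rw [lt_div_iff₀ (by positivity), mul_comm] at hn'
    have := mul_le_mul_of_nonneg_right h2 (hrpos n).le
    linarith
  set G : ℕ → ℝ → ℝ := fun n => procLap (Ta a) (B n) (μ (B n)) (ks.drop k) with hG
  have hGi : ∀ n, Measurable (G n) := fun n =>
    measurable_procLap _ _ _ (measurable_Ta a) (hBm n) _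
  have hGT := procLap_almost_invariant hErg.toMeasurePreserving hBm hc (ks.drop k)
  have hKB : ∀ᶠ n in atTop, μ.real (K n) ≤ (√(L ^ 2) + 1) * μ.real (B n) := by
    filter_upwards [(tendsto_ball_scale hQ0 hQ (A := L ^ 2) (by positivity) hr).eventually_lt_const
      (lt_add_one _), hpos, hsmall] with n h1 h2 h3
    rw [div_lt_iff₀ h2] at h1
    exact (measureReal_mono (hMKb n h3).2.2.2.2.1).trans h1.le
  have hC : 0 < √(L ^ 2) + 1 := by positivity
  rw [Metric.tendsto_nhds]
  intro ε hε
  have hpush := push_interval_independence (σ := σ) (ζ := ζ) ha hHm (hμ ▸ hErg) hGi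
    (fun n => procLap_nonneg _ _ _ _) (fun n => procLap_le_one _ _ _ _) (hμ ▸ hGT) hσ hδ₁ hβ hβδ hη hH
    (show 0 < ε / 2 / (√(L ^ 2) + 1) by positivity)
  rw [← hμ] at hpush
  have hMε := hMc.mul_const ((p * 2 * ks.sum : ℕ) : ℝ)
  rw [zero_mul] at hMε
  filter_upwards [hpush,
    hMε.eventually_lt_const (half_pos hε), hKB, hkM, hsmall, hpos] with n hn1 hn2 hn3 hn4 hn5 hn6
  obtain ⟨-, -, hKc, hKδ, -, hsub, hne, hclose, hfar, hbη, himg⟩ := hMKb n hn5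
  have hUσ : ∀ x ∈ U n, (L ^ (k + 1))⁻¹ * r n ≤ σ * (x - ζ) ∧ σ * (x - ζ) < r n := by
    intro x hx
    have h1 : |x - ζ| = σ * (x - ζ) := by
      rw [← abs_of_pos (show 0 < σ * (x - ζ) from hx.2), abs_mul, habs, one_mul]
    have h2 := h.le_of_notMem_tube (hn5.le.trans hδ₀δ) (k + 1) hx.1.2
    have h3 := hUB n hx
    rw [hB, Metric.mem_ball, Real.dist_eq, h1] at h3
    rw [h1] at h2
    exact ⟨by rwa [inv_mul_le_iff₀ (by positivity)], h3⟩
  have hUK : U n ⊆ K n := fun x hx => hsub ⟨hx.2, (hUσ x hx).2⟩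
  have key := hn1 (p * (2 * M n)) (K n) (U n) (b n) hKc hKδ hne (injOn_iterate_Ta ha _ hKc hne) hUK
    (h.isPreconnected_tube_sdiff ha hσ (hn5.le.trans hδ₀δ) k)
    (fun x hx => hfar x (hUσ x hx).1 (hUσ x hx).2) hbη himg
  set J := ∫ y, G n y ∂μ with hJ
  have hvis : ∀ x ∈ U n, numVisits (Ta a) (B n) (p * (2 * M n)) x = k := fun x hx =>
    h.numVisits_eq hp (hn5.le.trans hδ₀δ) (2 * M n) k hx.1.1 hn4.le (fun _ => hx.1.2)
      fun i hi => hclose i hi x (hUK hx)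
  have hi1 : IntegrableOn (procLap (Ta a) (B n) (μ (B n)) ks) (U n) μ :=
    (integrable_procLap (measurable_Ta a) (hBm n) _ _).integrableOn
  have hi2 : IntegrableOn (fun x => G n ((Ta a)^[p * (2 * M n)] x)) (U n) μ :=
    (integrable_of_mem_unit ((hGi n).comp ((measurable_Ta a).iterate _))
      (fun x => procLap_nonneg _ _ _ _ _) (fun x => procLap_le_one _ _ _ _ _)).integrableOn
  have hiJ : IntegrableOn (fun _ => J) (U n) μ := (integrable_const J).integrableOn
  have hsplit : ∫ x in U n, (procLap (Ta a) (B n) (μ (B n)) ks x - J) ∂μ =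
      ∫ x in U n, (procLap (Ta a) (B n) (μ (B n)) ks x - G n ((Ta a)^[p * (2 * M n)] x)) ∂μ +
      ∫ x in U n, (G n ((Ta a)^[p * (2 * M n)] x) - J) ∂μ := by
    refine Eq.trans (integral_congr_ae (ae_of_all _ fun x => ?_))
      (integral_add (hi1.sub hi2) (hi2.sub hiJ))
    simp only
    ring
  have hfirst : |∫ x in U n, (procLap (Ta a) (B n) (μ (B n)) ks x -
      G n ((Ta a)^[p * (2 * M n)] x)) ∂μ| ≤
      (p * (2 * M n) * ks.sum : ℕ) * μ.real (B n) * μ.real (U n) := by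
    rw [← Real.norm_eq_abs]
    refine norm_setIntegral_le_of_norm_le_const (measure_lt_top _ _) fun x hx => ?_
    exact abs_procLap_sub_le (Ta a) (B n) (measure_ne_top μ _) ks (hvis x hx)
  have hUB' : μ.real (U n) ≤ μ.real (B n) := measureReal_mono (hUB n)
  have hfirst' : ((p * (2 * M n) * ks.sum : ℕ) : ℝ) * μ.real (B n) < ε / 2 := by
    refine lt_of_eq_of_lt ?_ hn2
    push_cast
    ring
  rw [Real.dist_0_eq_abs, abs_div, abs_of_pos hn6, div_lt_iff₀ hn6]
  change |∫ x in U n, (procLap (Ta a) (B n) (μ (B n)) ks x - J) ∂μ| < _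
  rw [hsplit]
  calc _ ≤ _ := abs_add_le _ _
    _ ≤ (p * (2 * M n) * ks.sum : ℕ) * μ.real (B n) * μ.real (B n) +
        ε / 2 / (√(L ^ 2) + 1) * ((√(L ^ 2) + 1) * μ.real (B n)) := by
      refine add_le_add (hfirst.trans ?_) (key.trans ?_)
      · exact mul_le_mul_of_nonneg_left hUB' (by positivity)
      · exact mul_le_mul_of_nonneg_left hn3 (by positivity)
    _ < ε / 2 * μ.real (B n) + ε / 2 * μ.real (B n) := by
      refine add_lt_add_of_lt_of_le (mul_lt_mul_of_pos_right hfirst' hn6) (le_of_eq ?_)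
      field_simp
    _ = ε * μ.real (B n) := by ring

end Clusters

section Assembly

variable {a ζ δ l L Q : ℝ} {p : ℕ} {H : ℝ → ℝ≥0∞} {μ : Measure ℝ}

theorem LocalExpansion.mem_tube (h : LocalExpansion a ζ p δ l L) {s : ℝ} (hs : 0 < s) (k : ℕ) :
    ζ ∈ tube a ζ p s k := fun i _ => by
  have hfix : Function.IsFixedPt ((Ta a)^[p])^[i] ζ :=
    Function.IsFixedPt.iterate (f := (Ta a)^[p]) h.fixed i
  rw [Function.iterate_mul, hfix]
  simpa using hs

/-- The points making exactly `k` further consecutive visits to the ball decouple from the remaining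
part of the process. -/
theorem tendsto_procLap_shell (ha : 0 < a) (hp : 1 ≤ p) (hHm : Measurable H)
    [IsProbabilityMeasure (volume.withDensity H)] (hErg : Ergodic (Ta a) (volume.withDensity H))
    (h : LocalExpansion a ζ p δ l L) (hH : Harnack H {y | 0 < |y - ζ| ∧ |y - ζ| < δ})
    (hQ0 : 0 < Q) (hQ : MassLim (volume.withDensity H) ζ Q) {r : ℕ → ℝ}
    (hr : Tendsto r atTop (𝓝[>] 0)) (hrpos : ∀ n, 0 < r n) (hμ : μ = volume.withDensity H)
    (ks : List ℕ) (k : ℕ) :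
    Tendsto (fun n => (∫ x in tube a ζ p (r n) k \ tube a ζ p (r n) (k + 1),
        procLap (Ta a) (Metric.ball ζ (r n)) (μ (Metric.ball ζ (r n))) ks x ∂μ -
        μ.real (tube a ζ p (r n) k \ tube a ζ p (r n) (k + 1)) * ∫ y, procLap (Ta a)
          (Metric.ball ζ (r n)) (μ (Metric.ball ζ (r n))) (ks.drop k) y ∂μ) /
        μ.real (Metric.ball ζ (r n))) atTop (𝓝 0) := by
  have hprob : IsProbabilityMeasure μ := hμ ▸ inferInstance
  have hside : ∀ σ : ℝ, σ ^ 2 = 1 → Harnack H {y | 0 < σ * (y - ζ) ∧ σ * (y - ζ) < δ} := by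
    intro σ hσ
    have habs : |σ| = 1 := by
      rw [← sq_eq_sq₀ (abs_nonneg σ) zero_le_one, sq_abs, hσ, one_pow]
    refine hH.mono fun y hy => ?_
    have h1 : |y - ζ| = σ * (y - ζ) := by
      rw [← abs_of_pos hy.1, abs_mul, habs, one_mul]
    exact ⟨h1 ▸ hy.1, h1 ▸ hy.2⟩
  have h1 := tendsto_procLap_side ha hp hHm hErg h (σ := 1) (by norm_num) (hside 1 (by norm_num))
    hQ0 hQ hr hrpos hμ ks k
  have h2 := tendsto_procLap_side ha hp hHm hErg h (σ := -1) (by norm_num) (hside _ (by norm_num))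
    hQ0 hQ hr hrpos hμ ks k
  have h3 := h1.add h2
  rw [add_zero] at h3
  refine h3.congr fun n => ?_
  rw [← add_div]
  congr 1
  set U := tube a ζ p (r n) k \ tube a ζ p (r n) (k + 1) with hU
  have hi : Integrable (procLap (Ta a) (Metric.ball ζ (r n)) (μ (Metric.ball ζ (r n))) ks) μ :=
    integrable_procLap (measurable_Ta a) Metric.isOpen_ball.measurableSet _ _
  set J := ∫ y, procLap (Ta a) (Metric.ball ζ (r n)) (μ (Metric.ball ζ (r n))) (ks.drop k) y ∂μ
  have hUm : MeasurableSet U := (measurableSet_tube k).diff (measurableSet_tube (k + 1))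
  have hsm : ∀ σ : ℝ, MeasurableSet (U ∩ {y | 0 < σ * (y - ζ)}) := fun σ =>
    hUm.inter (measurableSet_lt measurable_const (measurable_side σ ζ))
  have hiJ : Integrable (fun x =>
      procLap (Ta a) (Metric.ball ζ (r n)) (μ (Metric.ball ζ (r n))) ks x - J) μ :=
    hi.sub (integrable_const J)
  have hunion : U = (U ∩ {y | 0 < 1 * (y - ζ)}) ∪ (U ∩ {y | 0 < -1 * (y - ζ)}) := by
    refine Subset.antisymm (fun y hy => ?_) (by simp)
    rcases lt_trichotomy y ζ with hlt | heq | hgt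
    · exact Or.inr ⟨hy, show 0 < -1 * (y - ζ) by linarith⟩
    · exact absurd (heq ▸ h.mem_tube (hrpos n) (k + 1)) hy.2
    · exact Or.inl ⟨hy, show 0 < 1 * (y - ζ) by linarith⟩
  have hdisj : Disjoint (U ∩ {y | 0 < 1 * (y - ζ)}) (U ∩ {y | 0 < -1 * (y - ζ)}) := by
    rw [Set.disjoint_left]
    rintro y ⟨_, hy⟩ ⟨_, hy'⟩
    have hy : 0 < 1 * (y - ζ) := hy
    have hy' : 0 < -1 * (y - ζ) := hy'
    linarith
  rw [← setIntegral_union hdisj (hsm _) hiJ.integrableOn hiJ.integrableOn, ← hunion,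
    integral_sub hi.integrableOn (integrable_const J).integrableOn, setIntegral_const, smul_eq_mul]

/-- Points making as many consecutive visits as there are coordinates contribute their full mass. -/
theorem tendsto_procLap_core (hp : 1 ≤ p) [IsProbabilityMeasure μ]
    (h : LocalExpansion a ζ p δ l L) {r : ℕ → ℝ} (hr : Tendsto r atTop (𝓝 0))
    (hc : Tendsto (fun n => μ.real (Metric.ball ζ (r n))) atTop (𝓝 0)) (ks : List ℕ) :
    Tendsto (fun n => (∫ x in tube a ζ p (r n) ks.length,
        procLap (Ta a) (Metric.ball ζ (r n)) (μ (Metric.ball ζ (r n))) ks x ∂μ -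
        μ.real (tube a ζ p (r n) ks.length)) / μ.real (Metric.ball ζ (r n))) atTop (𝓝 0) := by
  set m := ks.length with hm
  have hb := hc.const_mul ((p * m * ks.sum : ℕ) : ℝ)
  rw [mul_zero] at hb
  refine squeeze_zero_norm' ?_ hb
  filter_upwards [hr.eventually_lt_const h.pos] with n hn
  set B := Metric.ball ζ (r n)
  set W := tube a ζ p (r n) m
  have hi : Integrable (procLap (Ta a) B (μ B) ks) μ :=
    integrable_procLap (measurable_Ta a) Metric.isOpen_ball.measurableSet _ _
  have hWm : MeasurableSet W := measurableSet_tube m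
  have hbd : ‖∫ x in W, (procLap (Ta a) B (μ B) ks x - 1) ∂μ‖ ≤
      (p * m * ks.sum : ℕ) * μ.real B * μ.real W := by
    refine norm_setIntegral_le_of_norm_le_const (measure_lt_top _ _) fun x hx => ?_
    have hv : numVisits (Ta a) B (p * m) x = m :=
      h.numVisits_eq hp hn.le m m hx le_rfl (fun hlt => absurd hlt (lt_irrefl _))
        fun i hi => (hx i hi.le).trans hn
    have := abs_procLap_sub_le (Ta a) B (measure_ne_top μ B) ks hv
    rwa [hm, List.drop_length, procLap_nil] at this
  rw [integral_sub hi.integrableOn (integrable_const 1).integrableOn, setIntegral_const, smul_eq_mul,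
    mul_one] at hbd
  rw [norm_div, Real.norm_of_nonneg (measureReal_nonneg (μ := μ) (s := B))]
  refine div_le_of_le_mul₀ measureReal_nonneg (by positivity) (hbd.trans ?_)
  exact mul_le_mul_of_nonneg_left (measureReal_mono (tube_subset_ball m)) (by positivity)

theorem exists_forall_punctured_notMem {S : Set ℝ} (hS : S.Finite) (ζ : ℝ) :
    ∀ᶠ δ in 𝓝[>] (0 : ℝ), ∀ y, 0 < |y - ζ| → |y - ζ| < δ → y ∉ S := by
  have hcl : IsClosed (S \ {ζ}) := (hS.subset sdiff_subset).isClosed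
  obtain ⟨ε, hε, hsub⟩ := Metric.isOpen_iff.1 hcl.isOpen_compl ζ (by simp)
  filter_upwards [Ioo_mem_nhdsGT hε] with δ hδ y hy0 hy hyS
  refine hsub (show y ∈ Metric.ball ζ ε from ?_) ⟨hyS, fun h => ?_⟩
  · rw [Metric.mem_ball, Real.dist_eq]
    exact hy.trans hδ.2
  · rw [mem_singleton_iff.1 h, sub_self, abs_zero] at hy0
    exact lt_irrefl _ hy0

theorem tendsto_tube_div [IsFiniteMeasure μ] {D : ℝ} (h : LocalExpansion a ζ p δ l L)
    (hD : HasDerivAt ((Ta a)^[p]) D ζ) (hD0 : D ≠ 0) (hQ0 : 0 < Q) (hQ : MassLim μ ζ Q)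
    {r : ℕ → ℝ} (hr : Tendsto r atTop (𝓝[>] 0)) (k : ℕ) :
    Tendsto (fun n => μ.real (tube a ζ p (r n) k) / μ.real (Metric.ball ζ (r n))) atTop
      (𝓝 ((|D| ^ (-(1 / 2) : ℝ)) ^ k)) := by
  have h1 := ((tendsto_measureReal_tube h hD hD0 hQ k).comp hr).div (hQ.comp hr) hQ0.ne'
  have hval : √(|D| ^ k)⁻¹ = (|D| ^ (-(1 / 2) : ℝ)) ^ k := by
    rw [Real.rpow_neg (abs_nonneg D), ← Real.sqrt_eq_rpow, Real.sqrt_inv, inv_pow]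
    congr 1
    rw [Real.sqrt_eq_iff_mul_self_eq (by positivity) (by positivity), ← mul_pow,
      Real.mul_self_sqrt (abs_nonneg D)]
  rw [mul_div_cancel_left₀ _ hQ0.ne', hval] at h1
  refine h1.congr' ?_
  filter_upwards [hr self_mem_nhdsWithin] with n hn
  have hn : 0 < r n := hn
  have := Real.sqrt_pos.2 hn
  simp only [Pi.div_apply, Function.comp_apply]
  field_simp

end Assembly

/-- For a Misiurewicz–Thurston quadratic map and a periodic point `ζ` of
prime period `p` belonging to the critical orbit, with `θ = 1 - |(T_a^p)'(ζ)|^{-1/2}`, the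
rescaled interarrival process of shrinking balls `B_n` around `ζ` with `n μ(B_n) → τ > 0`
converges in distribution under `μ` to `ν_θ`, the interarrival law of a compound Poisson
process of intensity `θ` with Geometric(θ) multiplicity distribution. -/
theorem statement7 (a : ℝ) (ha : a ∈ Set.Ioc (0 : ℝ) 2)
    (hMis : ∃ k, 1 ≤ k ∧ ∃ p, 1 ≤ p ∧ (Ta a)^[k + p] 0 = (Ta a)^[k] 0)
    (hnotper : ∀ m, 1 ≤ m → (Ta a)^[m] 0 ≠ 0)
    (μ : Measure ℝ) [IsProbabilityMeasure μ] (hErg : Ergodic (Ta a) μ)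
    (hac : μ ≪ MeasureTheory.volume)
    (ζ : ℝ) (hζ : ζ ∈ Set.Icc (1 - a) 1)
    (p : ℕ) (hp : 1 ≤ p) (hper : (Ta a)^[p] ζ = ζ)
    (hprime : ∀ j, 1 ≤ j → j < p → (Ta a)^[j] ζ ≠ ζ)
    (hcrit : ∃ m : ℕ, (Ta a)^[m] 0 = ζ)
    (r : ℕ → ℝ) (hrpos : ∀ n, 0 < r n) (hr0 : Tendsto r atTop (𝓝 0))
    (τ : ℝ) (hτ : 0 < τ)
    (hlim : Tendsto (fun n : ℕ => (n : ℝ≥0∞) * μ (Metric.ball ζ (r n))) atTop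
      (𝓝 (ENNReal.ofReal τ))) :
    ∀ ν : Measure (ℕ → ℝ≥0∞),
      IsNuTheta (1 - |deriv ((Ta a)^[p]) ζ| ^ (-(1/2) : ℝ)) ν →
      ConvInDist (fun _ => μ)
        (fun n x => rescaledProcess (Ta a) (Metric.ball ζ (r n))
          (μ (Metric.ball ζ (r n))) x) ν := by
  intro ν hν
  obtain ⟨k₀, -, p', hp', hMis'⟩ := hMis
  obtain ⟨m, hm⟩ := hcrit
  have hfin := finite_postCrit_of_preperiodic hp' hMis'
  obtain ⟨H, hHm, hH, hμ⟩ := exists_harnack_density ha.1 hfin hErg.toMeasurePreserving hac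
  have hprob : IsProbabilityMeasure (volume.withDensity H) := hμ ▸ inferInstance
  have hErg' : Ergodic (Ta a) (volume.withDensity H) := hμ ▸ hErg
  obtain ⟨hexp, Q, hQ0, hQ⟩ := exists_massLim_periodic ha.1 hHm hErg'.toMeasurePreserving hH hnotper
    hp' hMis' hp hper hm
  have hζV : ζ ∈ postCrit a := by
    rcases m with _ | m
    · exact absurd (by rw [← hm] at hper; exact hper) (hnotper p hp)
    · exact ⟨m, hm⟩
  have h0 : ∀ j, (Ta a)^[j] ζ ≠ 0 := fun j hj => by
    obtain ⟨i, hi⟩ := iterate_mem_postCrit hζV j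
    exact hnotper (i + 1) (by omega) (hi.trans hj)
  obtain ⟨l, L, hloc⟩ := exists_localExpansion ha.1 hper hprime h0 hexp
  obtain ⟨δ, h, hδ⟩ := (hloc.and (exists_forall_punctured_notMem hfin ζ)).exists
  have hH' : Harnack H {y | 0 < |y - ζ| ∧ |y - ζ| < δ} := hH.mono fun y hy => hδ y hy.1 hy.2
  have hr : Tendsto r atTop (𝓝[>] 0) := tendsto_nhdsWithin_iff.2 ⟨hr0, Eventually.of_forall hrpos⟩
  have hQμ : MassLim μ ζ Q := hμ ▸ hQ
  have hlimQ : Tendsto (fun n => μ.real (Metric.ball ζ (r n)) / √(r n)) atTop (𝓝 Q) := hQμ.comp hr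
  have hpos : ∀ᶠ n in atTop, 0 < μ.real (Metric.ball ζ (r n)) := by
    filter_upwards [hlimQ.eventually_const_lt hQ0] with n hn
    exact (div_pos_iff_of_pos_right (Real.sqrt_pos.2 (hrpos n))).1 hn
  have hc : Tendsto (fun n => μ.real (Metric.ball ζ (r n))) atTop (𝓝 0) := by
    have h1 : Tendsto (fun n => √(r n)) atTop (𝓝 0) := by
      simpa [Function.comp_def] using (Real.continuous_sqrt.tendsto 0).comp hr0
    have h2 := hlimQ.mul h1
    rw [mul_zero] at h2
    exact h2.congr fun n => div_mul_cancel₀ _ (Real.sqrt_pos.2 (hrpos n)).ne'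
  set D := deriv ((Ta a)^[p]) ζ with hD
  have hDabs : 1 < |D| := by rw [hD, abs_deriv_iterate_Ta ha.1]; exact hexp
  have hderiv : HasDerivAt ((Ta a)^[p]) D ζ :=
    (hasDerivAt_iterate_Ta a p ζ).differentiableAt.hasDerivAt
  set θ := 1 - |D| ^ (-(1 / 2) : ℝ) with hθdef
  have hθ' : 1 - θ = |D| ^ (-(1 / 2) : ℝ) := by rw [hθdef]; ring
  have hθ : 0 < θ := sub_pos.2 (Real.rpow_lt_one_of_one_lt_of_neg hDabs (by norm_num))
  have hθ1 : θ ≤ 1 := sub_le_self _ (Real.rpow_nonneg (abs_nonneg D) _)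
  have hB : ∀ n, MeasurableSet (Metric.ball ζ (r n)) := fun n => Metric.isOpen_ball.measurableSet
  have hlap := procLap_limits hErg.toMeasurePreserving hB hpos hc hθ fun ks =>
    procLap_expansion (measurable_Ta a) hB (W := fun n k => tube a ζ p (r n) k)
      (fun n k => measurableSet_tube k) (fun n => tube_zero) (fun n k => tube_succ_subset k)
      (fun k => hθ' ▸ tendsto_tube_div h hderiv (abs_pos.1 (one_pos.trans hDabs)) hQ0 hQμ hr k)
      (fun k _ => tendsto_procLap_shell ha.1 hp hHm hErg' h hH' hQ0 hQ hr hrpos hμ ks k)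
      (tendsto_procLap_core hp h hr0 hc ks)
  have hνprob := hν.1
  refine convInDist_of_lap μ _ (fun n => measurable_rescaledProcess _ _ (measurable_Ta a) (hB n) _)
    ν fun ks => ?_
  rcases ks with _ | ⟨k, ks⟩
  · simp [lap]
  · rw [integral_lap_nuTheta hθ hθ1 hν]
    exact (hlap ks).2 k
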